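/- arXiv:1211.2374 — 3 statements merged into one kernel-verified Lean document; each statement's English description precedes it below -/
import Mathlib

section
/- For every real $c_0>0$ and every integer $d\ge 3$ there exists a constant $c=c(c_0,d)>0$ with the following property. Let $G$ be a finite $d$-regular simple graph on vertex set $V$ that is a $c_0$-expander, i.e. for every $H\subseteq V$ the number of edges between $H$ and $V\setminus H$ is at least $c_0|H||V\setminus H|/|V|$. Let $M$ be a matching in $G$ that leaves at least two vertices unmatched, let $0<\varepsilon\le 1/2$, and suppose that at least $\varepsilon|V|$ vertices are unmatched. Then either there is an augmenting path for $M$ with at most $c\,(\log(1/\varepsilon))^3$ edges (a path in $G$ of odd length, with both endpoints unmatched, whose edges lie alternately outside and inside $M$, the first one outside), or there exists a set $H\subseteq V$ with $|H|\ge 3$, $|H|$ odd, $|V\setminus H|\ge 2$, and at most $d$ edges between $H$ and $V\setminus H$. -/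
namespace ExpanderMatching

variable {V : Type*}

/-- `p` is an alternating path with respect to `M`: a path whose edges are alternately
outside and inside `M`, the first one being outside `M`. -/
def IsAlternatingPath {G : SimpleGraph V} (M : G.Subgraph) {x y : V} (p : G.Walk x y) : Prop :=
  p.IsPath ∧ ∀ i < p.length, (M.Adj (p.getVert i) (p.getVert (i + 1)) ↔ Odd i)

/-- `p` is an augmenting path for `M`: an alternating path of odd length with both
endpoints unmatched. -/
def IsAugmentingPath {G : SimpleGraph V} (M : G.Subgraph) {x y : V} (p : G.Walk x y) : Prop :=
  IsAlternatingPath M p ∧ Odd p.length ∧ x ∉ M.verts ∧ y ∉ M.verts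

/-- The number of edges of `G` between `H` and its complement. Each such edge is counted
once, as the pair (endpoint in `H`, endpoint outside `H`). -/
def cutSize [Fintype V] [DecidableEq V] (G : SimpleGraph V) [DecidableRel G.Adj]
    (H : Finset V) : ℕ :=
  (G.interedges H Hᶜ).card

/-- `G` is a `c₀`-expander. -/
def IsExpander [Fintype V] [DecidableEq V] (c₀ : ℝ) (G : SimpleGraph V)
    [DecidableRel G.Adj] : Prop :=
  ∀ H : Finset V, c₀ * (H.card : ℝ) * (Hᶜ.card : ℝ) / (Fintype.card V : ℝ) ≤ (cutSize G H : ℝ)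

end ExpanderMatching

namespace ExpanderMatching

variable {V : Type*}

/-- The vertices `p 0, …, p l` form a path in `G` whose edges lie alternately outside and inside
the matching given by the mate function `m`, the first one outside. -/
structure AltPath (G : SimpleGraph V) (m : V → V) (p : ℕ → V) (l : ℕ) : Prop where
  inj : ∀ i ≤ l, ∀ j ≤ l, p i = p j → i = j
  adj : ∀ i < l, G.Adj (p i) (p (i + 1))
  alt : ∀ i < l, (m (p i) = p (i + 1) ↔ Odd i)

/-- Follow `p` up to index `k`, then `q` forwards from index `j`. -/
def fwd (p : ℕ → V) (k : ℕ) (q : ℕ → V) (j : ℕ) : ℕ → V :=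
  fun i => if i ≤ k then p i else q (j + (i - k))

/-- Follow `p` up to index `k`, then `q` backwards from index `j`. -/
def bwd (p : ℕ → V) (k : ℕ) (q : ℕ → V) (j : ℕ) : ℕ → V :=
  fun i => if i ≤ k then p i else q (j - (i - k))

variable {G : SimpleGraph V} {m : V → V} {p q : ℕ → V} {k l j s : ℕ}

theorem fwd_of_le {i : ℕ} (h : i ≤ k) : fwd p k q j i = p i := by simp [fwd, h]

theorem fwd_of_ge (hpq : p k = q j) {i : ℕ} (h : k ≤ i) :
    fwd p k q j i = q (j + (i - k)) := by
  rcases h.eq_or_lt with rfl | h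
  · simp [fwd, hpq]
  · simp [fwd, not_le.2 h]

theorem bwd_of_le {i : ℕ} (h : i ≤ k) : bwd p k q j i = p i := by simp [bwd, h]

theorem bwd_of_ge (hpq : p k = q j) {i : ℕ} (h : k ≤ i) :
    bwd p k q j i = q (j - (i - k)) := by
  rcases h.eq_or_lt with rfl | h
  · simp [bwd, hpq]
  · simp [bwd, not_le.2 h]

theorem forall_fwd (hpq : p k = q j) {Q : V → Prop} (hp : ∀ i ≤ k, Q (p i))
    (hq : ∀ i, j ≤ i → i ≤ l → Q (q i)) : ∀ i ≤ k + (l - j), Q (fwd p k q j i) := by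
  intro i hi
  rcases le_or_gt i k with h | h
  · rw [fwd_of_le h]; exact hp i h
  · rcases le_or_gt j l with hjl | hjl
    · rw [fwd_of_ge hpq h.le]; exact hq _ (by omega) (by omega)
    · omega

theorem forall_bwd (hpq : p k = q j) {Q : V → Prop} (hp : ∀ i ≤ k, Q (p i))
    (hq : ∀ i, s ≤ i → i ≤ j → Q (q i)) : ∀ i ≤ k + (j - s), Q (bwd p k q j i) := by
  intro i hi
  rcases le_or_gt i k with h | h
  · rw [bwd_of_le h]; exact hp i h
  · rw [bwd_of_ge hpq h.le]; exact hq _ (by omega) (by omega)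

theorem AltPath.mono (hp : AltPath G m p l) (hk : k ≤ l) : AltPath G m p k :=
  ⟨fun i hi j hj => hp.inj i (hi.trans hk) j (hj.trans hk), fun i hi => hp.adj i (by omega),
    fun i hi => hp.alt i (by omega)⟩

theorem AltPath.nil : AltPath G m p 0 :=
  ⟨fun i hi j hj _ => by omega, fun i hi => by omega, fun i hi => by omega⟩

theorem AltPath.fwd (hp : AltPath G m p k) (hq : AltPath G m q l) (hj : j ≤ l) (h : p k = q j)
    (hpar : Even (k + j)) (hd : ∀ i < k, ∀ i', j ≤ i' → i' ≤ l → p i ≠ q i') :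
    AltPath G m (fwd p k q j) (k + (l - j)) := by
  refine ⟨?_, ?_, ?_⟩
  · have key : ∀ i i', i ≤ i' → i' ≤ k + (l - j) →
        ExpanderMatching.fwd p k q j i = ExpanderMatching.fwd p k q j i' → i = i' := by
      intro i i' hii hi' he
      rcases le_or_gt i' k with h1 | h1
      · rw [fwd_of_le h1, fwd_of_le (by omega)] at he
        exact hp.inj i (by omega) i' h1 he
      · rw [fwd_of_ge h h1.le] at he
        rcases lt_or_ge i k with h2 | h2
        · rw [fwd_of_le h2.le] at he
          exact absurd he (hd i h2 _ (by omega) (by omega))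
        · rw [fwd_of_ge h h2] at he
          have := hq.inj _ (by omega) _ (by omega) he
          omega
    intro i hi i' hi' he
    rcases le_total i i' with h1 | h1
    · exact key i i' h1 hi' he
    · exact (key i' i h1 hi he.symm).symm
  · intro i hi
    rcases lt_or_ge i k with h1 | h1
    · rw [fwd_of_le h1.le, fwd_of_le (by omega)]; exact hp.adj i h1
    · rw [fwd_of_ge h h1, fwd_of_ge h (by omega), show j + (i + 1 - k) = j + (i - k) + 1 by omega]
      exact hq.adj _ (by omega)
  · intro i hi
    rcases lt_or_ge i k with h1 | h1
    · rw [fwd_of_le h1.le, fwd_of_le (by omega)]; exact hp.alt i h1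
    · rw [fwd_of_ge h h1, fwd_of_ge h (by omega), show j + (i + 1 - k) = j + (i - k) + 1 by omega,
        hq.alt _ (by omega)]
      grind

theorem AltPath.bwd (hinv : ∀ v, m (m v) = v) (hp : AltPath G m p k) (hq : AltPath G m q l)
    (hj : j ≤ l) (hs : s ≤ j) (h : p k = q j)
    (hpar : Odd (k + j)) (hd : ∀ i < k, ∀ i', s ≤ i' → i' ≤ j → p i ≠ q i') :
    AltPath G m (bwd p k q j) (k + (j - s)) := by
  refine ⟨?_, ?_, ?_⟩
  · have key : ∀ i i', i ≤ i' → i' ≤ k + (j - s) →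
        ExpanderMatching.bwd p k q j i = ExpanderMatching.bwd p k q j i' → i = i' := by
      intro i i' hii hi' he
      rcases le_or_gt i' k with h1 | h1
      · rw [bwd_of_le h1, bwd_of_le (by omega)] at he
        exact hp.inj i (by omega) i' h1 he
      · rw [bwd_of_ge h h1.le] at he
        rcases lt_or_ge i k with h2 | h2
        · rw [bwd_of_le h2.le] at he
          exact absurd he (hd i h2 _ (by omega) (by omega))
        · rw [bwd_of_ge h h2] at he
          have := hq.inj _ (by omega) _ (by omega) he
          omega
    intro i hi i' hi' he
    rcases le_total i i' with h1 | h1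
    · exact key i i' h1 hi' he
    · exact (key i' i h1 hi he.symm).symm
  · intro i hi
    rcases lt_or_ge i k with h1 | h1
    · rw [bwd_of_le h1.le, bwd_of_le (by omega)]; exact hp.adj i h1
    · rw [bwd_of_ge h h1, bwd_of_ge h (by omega),
        show j - (i - k) = j - (i + 1 - k) + 1 by omega]
      exact (hq.adj _ (by omega)).symm
  · intro i hi
    rcases lt_or_ge i k with h1 | h1
    · rw [bwd_of_le h1.le, bwd_of_le (by omega)]; exact hp.alt i h1
    · rw [bwd_of_ge h h1, bwd_of_ge h (by omega),
        show j - (i - k) = j - (i + 1 - k) + 1 by omega]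
      have := hq.alt (j - (i + 1 - k)) (by omega)
      have e : (m (q (j - (i + 1 - k) + 1)) = q (j - (i + 1 - k))) ↔
          (m (q (j - (i + 1 - k))) = q (j - (i + 1 - k) + 1)) :=
        ⟨fun e => by rw [← e, hinv], fun e => by rw [← e, hinv]⟩
      rw [e, this]
      obtain ⟨c, hc⟩ : ∃ c, i = k + c := ⟨i - k, by omega⟩
      subst hc
      have : j - (k + c + 1 - k) + c + 1 = j := by omega
      generalize j - (k + c + 1 - k) = z at *
      subst this
      grind

/-- Extend an alternating path of even length by one vertex. -/
theorem AltPath.snoc (hp : AltPath G m p k) (hk : Even k) {v : V} (hv : ∀ i ≤ k, p i ≠ v)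
    (ha : G.Adj (p k) v) (hm : m (p k) ≠ v) :
    AltPath G m (fun i => if i ≤ k then p i else v) (k + 1) := by
  refine ⟨?_, ?_, ?_⟩
  · intro i hi j hj he
    split_ifs at he with h1 h2 h2
    · exact hp.inj i h1 j h2 he
    · exact absurd he (hv i h1)
    · exact absurd he.symm (hv j h2)
    · omega
  · intro i hi
    rcases lt_or_ge i k with h1 | h1
    · rw [if_pos h1.le, if_pos (by omega)]; exact hp.adj i h1
    · obtain rfl : i = k := by omega
      simpa using ha
  · intro i hi
    rcases lt_or_ge i k with h1 | h1
    · rw [if_pos h1.le, if_pos (by omega)]; exact hp.alt i h1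
    · obtain rfl : i = k := by omega
      have : ¬ Odd i := by grind
      simp [hm, this]

/-- Extend an alternating path of odd length by the mate of its last vertex. -/
theorem AltPath.snoc_mate (hp : AltPath G m p k) (hk : Odd k)
    (hv : ∀ i ≤ k, p i ≠ m (p k)) (ha : G.Adj (p k) (m (p k))) :
    AltPath G m (fun i => if i ≤ k then p i else m (p k)) (k + 1) := by
  refine ⟨?_, ?_, ?_⟩
  · intro i hi j hj he
    split_ifs at he with h1 h2 h2
    · exact hp.inj i h1 j h2 he
    · exact absurd he (hv i h1)
    · exact absurd he.symm (hv j h2)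
    · omega
  · intro i hi
    rcases lt_or_ge i k with h1 | h1
    · rw [if_pos h1.le, if_pos (by omega)]; exact hp.adj i h1
    · obtain rfl : i = k := by omega
      simpa using ha
  · intro i hi
    rcases lt_or_ge i k with h1 | h1
    · rw [if_pos h1.le, if_pos (by omega)]; exact hp.alt i h1
    · obtain rfl : i = k := by omega
      simp [hk]

theorem AltPath.reverse (hinv : ∀ v, m (m v) = v) (hq : AltPath G m q l) (hl : Odd l) :
    AltPath G m (fun i => q (l - i)) l := by
  have := AltPath.bwd (p := fun _ => q l) (k := 0) (s := 0) hinv AltPath.nil hq le_rfl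
    (Nat.zero_le l) rfl (by simpa using hl) (by simp)
  have e : ExpanderMatching.bwd (fun _ => q l) 0 q l = fun i => q (l - i) := by
    funext i
    rw [bwd_of_ge (p := fun _ => q l) (q := q) (j := l) rfl (Nat.zero_le i)]; simp
  rw [e] at this
  simpa using this

theorem AltPath.mate_odd (hq : AltPath G m q l) (hj : j < l) (ho : Odd j) :
    m (q j) = q (j + 1) := (hq.alt j hj).2 ho

theorem AltPath.mate_even (hinv : ∀ v, m (m v) = v) (hq : AltPath G m q l) (hj : j + 1 ≤ l)
    (ho : Odd j) : m (q (j + 1)) = q j := by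
  rw [← (hq.alt j (by omega)).2 ho, hinv]

theorem AltPath.mate_mem (hinv : ∀ v, m (m v) = v) (hq : AltPath G m q l) (hl : Even l)
    (h1 : 1 ≤ j) (h2 : j ≤ l) : ∃ i, 1 ≤ i ∧ i ≤ l ∧ m (q j) = q i := by
  rcases Nat.even_or_odd j with hj | hj
  · obtain ⟨i, rfl⟩ : ∃ i, j = i + 1 := ⟨j - 1, by omega⟩
    exact ⟨i, by grind, by omega, hq.mate_even hinv h2 (by grind)⟩
  · exact ⟨j + 1, by omega, by grind, hq.mate_odd (by grind) hj⟩

/-- If `p` meets a mate-closed segment of `q`, then the first meeting occurs at an odd index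
of `p`. -/
theorem AltPath.first_touch_segment (hinv : ∀ v, m (m v) = v) {a b : ℕ}
    (hp : AltPath G m p k)
    (hcl : ∀ j, a ≤ j → j ≤ b → ∃ i, a ≤ i ∧ i ≤ b ∧ m (q j) = q i)
    (hex : ∃ i ≤ k, ∃ j, a ≤ j ∧ j ≤ b ∧ p i = q j)
    (h0 : ∀ j, a ≤ j → j ≤ b → p 0 ≠ q j) :
    ∃ i ≤ k, Odd i ∧ (∃ j, a ≤ j ∧ j ≤ b ∧ p i = q j) ∧
      ∀ i' < i, ∀ j, a ≤ j → j ≤ b → p i' ≠ q j := by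
  classical
  have hex' : ∃ i, i ≤ k ∧ ∃ j, a ≤ j ∧ j ≤ b ∧ p i = q j := hex
  obtain ⟨hk, j, hj1, hj2, hj⟩ := Nat.find_spec hex'
  have hmin : ∀ i' < Nat.find hex', ∀ j, a ≤ j → j ≤ b → p i' ≠ q j := by
    intro i' hi' j h1 h2 he
    exact Nat.find_min hex' hi' ⟨by omega, j, h1, h2, he⟩
  refine ⟨Nat.find hex', hk, ?_, ⟨j, hj1, hj2, hj⟩, hmin⟩
  generalize Nat.find hex' = i at *
  by_contra hodd
  rcases Nat.eq_zero_or_pos i with rfl | hpos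
  · exact h0 j hj1 hj2 hj
  · obtain ⟨i, rfl⟩ : ∃ i', i = i' + 1 := ⟨i - 1, by omega⟩
    obtain ⟨j', h1, h2, h3⟩ := hcl j hj1 hj2
    refine hmin i (by omega) j' h1 h2 ?_
    rw [← h3, ← hj, hp.mate_even hinv hk (by grind)]

theorem AltPath.first_touch (hinv : ∀ v, m (m v) = v) (hp : AltPath G m p k)
    (hq : AltPath G m q l) (hl : Even l)
    (hex : ∃ i ≤ k, ∃ j, 1 ≤ j ∧ j ≤ l ∧ p i = q j)
    (h0 : ∀ j, 1 ≤ j → j ≤ l → p 0 ≠ q j) :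
    ∃ i ≤ k, Odd i ∧ (∃ j, 1 ≤ j ∧ j ≤ l ∧ p i = q j) ∧
      ∀ i' < i, ∀ j, 1 ≤ j → j ≤ l → p i' ≠ q j :=
  hp.first_touch_segment hinv (fun _ h1 h2 => hq.mate_mem hinv hl h1 h2) hex h0

end ExpanderMatching

namespace ExpanderMatching

variable {V : Type*}

/-- A search instance: `A` is the set of vertices that may be visited, `U` the set of roots.
All vertices of `A` that are not roots are matched within `A`, the roots are not. -/
structure SearchInstance (G : SimpleGraph V) (m : V → V) (A U : Finset V) : Prop where
  inv : ∀ v, m (m v) = v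
  madj : ∀ v, m v ≠ v → G.Adj v (m v)
  sub : U ⊆ A
  root : ∀ u ∈ U, m u ∈ A → m u = u
  mate : ∀ v ∈ A, v ∉ U → m v ∈ A ∧ m v ≠ v

/-- `v` is the end of an alternating path of length `l` in `A` that starts at a root. -/
def Reach (G : SimpleGraph V) (m : V → V) (A U : Finset V) (l : ℕ) (v : V) : Prop :=
  ∃ p, AltPath G m p l ∧ p 0 ∈ U ∧ (∀ i ≤ l, p i ∈ A) ∧ p l = v

/-- No alternating path of odd length at most `L` joins two roots. -/
def NoAug (G : SimpleGraph V) (m : V → V) (A U : Finset V) (L : ℕ) : Prop :=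
  ∀ u ∈ U, ∀ l ≤ L, Odd l → ¬ Reach G m A U l u

open Classical in
/-- Vertices reached by an alternating path of even length at most `n`. -/
noncomputable def outSet (G : SimpleGraph V) (m : V → V) (A U : Finset V) (n : ℕ) : Finset V :=
  A.filter fun v => ∃ l ≤ n, Even l ∧ Reach G m A U l v

open Classical in
/-- Vertices reached by an alternating path of odd length at most `n`. -/
noncomputable def inSet (G : SimpleGraph V) (m : V → V) (A U : Finset V) (n : ℕ) : Finset V :=
  A.filter fun v => ∃ l ≤ n, Odd l ∧ Reach G m A U l v

/-- The least even length of an alternating path from a root to `v`. -/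
noncomputable def lam (G : SimpleGraph V) (m : V → V) (A U : Finset V) (v : V) : ℕ :=
  sInf {l | Even l ∧ Reach G m A U l v}

variable {G : SimpleGraph V} {m : V → V} {A U : Finset V} {l n n' L : ℕ} {u v w : V}

theorem Reach.mem (h : Reach G m A U l v) : v ∈ A := by
  obtain ⟨p, -, -, hA, rfl⟩ := h
  exact hA l le_rfl

theorem mem_outSet : v ∈ outSet G m A U n ↔ ∃ l ≤ n, Even l ∧ Reach G m A U l v := by
  simp only [outSet, Finset.mem_filter, and_iff_right_iff_imp]
  rintro ⟨l, -, -, h⟩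
  exact h.mem

theorem mem_inSet : v ∈ inSet G m A U n ↔ ∃ l ≤ n, Odd l ∧ Reach G m A U l v := by
  simp only [inSet, Finset.mem_filter, and_iff_right_iff_imp]
  rintro ⟨l, -, -, h⟩
  exact h.mem

theorem outSet_subset : outSet G m A U n ⊆ A := by
  classical exact Finset.filter_subset _ _

theorem inSet_subset : inSet G m A U n ⊆ A := by
  classical exact Finset.filter_subset _ _

theorem outSet_mono (h : n ≤ n') : outSet G m A U n ⊆ outSet G m A U n' := by
  intro v hv
  obtain ⟨l, hl, h1⟩ := mem_outSet.1 hv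
  exact mem_outSet.2 ⟨l, hl.trans h, h1⟩

theorem inSet_mono (h : n ≤ n') : inSet G m A U n ⊆ inSet G m A U n' := by
  intro v hv
  obtain ⟨l, hl, h1⟩ := mem_inSet.1 hv
  exact mem_inSet.2 ⟨l, hl.trans h, h1⟩

theorem lam_spec (h : v ∈ outSet G m A U n) :
    Even (lam G m A U v) ∧ Reach G m A U (lam G m A U v) v := by
  obtain ⟨l, -, h1, h2⟩ := mem_outSet.1 h
  exact Nat.sInf_mem (s := {l | Even l ∧ Reach G m A U l v}) ⟨l, h1, h2⟩

theorem lam_le_of_reach (h1 : Even l) (h2 : Reach G m A U l v) : lam G m A U v ≤ l :=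
  Nat.sInf_le ⟨h1, h2⟩

theorem lam_le (h : v ∈ outSet G m A U n) : lam G m A U v ≤ n := by
  obtain ⟨l, hl, h1, h2⟩ := mem_outSet.1 h
  exact (lam_le_of_reach h1 h2).trans hl

/-- A shortest even alternating path to `v`. -/
theorem exists_path_lam (h : v ∈ outSet G m A U n) : ∃ p, AltPath G m p (lam G m A U v) ∧
    p 0 ∈ U ∧ (∀ i ≤ lam G m A U v, p i ∈ A) ∧ p (lam G m A U v) = v := (lam_spec h).2

theorem reach_of_path {p : ℕ → V} (hp : AltPath G m p l) (h0 : p 0 ∈ U) (hA : ∀ i ≤ l, p i ∈ A)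
    {i : ℕ} (hi : i ≤ l) : Reach G m A U i (p i) :=
  ⟨p, hp.mono hi, h0, fun j hj => hA j (hj.trans hi), rfl⟩

theorem mem_out_of_path {p : ℕ → V} (hp : AltPath G m p l) (h0 : p 0 ∈ U)
    (hA : ∀ i ≤ l, p i ∈ A) {i : ℕ} (hi : i ≤ l) (he : Even i) (hn : i ≤ n) :
    p i ∈ outSet G m A U n := mem_outSet.2 ⟨i, hn, he, reach_of_path hp h0 hA hi⟩

theorem mem_in_of_path {p : ℕ → V} (hp : AltPath G m p l) (h0 : p 0 ∈ U)
    (hA : ∀ i ≤ l, p i ∈ A) {i : ℕ} (hi : i ≤ l) (he : Odd i) (hn : i ≤ n) :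
    p i ∈ inSet G m A U n := mem_inSet.2 ⟨i, hn, he, reach_of_path hp h0 hA hi⟩

theorem Reach.mem_of_zero (h : Reach G m A U 0 v) : v ∈ U := by
  obtain ⟨p, -, h, -, rfl⟩ := h
  exact h

theorem NoAug.root_notMem_in (hN : NoAug G m A U L) (hn : n ≤ L) (hu : u ∈ U) :
    u ∉ inSet G m A U n := by
  intro h
  obtain ⟨l, hl, h1, h2⟩ := mem_inSet.1 h
  exact hN u hu l (hl.trans hn) h1 h2

theorem noAug_singleton : NoAug G m A {u} L := by
  intro u' hu l _ hl h
  rw [Finset.mem_singleton] at hu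
  subst hu
  obtain ⟨p, hp, h0, -, h1⟩ := h
  rw [Finset.mem_singleton] at h0
  have := hp.inj 0 (Nat.zero_le l) l le_rfl (h0.trans h1.symm)
  have := hl.pos
  omega

namespace SearchInstance

theorem mate_notMem_root (I : SearchInstance G m A U) (hv : v ∈ A) (hU : v ∉ U) : m v ∉ U := by
  intro h
  have := I.root _ h (by rwa [I.inv])
  rw [I.inv] at this
  exact (I.mate v hv hU).2 this.symm

theorem root_mem_out (I : SearchInstance G m A U) (hu : u ∈ U) : u ∈ outSet G m A U n :=
  mem_outSet.2 ⟨0, Nat.zero_le n, Even.zero, fun _ => u, AltPath.nil, hu,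
    fun _ _ => I.sub hu, rfl⟩

theorem root_mate_ne (I : SearchInstance G m A U) (hu : u ∈ U) (hv : v ∈ A) (huv : u ≠ v) :
    m u ≠ v := by
  rintro rfl
  exact huv (I.root u hu hv).symm

theorem mate_notMem_path (I : SearchInstance G m A U) {p : ℕ → V} (hp : AltPath G m p l)
    (h0 : p 0 ∈ U) (hA : ∀ i ≤ l, p i ∈ A) (hl : Odd l) (hU : p l ∉ U) : ∀ i ≤ l, p i ≠ m (p l) := by
  intro i hi he
  rcases Nat.eq_zero_or_pos i with rfl | hpos
  · exact I.mate_notMem_root (hA l le_rfl) hU (he ▸ h0)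
  rcases Nat.even_or_odd i with hev | hod
  · obtain ⟨j, rfl⟩ : ∃ j, i = j + 1 := ⟨i - 1, by omega⟩
    have h1 := hp.mate_even I.inv hi (by grind)
    rw [he, I.inv] at h1
    have := hp.inj _ le_rfl _ (by omega) h1
    omega
  · rcases hi.eq_or_lt with rfl | hlt
    · exact (I.mate _ (hA i le_rfl) hU).2 he.symm
    · have h1 := hp.mate_odd hlt hod
      rw [he, I.inv] at h1
      have := hp.inj _ le_rfl _ (by omega) h1
      grind

theorem reach_mate_succ (I : SearchInstance G m A U) (h : Reach G m A U l v) (hl : Odd l)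
    (hU : v ∉ U) : Reach G m A U (l + 1) (m v) := by
  obtain ⟨p, hp, h0, hA, rfl⟩ := h
  have hm := I.mate _ (hA l le_rfl) hU
  refine ⟨_, hp.snoc_mate hl (I.mate_notMem_path hp h0 hA hl hU) (I.madj _ hm.2), by simpa,
    fun i hi => ?_, by simp⟩
  split_ifs with h
  · exact hA i h
  · exact hm.1

theorem reach_mate_pred (I : SearchInstance G m A U) (h : Reach G m A U (l + 1) v) (hl : Odd l) :
    Reach G m A U l (m v) := by
  obtain ⟨p, hp, h0, hA, rfl⟩ := h
  rw [hp.mate_even I.inv le_rfl hl]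
  exact reach_of_path hp h0 hA (Nat.le_succ l)

theorem mate_mem_out (I : SearchInstance G m A U) (hN : NoAug G m A U L) (hn : n ≤ L) (he : Even n)
    (hv : v ∈ inSet G m A U n) : m v ∈ outSet G m A U n := by
  have hU : v ∉ U := fun h => hN.root_notMem_in hn h hv
  obtain ⟨l, hl, h1, h2⟩ := mem_inSet.1 hv
  exact mem_outSet.2 ⟨l + 1, by grind, by grind, I.reach_mate_succ h2 h1 hU⟩

theorem mate_mem_in (I : SearchInstance G m A U) (hU : v ∉ U) (hv : v ∈ outSet G m A U n) :
    m v ∈ inSet G m A U n := by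
  obtain ⟨l, hl, h1, h2⟩ := mem_outSet.1 hv
  rcases Nat.eq_zero_or_pos l with rfl | hpos
  · exact absurd (h2.mem_of_zero) hU
  · obtain ⟨j, rfl⟩ : ∃ j, l = j + 1 := ⟨l - 1, by omega⟩
    exact mem_inSet.2 ⟨j, by omega, by grind, I.reach_mate_pred h2 (by grind)⟩

/-- The set of vertices reached both ways is closed under taking mates. -/
theorem mate_mem_both (I : SearchInstance G m A U) (hN : NoAug G m A U L) (hn : n ≤ L) (he : Even n)
    (hv : v ∈ outSet G m A U n) (hv' : v ∈ inSet G m A U n) :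
    m v ∈ outSet G m A U n ∧ m v ∈ inSet G m A U n ∧ m v ≠ v ∧ v ∉ U := by
  have hU : v ∉ U := fun h => hN.root_notMem_in hn h hv'
  exact ⟨I.mate_mem_out hN hn he hv', I.mate_mem_in hU hv, (I.mate v (outSet_subset hv) hU).2, hU⟩

theorem reach_snoc (I : SearchInstance G m A U) {p : ℕ → V} (hp : AltPath G m p l) (h0 : p 0 ∈ U)
    (hA : ∀ i ≤ l, p i ∈ A) (hl : Even l) (hw : w ∈ A) (ha : G.Adj (p l) w)
    (hwp : ∀ i ≤ l, p i ≠ w) : Reach G m A U (l + 1) w := by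
  refine ⟨_, hp.snoc hl hwp ha ?_, by simpa, fun i hi => ?_, by simp⟩
  · rcases Nat.eq_zero_or_pos l with rfl | hpos
    · exact I.root_mate_ne h0 hw (hwp 0 le_rfl)
    · obtain ⟨j, rfl⟩ : ∃ j, l = j + 1 := ⟨l - 1, by omega⟩
      rw [hp.mate_even I.inv le_rfl (by grind)]
      exact hwp j (by omega)
  · split_ifs with h
    · exact hA i h
    · exact hw

/-- A neighbour in `A` of a vertex reached at even distance is reached one step later. -/
theorem adj_out_reached (I : SearchInstance G m A U) (hv : v ∈ outSet G m A U n) (hw : w ∈ A)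
    (ha : G.Adj v w) (hX : w ∉ outSet G m A U n) (hX' : w ∉ inSet G m A U n) :
    w ∈ inSet G m A U (n + 1) := by
  obtain ⟨p, hp, h0, hA, hpv⟩ := exists_path_lam hv
  have hl := lam_le hv
  have he := (lam_spec hv).1
  refine mem_inSet.2 ⟨lam G m A U v + 1, by omega, he.add_one, ?_⟩
  refine I.reach_snoc hp h0 hA he hw (by rw [hpv]; exact ha) ?_
  rintro i hi rfl
  rcases Nat.even_or_odd i with h | h
  · exact hX (mem_out_of_path hp h0 hA hi h (by omega))
  · exact hX' (mem_in_of_path hp h0 hA hi h (by omega))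

/-- Of two adjacent vertices reached at even distance, one is reached at odd distance one step
later. -/
theorem adj_out_out (I : SearchInstance G m A U) (hv : v ∈ outSet G m A U n)
    (hw : w ∈ outSet G m A U n) (ha : G.Adj v w) :
    v ∈ inSet G m A U (n + 1) ∨ w ∈ inSet G m A U (n + 1) := by
  wlog hle : lam G m A U v ≤ lam G m A U w generalizing v w
  · exact (this hw hv ha.symm (by omega)).symm
  right
  obtain ⟨p, hp, h0, hA, hpv⟩ := exists_path_lam hv
  have hl := lam_le hv
  have he := (lam_spec hv).1
  by_cases hwp : ∀ i ≤ lam G m A U v, p i ≠ w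
  · exact mem_inSet.2 ⟨lam G m A U v + 1, by omega, he.add_one,
      I.reach_snoc hp h0 hA he (outSet_subset hw) (by rw [hpv]; exact ha) hwp⟩
  · push Not at hwp
    obtain ⟨i, hi, rfl⟩ := hwp
    rcases Nat.even_or_odd i with h | h
    · have := lam_le_of_reach h (reach_of_path hp h0 hA hi)
      have hi' : i = lam G m A U v := by omega
      rw [hi', hpv] at ha
      exact absurd ha G.irrefl
    · exact mem_in_of_path hp h0 hA hi h (by omega)

end SearchInstance

end ExpanderMatching

namespace ExpanderMatching

variable {V : Type*}

/-- An alternating path from `x ∈ K` whose other vertices lie in `A` outside `K`. -/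
structure GatePath (G : SimpleGraph V) (m : V → V) (A K : Finset V) (x : V) (R : ℕ → V) (l : ℕ) :
    Prop where
  path : AltPath G m R l
  zero : R 0 = x
  start : x ∈ K
  mem : ∀ i, 1 ≤ i → i ≤ l → R i ∈ A ∧ R i ∉ K

/-- There is an alternating path of length `t` from `x` to `y` whose inner vertices lie in `A`
outside `K`. -/
def GateAug (G : SimpleGraph V) (m : V → V) (A K : Finset V) (x y : V) (t : ℕ) : Prop :=
  ∃ p, AltPath G m p t ∧ p 0 = x ∧ p t = y ∧ ∀ i, 1 ≤ i → i < t → p i ∈ A ∧ p i ∉ K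

variable {G : SimpleGraph V} {m : V → V} {A U K : Finset V} {l l' n w L t : ℕ} {x y v : V}
  {R S : ℕ → V}

theorem GateAug.symm (hinv : ∀ v, m (m v) = v) (h : GateAug G m A K x y t) (ht : Odd t) :
    GateAug G m A K y x t := by
  obtain ⟨p, hp, h0, h1, h2⟩ := h
  exact ⟨_, hp.reverse hinv ht, by simpa using h1, by simpa using h0,
    fun i hi hi' => h2 _ (by omega) (by omega)⟩

namespace GatePath

theorem ne_start (hR : GatePath G m A K x R l) (hy : y ∈ K) {i : ℕ} (h1 : 1 ≤ i) (h2 : i ≤ l) :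
    R i ≠ y := fun h => (hR.mem i h1 h2).2 (h ▸ hy)

theorem ne_other (hR : GatePath G m A K x R l) (hy : y ∈ K) (hxy : x ≠ y) {i : ℕ} (h2 : i ≤ l) :
    R i ≠ y := by
  rcases Nat.eq_zero_or_pos i with rfl | h
  · rw [hR.zero]; exact hxy
  · exact hR.ne_start hy h h2

theorem mono (hR : GatePath G m A K x R l) (h : l' ≤ l) : GatePath G m A K x R l' :=
  ⟨hR.path.mono h, hR.zero, hR.start, fun i h1 h2 => hR.mem i h1 (h2.trans h)⟩

/-- If two gate paths with different starting points meet, then either their starting points are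
joined by an alternating path, or the end of the first is reached from the start of the second. -/
theorem touch (hinv : ∀ v, m (m v) = v) (hR : GatePath G m A K x R l) (hl : Even l)
    (hS : GatePath G m A K y S l') (hxy : x ≠ y) (hmeet : ∃ i ≤ l', ∃ j ≤ l, S i = R j) :
    (∃ t, Odd t ∧ t ≤ l + l' ∧ GateAug G m A K y x t) ∨
    ∃ k ≤ l', ∃ j ≤ l, Odd k ∧ Odd j ∧ S k = R j ∧
      ∀ i < k, ∀ j', 1 ≤ j' → j' ≤ l → S i ≠ R j' := by
  obtain ⟨i0, hi0, j0, hj0, he0⟩ := hmeet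
  have hj0' : 1 ≤ j0 := by
    rcases Nat.eq_zero_or_pos j0 with rfl | h
    · exact absurd (he0.trans hR.zero) (hS.ne_other hR.start hxy.symm hi0)
    · exact h
  obtain ⟨k, hk, hko, ⟨j, hj1, hj2, hj⟩, hfirst⟩ := hS.path.first_touch hinv hR.path hl
    ⟨i0, hi0, j0, hj0', hj0, he0⟩
    (fun j h1 h2 => by rw [hS.zero]; exact (hR.ne_start hS.start h1 h2).symm)
  rcases Nat.even_or_odd j with hje | hjo
  · left
    refine ⟨k + (j - 0), by grind, by omega, _, AltPath.bwd hinv (hS.path.mono hk) hR.path hj2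
      (Nat.zero_le j) hj (by grind) ?_, ?_, ?_, ?_⟩
    · intro i hi j' _ hj'
      rcases Nat.eq_zero_or_pos j' with rfl | h
      · rw [hR.zero]; exact hS.ne_other hR.start hxy.symm (by omega)
      · exact hfirst i hi j' h (by omega)
    · rw [bwd_of_le (Nat.zero_le _), hS.zero]
    · rw [bwd_of_ge hj (by omega), ← hR.zero]; congr 1; omega
    · intro i h1 h2
      rcases le_or_gt i k with h | h
      · rw [bwd_of_le h]; exact hS.mem i h1 (by omega)
      · rw [bwd_of_ge hj h.le]; exact hR.mem _ (by omega) (by omega)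
  · exact Or.inr ⟨k, hk, j, hj2, hko, hjo, hj, hfirst⟩

theorem splice (hR : GatePath G m A K x R l)
    (hS : GatePath G m A K y S l') {k j : ℕ} (hk : k ≤ l') (hj : j ≤ l)
    (hko : Odd k) (hjo : Odd j) (he : S k = R j)
    (hfirst : ∀ i < k, ∀ j', 1 ≤ j' → j' ≤ l → S i ≠ R j') :
    GatePath G m A K y (fwd S k R j) (k + (l - j)) ∧ fwd S k R j (k + (l - j)) = R l := by
  have hj1 : 1 ≤ j := hjo.pos
  refine ⟨⟨(hS.path.mono hk).fwd hR.path hj he (by grind) fun i hi i' h1 h2 =>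
    hfirst i hi i' (by omega) h2, ?_, hS.start, ?_⟩, ?_⟩
  · rw [fwd_of_le (Nat.zero_le _), hS.zero]
  · intro i h1 h2
    rcases le_or_gt i k with h | h
    · rw [fwd_of_le h]; exact hS.mem i h1 (by omega)
    · rw [fwd_of_ge he h.le]; exact hR.mem _ (by omega) (by omega)
  · rw [fwd_of_ge he (by omega)]; congr 1; omega

/-- Two gate paths with different starting points, each of minimal weight for its end, that meet
or have adjacent ends give an alternating path between their starting points. -/
theorem exists_gateAug (hinv : ∀ v, m (m v) = v) {H : V → ℕ} {N : ℕ}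
    (hH : ∀ x ∈ K, ∀ y ∈ K, ∀ a b, H x + N * a = H y + N * b → x = y)
    (hR : GatePath G m A K x R l) (hl : Even l)
    (hRmin : ∀ z Q k, Even k → GatePath G m A K z Q k → Q k = R l → H x + N * l ≤ H z + N * k)
    (hS : GatePath G m A K y S l') (hl' : Even l')
    (hSmin : ∀ z Q k, Even k → GatePath G m A K z Q k → Q k = S l' → H y + N * l' ≤ H z + N * k)
    (hxy : x ≠ y)
    (hmeet : (∃ i ≤ l, ∃ j ≤ l', R i = S j) ∨ (G.Adj (R l) (S l') ∧ m (R l) ≠ S l')) :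
    ∃ t, Odd t ∧ t ≤ l + l' + 1 ∧ GateAug G m A K x y t := by
  by_cases hm : ∃ i ≤ l, ∃ j ≤ l', R i = S j
  · have hm' : ∃ i ≤ l', ∃ j ≤ l, S i = R j := by
      obtain ⟨i, hi, j, hj, h⟩ := hm
      exact ⟨j, hj, i, hi, h.symm⟩
    rcases touch hinv hR hl hS hxy hm' with ⟨t, h1, h2, h3⟩ | ⟨k, hk, j, hj, hko, hjo, he, hf⟩
    · exact ⟨t, h1, by omega, h3.symm hinv h1⟩
    rcases touch hinv hS hl' hR hxy.symm hm with
      ⟨t, h1, h2, h3⟩ | ⟨j', hj', k', hk', hjo', hko', he', hf'⟩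
    · exact ⟨t, h1, by omega, h3⟩
    exfalso
    obtain ⟨g1, g2⟩ := splice hR hS hk hj hko hjo he hf
    obtain ⟨g1', g2'⟩ := splice hS hR hj' hk' hjo' hko' he' hf'
    have i1 := hRmin _ _ _ (by grind) g1 g2
    have i2 := hSmin _ _ _ (by grind) g1' g2'
    have jj : j' ≤ j := by
      by_contra hlt
      exact hf' j (by omega) k hko.pos hk he.symm
    have kk : k ≤ k' := by
      by_contra hlt
      exact hf k' (by omega) j' hjo'.pos hj' he'.symm
    have e1 : N * (k + (l - j)) + N * j = N * k + N * l := by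
      rw [← mul_add, ← mul_add]; congr 1; omega
    have e2 : N * (j' + (l' - k')) + N * k' = N * j' + N * l' := by
      rw [← mul_add, ← mul_add]; congr 1; omega
    have e3 : N * j' ≤ N * j := Nat.mul_le_mul_left _ jj
    have e4 : N * k ≤ N * k' := Nat.mul_le_mul_left _ kk
    exact hxy (hH x hR.start y hS.start j k (by omega))
  · obtain ⟨ha, hmm⟩ := hmeet.resolve_left hm
    push Not at hm
    have hs := hR.path.snoc hl (v := S l') (fun i hi => hm i hi l' le_rfl) ha hmm
    have hb := AltPath.bwd hinv hs hS.path le_rfl (Nat.zero_le l') (by simp) (by grind) ?_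
    · refine ⟨l + 1 + (l' - 0), by grind, by omega, _, hb, ?_, ?_, ?_⟩
      · rw [bwd_of_le (Nat.zero_le _), if_pos (Nat.zero_le _), hR.zero]
      · rw [bwd_of_ge (by simp) (by omega), ← hS.zero]; congr 1; omega
      · intro i h1 h2
        rcases le_or_gt i l with h | h
        · rw [bwd_of_le (by omega), if_pos h]; exact hR.mem i h1 h
        · rw [bwd_of_ge (by simp) (by omega)]; exact hS.mem _ (by omega) (by omega)
    · intro i hi i' _ h2
      rw [if_pos (by omega)]
      exact hm i (by omega) i' h2

end GatePath

section

variable [Fintype V]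

/-- The weight of a vertex as the start of gate paths: its even distance from the roots, with ties
broken by an enumeration of the vertices. -/
noncomputable def gateWeight (G : SimpleGraph V) (m : V → V) (A U : Finset V) (x : V) : ℕ :=
  Fintype.card V * lam G m A U x + (Fintype.equivFin V x).val

theorem gateWeight_inj {a b : ℕ} (h : gateWeight G m A U x + Fintype.card V * a =
    gateWeight G m A U y + Fintype.card V * b) : x = y := by
  have hx := (Fintype.equivFin V x).isLt
  have hy := (Fintype.equivFin V y).isLt
  have h' := congrArg (· % Fintype.card V) h
  simp only [gateWeight, add_assoc, Nat.mul_add_mod, Nat.add_mul_mod_self_left,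
    Nat.mod_eq_of_lt hx, Nat.mod_eq_of_lt hy] at h'
  exact (Fintype.equivFin V).injective (Fin.ext h')

theorem lam_add_le_of_gateWeight_le {a b c d : ℕ}
    (hx : gateWeight G m A U x + Fintype.card V * a ≤ gateWeight G m A U y + Fintype.card V * b)
    (hc : lam G m A U x + a = c) (hd : lam G m A U y + b = d) : c ≤ d := by
  have hy := (Fintype.equivFin V y).isLt
  by_contra hlt
  have : Fintype.card V * (d + 1) ≤ Fintype.card V * c := Nat.mul_le_mul_left _ (by omega)
  rw [← hc, ← hd] at this
  simp only [mul_add, gateWeight] at *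
  omega

end

variable [DecidableEq V]

/-- The vertices reached at even distance at most `n` that are not reached at odd distance at most
`n + w`. -/
noncomputable def gates (G : SimpleGraph V) (m : V → V) (A U : Finset V) (n w : ℕ) : Finset V :=
  outSet G m A U n \ inSet G m A U (n + w)

theorem mem_gates : x ∈ gates G m A U n w ↔
    x ∈ outSet G m A U n ∧ x ∉ inSet G m A U (n + w) := by
  simp [gates]

theorem SearchInstance.root_mem_gates (I : SearchInstance G m A U) (hN : NoAug G m A U L)
    (hL : n + w ≤ L) (hx : x ∈ U) : x ∈ gates G m A U n w :=
  mem_gates.2 ⟨I.root_mem_out hx, hN.root_notMem_in hL hx⟩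

/-- Gates are not joined by short alternating paths. -/
theorem SearchInstance.lt_of_gateAug (I : SearchInstance G m A U) (hN : NoAug G m A U L)
    (hL : n + w ≤ L) (hx : x ∈ gates G m A U n w) (hy : y ∈ gates G m A U n w) (hxy : x ≠ y)
    (ht : Odd t) (h : GateAug G m A (gates G m A U n w) x y t) :
    n + w < lam G m A U x + t ∧ n + w < lam G m A U y + t := by
  wlog hle : lam G m A U x ≤ lam G m A U y generalizing x y
  · exact (this hy hx hxy.symm (h.symm I.inv ht) (by omega)).symm
  suffices n + w < lam G m A U x + t by omega
  by_contra hcon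
  obtain ⟨q, hq, q0, qt, hqK⟩ := h
  obtain ⟨p, hp, h0, hA, hpx⟩ := exists_path_lam (mem_gates.1 hx).1
  have hev := (lam_spec (mem_gates.1 hx).1).1
  have hxA := outSet_subset (mem_gates.1 hx).1
  have hyA := outSet_subset (mem_gates.1 hy).1
  have hxI := (mem_gates.1 hx).2
  have hyI := (mem_gates.1 hy).2
  set a := lam G m A U x with ha
  have hqA : ∀ i ≤ t, q i ∈ A := by
    intro i hi
    rcases Nat.eq_zero_or_pos i with rfl | h
    · rwa [q0]
    · rcases hi.eq_or_lt with rfl | h'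
      · rwa [qt]
      · exact (hqK i h h').1
  have hyp : ∀ i ≤ a, p i ≠ y := by
    rintro i hi rfl
    rcases Nat.even_or_odd i with he | ho
    · have := lam_le_of_reach he (reach_of_path hp h0 hA hi)
      obtain rfl : i = a := by omega
      exact hxy hpx.symm
    · exact hyI (mem_in_of_path hp h0 hA hi ho (by omega))
  have hxp : ∀ i < a, p i ≠ x := fun i hi he => by
    have := hp.inj i hi.le a le_rfl (he.trans hpx.symm)
    omega
  have hpos := ht.pos
  by_cases hm : ∃ i ≤ a, ∃ j, 1 ≤ j ∧ j ≤ t - 1 ∧ p i = q j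
  · obtain ⟨k, hk, hko, ⟨j, hj1, hj2, hj⟩, hfirst⟩ := hp.first_touch I.inv
      (hq.mono (k := t - 1) (by omega)) (by grind) hm
      (fun j h1 h2 he => (hqK j h1 (by omega)).2 (he ▸ I.root_mem_gates hN hL h0))
    rcases Nat.even_or_odd j with hje | hjo
    · have hb := AltPath.bwd I.inv (hp.mono hk) hq (by omega) (Nat.zero_le j) hj (by grind)
        (fun i hi j' _ hj' => by
          rcases Nat.eq_zero_or_pos j' with rfl | h
          · rw [q0]; exact hxp i (by omega)
          · exact hfirst i hi j' h (by omega))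
      refine hxI (mem_inSet.2 ⟨k + (j - 0), by omega, by grind, _, hb, ?_, ?_, ?_⟩)
      · rwa [bwd_of_le (Nat.zero_le _)]
      · exact forall_bwd (Q := (· ∈ A)) hj (fun i hi => hA i (by omega))
          (fun i _ h2 => hqA i (by omega))
      · rw [bwd_of_ge hj (by omega), ← q0]; congr 1; omega
    · have hb := (hp.mono hk).fwd hq (by omega) hj (by grind)
        (fun i hi j' hj' hj'' => by
          rcases hj''.eq_or_lt with rfl | h
          · rw [qt]; exact hyp i (by omega)
          · exact hfirst i hi j' (by omega) (by omega))
      refine hyI (mem_inSet.2 ⟨k + (t - j), by omega, by grind, _, hb, ?_, ?_, ?_⟩)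
      · rwa [fwd_of_le (Nat.zero_le _)]
      · exact forall_fwd (Q := (· ∈ A)) hj (fun i hi => hA i (by omega))
          (fun i _ h2 => hqA i (by omega))
      · rw [fwd_of_ge hj (by omega), ← qt]; congr 1; omega
  · push Not at hm
    have hj : p a = q 0 := hpx.trans q0.symm
    have hb := hp.fwd hq (Nat.zero_le t) hj (by grind)
        (fun i hi j' _ hj'' => by
          rcases Nat.eq_zero_or_pos j' with rfl | h
          · rw [q0]; exact hxp i (by omega)
          rcases hj''.eq_or_lt with rfl | h
          · rw [qt]; exact hyp i (by omega)
          · exact hm i (by omega) j' (by omega) (by omega))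
    refine hyI (mem_inSet.2 ⟨a + (t - 0), by omega, by grind, _, hb, ?_, ?_, ?_⟩)
    · rwa [fwd_of_le (Nat.zero_le _)]
    · exact forall_fwd (Q := (· ∈ A)) hj (fun i hi => hA i (by omega))
        (fun i _ h2 => hqA i (by omega))
    · rw [fwd_of_ge hj (by omega), ← qt]; congr 1; omega

/-- The end of an even gate path is reached at even distance. -/
theorem SearchInstance.mem_out_of_gatePath (I : SearchInstance G m A U) (hN : NoAug G m A U L)
    (hL : n + w ≤ L) (hR : GatePath G m A (gates G m A U n w) x R l) (hl : Even l)
    (hle : lam G m A U x + l ≤ n + w) : R l ∈ outSet G m A U (lam G m A U x + l) := by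
  have hx := hR.start
  obtain ⟨p, hp, h0, hA, hpx⟩ := exists_path_lam (mem_gates.1 hx).1
  have hev := (lam_spec (mem_gates.1 hx).1).1
  have hxA := outSet_subset (mem_gates.1 hx).1
  have hxI := (mem_gates.1 hx).2
  set a := lam G m A U x with ha
  have hRA : ∀ i ≤ l, R i ∈ A := by
    intro i hi
    rcases Nat.eq_zero_or_pos i with rfl | h
    · rwa [hR.zero]
    · exact (hR.mem i h hi).1
  have hxp : ∀ i < a, p i ≠ x := fun i hi he => by
    have := hp.inj i hi.le a le_rfl (he.trans hpx.symm)
    omega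
  by_cases hm : ∃ i ≤ a, ∃ j, 1 ≤ j ∧ j ≤ l ∧ p i = R j
  · obtain ⟨k, hk, hko, ⟨j, hj1, hj2, hj⟩, hfirst⟩ := hp.first_touch I.inv
      hR.path hl hm (fun j h1 h2 => (hR.ne_start (I.root_mem_gates hN hL h0) h1 h2).symm)
    rcases Nat.even_or_odd j with hje | hjo
    · exfalso
      have hb := AltPath.bwd I.inv (hp.mono hk) hR.path hj2 (Nat.zero_le j) hj (by grind)
        (fun i hi j' _ hj' => by
          rcases Nat.eq_zero_or_pos j' with rfl | h
          · rw [hR.zero]; exact hxp i (by omega)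
          · exact hfirst i hi j' h (by omega))
      refine hxI (mem_inSet.2 ⟨k + (j - 0), by omega, by grind, _, hb, ?_, ?_, ?_⟩)
      · rwa [bwd_of_le (Nat.zero_le _)]
      · exact forall_bwd (Q := (· ∈ A)) hj (fun i hi => hA i (by omega))
          (fun i _ h2 => hRA i (by omega))
      · rw [bwd_of_ge hj (by omega), ← hR.zero]; congr 1; omega
    · have hb := (hp.mono hk).fwd hR.path hj2 hj (by grind)
        (fun i hi j' hj' hj'' => hfirst i hi j' (by omega) hj'')
      refine mem_outSet.2 ⟨k + (l - j), by omega, by grind, _, hb, ?_, ?_, ?_⟩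
      · rwa [fwd_of_le (Nat.zero_le _)]
      · exact forall_fwd (Q := (· ∈ A)) hj (fun i hi => hA i (by omega))
          (fun i _ h2 => hRA i (by omega))
      · rw [fwd_of_ge hj (by omega)]; congr 1; omega
  · push Not at hm
    have hj : p a = R 0 := hpx.trans hR.zero.symm
    have hb := hp.fwd hR.path (Nat.zero_le l) hj (by grind)
        (fun i hi j' _ hj'' => by
          rcases Nat.eq_zero_or_pos j' with rfl | h
          · rw [hR.zero]; exact hxp i (by omega)
          · exact hm i (by omega) j' (by omega) (by omega))
    refine mem_outSet.2 ⟨a + (l - 0), by omega, by grind, _, hb, ?_, ?_, ?_⟩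
    · rwa [fwd_of_le (Nat.zero_le _)]
    · exact forall_fwd (Q := (· ∈ A)) hj (fun i hi => hA i (by omega))
        (fun i _ h2 => hRA i (by omega))
    · rw [fwd_of_ge hj (by omega)]; congr 1; omega

variable [Fintype V]

/-- `R` is a gate path of least weight among the even gate paths to its end. -/
structure MinGatePath (G : SimpleGraph V) (m : V → V) (A U : Finset V) (n w : ℕ)
    (x : V) (R : ℕ → V) (l : ℕ) : Prop where
  gatePath : GatePath G m A (gates G m A U n w) x R l
  even : Even l
  min : ∀ z Q k, Even k → GatePath G m A (gates G m A U n w) z Q k → Q k = R l →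
    gateWeight G m A U x + Fintype.card V * l ≤ gateWeight G m A U z + Fintype.card V * k

/-- `v` has the label `x` if a least even gate path to `v` starts at `x`. -/
def IsLabel (G : SimpleGraph V) (m : V → V) (A U : Finset V) (n w : ℕ) (v x : V) : Prop :=
  ∃ R l, MinGatePath G m A U n w x R l ∧ R l = v

theorem IsLabel.unique (hx : IsLabel G m A U n w v x) (hy : IsLabel G m A U n w v y) :
    x = y := by
  obtain ⟨R, l, hR, rfl⟩ := hx
  obtain ⟨S, l', hS, he⟩ := hy
  exact gateWeight_inj (le_antisymm (hR.min _ _ _ hS.even hS.gatePath he)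
    (hS.min _ _ _ hR.even hR.gatePath he.symm))

theorem exists_minGatePath (hR : GatePath G m A (gates G m A U n w) x R l) (hl : Even l) :
    ∃ z Q k, MinGatePath G m A U n w z Q k ∧ Q k = R l := by
  classical
  let P : ℕ → Prop := fun t => ∃ z Q k, Even k ∧ GatePath G m A (gates G m A U n w) z Q k ∧
    Q k = R l ∧ gateWeight G m A U z + Fintype.card V * k = t
  have hex : ∃ t, P t := ⟨_, x, R, l, hl, hR, rfl, rfl⟩
  obtain ⟨z, Q, k, hk, hQ, he, ht⟩ := Nat.find_spec hex
  refine ⟨z, Q, k, ⟨hQ, hk, fun z' Q' k' hk' hQ' he' => ?_⟩, he⟩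
  rw [ht]
  exact Nat.find_min' hex ⟨z', Q', k', hk', hQ', he'.trans he, rfl⟩

theorem MinGatePath.lam_add_le (hR : MinGatePath G m A U n w x R l)
    (hS : GatePath G m A (gates G m A U n w) y S l') (hl' : Even l') (he : S l' = R l) :
    lam G m A U x + l ≤ lam G m A U y + l' :=
  lam_add_le_of_gateWeight_le (hR.min _ _ _ hl' hS he) rfl rfl

/-- Every vertex reached at even distance has a label. -/
theorem SearchInstance.exists_label (I : SearchInstance G m A U) (hN : NoAug G m A U L)
    (hL : n + w ≤ L) (hv : v ∈ outSet G m A U n) :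
    ∃ x R l, MinGatePath G m A U n w x R l ∧ R l = v ∧ lam G m A U x + l ≤ n := by
  classical
  obtain ⟨p, hp, h0, hA, hpv⟩ := exists_path_lam hv
  have hev := (lam_spec hv).1
  have hle := lam_le hv
  set a := lam G m A U v with ha
  let P : ℕ → Prop := fun i => p i ∈ gates G m A U n w
  have hP0 : P 0 := I.root_mem_gates hN hL h0
  have hPk := Nat.findGreatest_spec (P := P) (Nat.zero_le a) hP0
  have hka := Nat.findGreatest_le (P := P) a
  have hgt : ∀ i, Nat.findGreatest P a < i → i ≤ a → ¬ P i := fun i h1 h2 =>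
    Nat.findGreatest_is_greatest h1 h2
  generalize Nat.findGreatest P a = k at *
  have hke : Even k := by
    by_contra ho
    exact (mem_gates.1 hPk).2 (mem_in_of_path hp h0 hA hka (by simpa using ho) (by omega))
  have hg : GatePath G m A (gates G m A U n w) (p k) (fun i => p (k + i)) (a - k) := by
    refine ⟨⟨?_, ?_, ?_⟩, rfl, hPk, fun i h1 h2 => ⟨hA _ (by omega), hgt _ (by omega) (by omega)⟩⟩
    · intro i hi j hj he
      have := hp.inj _ (by omega) _ (by omega) he
      omega
    · intro i hi
      exact hp.adj (k + i) (by omega)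
    · intro i hi
      have := hp.alt (k + i) (by omega)
      rw [← add_assoc, this]
      grind
  obtain ⟨z, Q, t, hQ, he⟩ := exists_minGatePath hg (by grind)
  have h1 : lam G m A U z + t ≤ lam G m A U (p k) + (a - k) := hQ.lam_add_le hg (by grind) he.symm
  have h2 : lam G m A U (p k) ≤ k := lam_le_of_reach hke (reach_of_path hp h0 hA hka)
  refine ⟨z, Q, t, hQ, ?_, by omega⟩
  rw [he, ← hpv]; congr 1; omega

theorem SearchInstance.eq_of_meet (I : SearchInstance G m A U) (hN : NoAug G m A U L)
    (hL : n + w ≤ L) (hR : MinGatePath G m A U n w x R l) (hS : MinGatePath G m A U n w y S l')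
    (hmeet : (∃ i ≤ l, ∃ j ≤ l', R i = S j) ∨ (G.Adj (R l) (S l') ∧ m (R l) ≠ S l'))
    (hle : lam G m A U y + l + l' + 1 ≤ n + w) : x = y := by
  by_contra hxy
  obtain ⟨t, ht, htl, h⟩ := hR.gatePath.exists_gateAug I.inv
    (fun x _ y _ a b h => gateWeight_inj (G := G) (m := m) (A := A) (U := U) h)
    hR.even hR.min hS.gatePath hS.even hS.min hxy hmeet
  have := I.lt_of_gateAug hN hL hR.gatePath.start hS.gatePath.start hxy ht h
  omega

/-- All vertices of a short alternating path that starts at a gate `x` and continues through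
vertices reached both ways have the label `x`. -/
theorem SearchInstance.label_of_path (I : SearchInstance G m A U) (hN : NoAug G m A U L)
    (hL : n + w ≤ L) (hx : x ∈ gates G m A U n w) {e : ℕ → V} (he : AltPath G m e l)
    (he0 : e 0 = x)
    (heB : ∀ i, 1 ≤ i → i ≤ l → e i ∈ outSet G m A U n ∧ e i ∈ inSet G m A U n)
    (hlw : l + 1 ≤ w) : ∀ i ≤ l, IsLabel G m A U n w (e i) x := by
  have heG : GatePath G m A (gates G m A U n w) x e l :=
    ⟨he, he0, hx, fun i h1 h2 => ⟨outSet_subset (heB i h1 h2).1, fun h =>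
      (mem_gates.1 h).2 (inSet_mono (Nat.le_add_right n w) (heB i h1 h2).2)⟩⟩
  intro i
  induction i with
  | zero =>
    intro _
    obtain ⟨z, Q, k, hQ, hk⟩ := exists_minGatePath (heG.mono (Nat.zero_le l)) Even.zero
    have hk0 : k = 0 := by
      by_contra h
      exact (hQ.gatePath.mem k (by omega) le_rfl).2 (by rw [hk, he0]; exact hx)
    subst hk0
    have : z = x := by rw [← hQ.gatePath.zero, hk, he0]
    subst this
    exact ⟨Q, 0, hQ, hk⟩
  | succ i ih =>
    intro hi
    obtain ⟨R, a, hR, hRe⟩ := ih (by omega)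
    obtain ⟨y, S, b, hS, hSe, hSn⟩ := I.exists_label hN hL (heB (i + 1) (by omega) hi).1
    suffices x = y by
      subst this
      exact ⟨S, b, hS, hSe⟩
    rcases Nat.even_or_odd i with hev | hod
    · have h1 := hR.lam_add_le (heG.mono (l' := i) (by omega)) hev hRe.symm
      refine I.eq_of_meet hN hL hR hS (Or.inr ?_) (by omega)
      rw [hRe, hSe]
      refine ⟨he.adj i (by omega), fun h => ?_⟩
      have := (he.alt i (by omega)).1 h
      grind
    · have h1 := hS.lam_add_le (heG.mono hi) (by grind) hSe.symm
      have hmi : m (e i) = e (i + 1) := he.mate_odd (by omega) hod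
      have ha : 1 ≤ a := by
        by_contra h0
        have : a = 0 := by omega
        subst this
        rw [hR.gatePath.zero, ← he0] at hRe
        have := he.inj 0 (by omega) i (by omega) hRe
        grind
      have h2 : lam G m A U x + a ≤ n := by
        obtain ⟨y', S', b', hS', hSe', hSn'⟩ :=
          I.exists_label hN hL (heB i hod.pos (by omega)).1
        exact (hR.lam_add_le hS'.gatePath hS'.even (hSe'.trans hRe.symm)).trans hSn'
      obtain ⟨j, hj1, hj2, hj⟩ := hR.gatePath.path.mate_mem I.inv hR.even ha le_rfl
      refine I.eq_of_meet hN hL hR hS (Or.inl ⟨j, hj2, b, le_rfl, ?_⟩) (by omega)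
      rw [← hj, hRe, hSe, hmi]

end ExpanderMatching

namespace ExpanderMatching

variable {V : Type*}

section

/-- `a` and `b` are joined by a walk inside `B`. -/
def Conn (G : SimpleGraph V) (B : Finset V) : V → V → Prop :=
  Relation.ReflTransGen fun a b => a ∈ B ∧ b ∈ B ∧ G.Adj a b

variable {G : SimpleGraph V} {B Z : Finset V} {a b : V}

theorem Conn.symm (h : Conn G B a b) : Conn G B b a := by
  induction h with
  | refl => exact Relation.ReflTransGen.refl
  | tail _ h ih => exact Relation.ReflTransGen.head ⟨h.2.1, h.1, h.2.2.symm⟩ ih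

theorem Conn.trans {c : V} (h : Conn G B a b) (h' : Conn G B b c) : Conn G B a c :=
  Relation.ReflTransGen.trans h h'

theorem Conn.of_adj (ha : a ∈ B) (hb : b ∈ B) (h : G.Adj a b) : Conn G B a b :=
  Relation.ReflTransGen.single ⟨ha, hb, h⟩

theorem Conn.exists_crossing (h : Conn G B a b) (ha : a ∈ Z) (hb : b ∉ Z) :
    ∃ f ∈ B, ∃ g ∈ B, f ∈ Z ∧ g ∉ Z ∧ G.Adj f g := by
  induction h with
  | refl => exact absurd ha hb
  | @tail c e _ hce ih =>
    by_cases hc : c ∈ Z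
    · exact ⟨c, hce.1, e, hce.2.1, hc, hb, hce.2.2⟩
    · exact ih hc

end

variable [DecidableEq V]

/-- Vertices reached by alternating paths of length at most `n` of both parities. -/
noncomputable def bothSet (G : SimpleGraph V) (m : V → V) (A U : Finset V) (n : ℕ) : Finset V :=
  outSet G m A U n ∩ inSet G m A U n

/-- Vertices reached by alternating paths of length at most `n`. -/
noncomputable def reached (G : SimpleGraph V) (m : V → V) (A U : Finset V) (n : ℕ) : Finset V :=
  outSet G m A U n ∪ inSet G m A U n

/-- Vertices reached only at even distance at time `n`, but at odd distance too at time
`n + w`. -/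
noncomputable def absorbed (G : SimpleGraph V) (m : V → V) (A U : Finset V) (n w : ℕ) :
    Finset V :=
  (outSet G m A U n ∩ inSet G m A U (n + w)) \ inSet G m A U n

/-- The vertices reached from `x` at distance at most `r` through vertices that are reached both
ways at time `n`. -/
noncomputable def zone (G : SimpleGraph V) (m : V → V) (A U : Finset V) (n : ℕ) (x : V) (r : ℕ) :
    Finset V :=
  reached G m (insert x (bothSet G m A U n)) {x} r

/-- The gate `x` shares a component of the vertices reached both ways with another gate. -/
def IsMulti (G : SimpleGraph V) (m : V → V) (A U : Finset V) (n w : ℕ) (x : V) : Prop :=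
  x ∈ gates G m A U n w ∧ ∃ y ∈ gates G m A U n w, y ≠ x ∧ ∃ b ∈ bothSet G m A U n,
    ∃ b' ∈ bothSet G m A U n, G.Adj x b ∧ G.Adj y b' ∧ Conn G (bothSet G m A U n) b b'

variable {G : SimpleGraph V} {m : V → V} {A U : Finset V} {l n n' w L r d : ℕ}
  {v x y z : V}

theorem mem_bothSet : v ∈ bothSet G m A U n ↔ v ∈ outSet G m A U n ∧ v ∈ inSet G m A U n := by
  simp [bothSet]

theorem mem_reached : v ∈ reached G m A U n ↔ ∃ l ≤ n, Reach G m A U l v := by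
  simp only [reached, Finset.mem_union, mem_outSet, mem_inSet]
  constructor
  · rintro (⟨l, h1, -, h2⟩ | ⟨l, h1, -, h2⟩) <;> exact ⟨l, h1, h2⟩
  · rintro ⟨l, h1, h2⟩
    rcases Nat.even_or_odd l with h | h
    · exact Or.inl ⟨l, h1, h, h2⟩
    · exact Or.inr ⟨l, h1, h, h2⟩

theorem mem_absorbed : v ∈ absorbed G m A U n w ↔
    v ∈ outSet G m A U n ∧ v ∈ inSet G m A U (n + w) ∧ v ∉ inSet G m A U n := by
  simp [absorbed, and_assoc]

theorem reached_mono (h : n ≤ n') : reached G m A U n ⊆ reached G m A U n' :=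
  Finset.union_subset_union (outSet_mono h) (inSet_mono h)

theorem bothSet_mono (h : n ≤ n') : bothSet G m A U n ⊆ bothSet G m A U n' :=
  Finset.inter_subset_inter (outSet_mono h) (inSet_mono h)

theorem reached_subset : reached G m A U n ⊆ A :=
  Finset.union_subset outSet_subset inSet_subset

theorem bothSet_subset_reached : bothSet G m A U n ⊆ reached G m A U n :=
  Finset.inter_subset_left.trans Finset.subset_union_left

theorem gates_notMem_bothSet (hx : x ∈ gates G m A U n w) : x ∉ bothSet G m A U n := fun h =>
  (mem_gates.1 hx).2 (inSet_mono (Nat.le_add_right n w) (mem_bothSet.1 h).2)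

namespace SearchInstance

theorem mate_mem_bothSet (I : SearchInstance G m A U) (hN : NoAug G m A U L) (hn : n ≤ L)
    (he : Even n) (hv : v ∈ bothSet G m A U n) :
    m v ∈ bothSet G m A U n ∧ m v ≠ v ∧ v ∉ U := by
  obtain ⟨h1, h2⟩ := mem_bothSet.1 hv
  obtain ⟨h3, h4, h5, h6⟩ := I.mate_mem_both hN hn he h1 h2
  exact ⟨mem_bothSet.2 ⟨h3, h4⟩, h5, h6⟩

/-- The search instance with the single root `x` inside the vertices reached both ways. -/
theorem local_instance (I : SearchInstance G m A U) (hN : NoAug G m A U L) (hn : n ≤ L)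
    (he : Even n) (hx : x ∉ bothSet G m A U n) :
    SearchInstance G m (insert x (bothSet G m A U n)) {x} where
  inv := I.inv
  madj := I.madj
  sub := by simp
  root := by
    intro u hu hm
    rw [Finset.mem_singleton] at hu
    subst hu
    rcases Finset.mem_insert.1 hm with h | h
    · exact h
    · have := (I.mate_mem_bothSet hN hn he h).1
      rw [I.inv] at this
      exact absurd this hx
  mate := by
    intro v hv hvx
    have hv' : v ∈ bothSet G m A U n :=
      (Finset.mem_insert.1 hv).resolve_left (by simpa using hvx)
    have := I.mate_mem_bothSet hN hn he hv'
    exact ⟨Finset.mem_insert_of_mem this.1, this.2.1⟩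

end SearchInstance

theorem mem_zone : z ∈ zone G m A U n x r ↔
    ∃ l ≤ r, Reach G m (insert x (bothSet G m A U n)) {x} l z := mem_reached

theorem exists_path_of_local_reach
    (h : Reach G m (insert x (bothSet G m A U n)) {x} l z) :
    ∃ e, AltPath G m e l ∧ e 0 = x ∧ e l = z ∧ ∀ i, 1 ≤ i → i ≤ l → e i ∈ bothSet G m A U n := by
  obtain ⟨e, he, h0, hA, hl⟩ := h
  rw [Finset.mem_singleton] at h0
  refine ⟨e, he, h0, hl, fun i h1 h2 => ?_⟩
  refine (Finset.mem_insert.1 (hA i h2)).resolve_left fun h => ?_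
  have := he.inj i h2 0 (Nat.zero_le l) (h.trans h0.symm)
  omega

theorem local_reach_of_path {e : ℕ → V} (he : AltPath G m e l) (h0 : e 0 = x)
    (hB : ∀ i, 1 ≤ i → i ≤ l → e i ∈ bothSet G m A U n) :
    Reach G m (insert x (bothSet G m A U n)) {x} l (e l) := by
  refine ⟨e, he, by simp [h0], fun i hi => ?_, rfl⟩
  rcases Nat.eq_zero_or_pos i with rfl | h
  · simp [h0]
  · exact Finset.mem_insert_of_mem (hB i h hi)

theorem root_mem_zone : x ∈ zone G m A U n x r :=
  mem_zone.2 ⟨0, Nat.zero_le r, fun _ => x, AltPath.nil, by simp, by simp, rfl⟩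

theorem zone_subset : zone G m A U n x r ⊆ insert x (bothSet G m A U n) := reached_subset

variable [Fintype V]

namespace SearchInstance

theorem label_of_mem_zone (I : SearchInstance G m A U) (hN : NoAug G m A U L)
    (hL : n + w ≤ L) (hx : x ∈ gates G m A U n w) (hr : r + 1 ≤ w)
    (hz : z ∈ zone G m A U n x r) : IsLabel G m A U n w z x := by
  obtain ⟨l, hl, h⟩ := mem_zone.1 hz
  obtain ⟨e, he, h0, rfl, hB⟩ := exists_path_of_local_reach h
  exact I.label_of_path hN hL hx he h0 (fun i h1 h2 => mem_bothSet.1 (hB i h1 h2)) (by omega) l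
    le_rfl

/-- The zones of distinct gates are disjoint. -/
theorem zone_disjoint (I : SearchInstance G m A U) (hN : NoAug G m A U L)
    (hL : n + w ≤ L) (hx : x ∈ gates G m A U n w) (hy : y ∈ gates G m A U n w) (hr : r + 1 ≤ w)
    (hxy : x ≠ y) : Disjoint (zone G m A U n x r) (zone G m A U n y r) := by
  rw [Finset.disjoint_left]
  intro z h1 h2
  exact hxy ((I.label_of_mem_zone hN hL hx hr h1).unique (I.label_of_mem_zone hN hL hy hr h2))

/-- The zone of a gate that shares its component with another gate is large, or it is adjacent to
an absorbed vertex. -/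
theorem zone_large_or_adj_absorbed (I : SearchInstance G m A U) (hN : NoAug G m A U L)
    (hL : n + w ≤ L) (hn : Even n) (hx : IsMulti G m A U n w x) (hr : r + 1 ≤ w) :
    r ≤ (zone G m A U n x r).card ∨
      ∃ z ∈ zone G m A U n x r, ∃ a ∈ absorbed G m A U n w, G.Adj a z := by
  classical
  by_contra hcon
  push Not at hcon
  obtain ⟨hcard, hadj⟩ := hcon
  obtain ⟨hxg, y, hy, hyx, b, hb, b', hb', hxb, hyb, hc⟩ := hx
  have hxB := gates_notMem_bothSet hxg
  have hyB := gates_notMem_bothSet hy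
  have J := I.local_instance hN (by omega) hn hxB
  have hr2 : 2 ≤ r := by
    have : 0 < (zone G m A U n x r).card := Finset.card_pos.2 ⟨x, root_mem_zone⟩
    omega
  have step : ∀ g c, g ∉ bothSet G m A U n → c ∈ bothSet G m A U n → G.Adj g c →
      c ∈ zone G m A U n g r := by
    intro g c hg hcB hgc
    refine mem_zone.2 ⟨1, by omega, ?_⟩
    exact (I.local_instance hN (by omega) hn hg).reach_snoc (p := fun _ => g) (l := 0)
      AltPath.nil (by simp) (by simp) Even.zero (Finset.mem_insert_of_mem hcB) hgc
      (fun _ _ h => hg (h ▸ hcB))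
  have hbZ := step x b hxB hb hxb
  have hbZ' : b' ∉ zone G m A U n x r := fun h =>
    Finset.disjoint_left.1 (I.zone_disjoint hN hL hy hxg hr hyx) (step y b' hyB hb' hyb) h
  -- no local path is longer than `r - 2`
  have hshort : ∀ t z, Reach G m (insert x (bothSet G m A U n)) {x} t z →
      t + 2 ≤ r ∧ z ∈ zone G m A U n x r := by
    intro t z h
    suffices t + 2 ≤ r from ⟨this, mem_zone.2 ⟨t, by omega, h⟩⟩
    by_contra hlt
    obtain ⟨p, hp, h0, hA, -⟩ := h
    have : (Finset.range r).card ≤ (zone G m A U n x r).card := by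
      refine Finset.card_le_card_of_injOn p ?_ ?_
      · intro i hi
        have hi : i < r := by simpa using hi
        exact mem_zone.2 ⟨i, by omega, reach_of_path hp h0 hA (by omega)⟩
      · intro i hi j hj he
        have hi : i < r := by simpa using hi
        have hj : j < r := by simpa using hj
        exact hp.inj i (by omega) j (by omega) he
    simp at this
    omega
  obtain ⟨f, hfB, g, hgB, hfZ, hgZ, hfg⟩ := hc.exists_crossing hbZ hbZ'
  have hodd : ∀ t, Reach G m (insert x (bothSet G m A U n)) {x} t f → Odd t := by
    intro t h
    by_contra hev
    obtain ⟨p, hp, h0, hA, rfl⟩ := h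
    refine hgZ (hshort (t + 1) g (J.reach_snoc hp h0 hA (by simpa using hev)
      (Finset.mem_insert_of_mem hgB) hfg ?_)).2
    rintro i hi rfl
    exact hgZ (hshort i _ (reach_of_path hp h0 hA hi)).2
  obtain ⟨t, -, hYr⟩ := mem_zone.1 hfZ
  have ht := hodd t hYr
  obtain ⟨Y, hY, hY0, hYt, hYB⟩ := exists_path_of_local_reach hYr
  obtain ⟨R, l, hR, hRl⟩ := I.label_of_mem_zone hN hL hxg hr hfZ
  have hln : lam G m A U x + l ≤ n := by
    obtain ⟨y', S', b', hS', hSe', hSn'⟩ := I.exists_label hN hL (mem_bothSet.1 hfB).1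
    exact (hR.lam_add_le hS'.gatePath hS'.even (hSe'.trans hRl.symm)).trans hSn'
  have hle := hR.even
  by_cases hall : ∀ i, 1 ≤ i → i ≤ l → R i ∈ bothSet G m A U n
  · have := hodd l (hRl ▸ local_reach_of_path hR.gatePath.path hR.gatePath.zero hall)
    grind
  push Not at hall
  obtain ⟨i0, hi0, hi0l, hi0B⟩ := hall
  let P : ℕ → Prop := fun i => R i ∉ bothSet G m A U n
  have hPi := Nat.findGreatest_spec (P := P) hi0l hi0B
  have hil := Nat.findGreatest_le (P := P) l
  have hi1 := Nat.le_findGreatest (P := P) hi0l hi0B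
  have hgt : ∀ i, Nat.findGreatest P l < i → i ≤ l → R i ∈ bothSet G m A U n :=
    fun i h1 h2 => not_not.1 (Nat.findGreatest_is_greatest h1 h2)
  generalize Nat.findGreatest P l = i at *
  have hil' : i < l := by
    rcases hil.eq_or_lt with rfl | h
    · exact absurd (hRl ▸ hfB) hPi
    · exact h
  have hie : Even i := by
    by_contra ho
    have h1 := hR.gatePath.path.mate_odd hil' (by simpa using ho)
    have h2 := (I.mate_mem_bothSet hN (by omega) hn (hgt (i + 1) (by omega) (by omega))).1
    rw [← h1, I.inv] at h2
    exact hPi h2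
  have hRiA : R i ∈ absorbed G m A U n w := by
    have h1 := outSet_mono (by omega) (I.mem_out_of_gatePath hN hL (hR.gatePath.mono hil) hie
      (by omega)) (n' := n)
    refine mem_absorbed.2 ⟨h1, ?_, fun h => hPi (mem_bothSet.2 ⟨h1, h⟩)⟩
    by_contra h
    exact (hR.gatePath.mem i (by omega) hil).2 (mem_gates.2 ⟨h1, h⟩)
  obtain ⟨k, hk, hko, ⟨j, hj1, hj2, hj⟩, hfirst⟩ := hY.first_touch_segment (a := i + 1) (b := l)
    I.inv (q := R) (fun j h1 h2 => by
      rcases Nat.even_or_odd j with he | ho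
      · obtain ⟨j', rfl⟩ : ∃ j', j = j' + 1 := ⟨j - 1, by omega⟩
        exact ⟨j', by grind, by omega, hR.gatePath.path.mate_even I.inv h2 (by grind)⟩
      · exact ⟨j + 1, by omega, by grind, hR.gatePath.path.mate_odd (by grind) ho⟩)
    ⟨t, le_rfl, l, by omega, le_rfl, hYt.trans hRl.symm⟩
    (fun j h1 h2 => by
      rw [hY0]; exact (hR.gatePath.ne_start hxg (by omega) h2).symm)
  rcases Nat.even_or_odd j with hje | hjo
  · have hb := AltPath.bwd I.inv (hY.mono hk) hR.gatePath.path hj2 hj1 hj (by grind)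
      (fun i' hi' j' h1 h2 => hfirst i' hi' j' h1 (by omega))
    have h1 : bwd Y k R j 0 = x := by rw [bwd_of_le (Nat.zero_le k), hY0]
    have h2 : bwd Y k R j (k + (j - (i + 1))) = R (i + 1) := by
      rw [bwd_of_ge hj (by omega)]; congr 1; omega
    have h3 := local_reach_of_path hb h1 (A := A) (U := U) (n := n) (fun i' h1 h2 => by
      rcases le_or_gt i' k with h | h
      · rw [bwd_of_le h]; exact hYB i' h1 (by omega)
      · rw [bwd_of_ge hj h.le]; exact hgt _ (by omega) (by omega))
    rw [h2] at h3
    exact hadj _ (hshort _ _ h3).2 _ hRiA (hR.gatePath.path.adj i hil')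
  · have hb := (hY.mono hk).fwd hR.gatePath.path hj2 hj (by grind)
      (fun i' hi' j' h1 h2 => hfirst i' hi' j' (by omega) h2)
    have h1 : fwd Y k R j 0 = x := by rw [fwd_of_le (Nat.zero_le k), hY0]
    have h2 : fwd Y k R j (k + (l - j)) = f := by
      rw [fwd_of_ge hj (by omega), ← hRl]; congr 1; omega
    have h3 := local_reach_of_path hb h1 (A := A) (U := U) (n := n) (fun i' h1 h2 => by
      rcases le_or_gt i' k with h | h
      · rw [fwd_of_le h]; exact hYB i' h1 (by omega)
      · rw [fwd_of_ge hj h.le]; exact hgt _ (by omega) (by omega))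
    rw [h2] at h3
    have := hodd _ h3
    grind

/-- Few zones are adjacent to absorbed vertices. -/
theorem card_adj_absorbed_le [DecidableRel G.Adj] (I : SearchInstance G m A U)
    (hN : NoAug G m A U L) (hL : n + w ≤ L) (hr : r + 1 ≤ w) (hreg : G.IsRegularOfDegree d)
    {K : Finset V} (hK : K ⊆ gates G m A U n w)
    (h : ∀ x ∈ K, ∃ z ∈ zone G m A U n x r, ∃ a ∈ absorbed G m A U n w, G.Adj a z) :
    K.card ≤ d * (absorbed G m A U n w).card := by
  choose! f hf a ha haf using h
  calc K.card ≤ ((absorbed G m A U n w).biUnion fun a => G.neighborFinset a).card := by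
        refine Finset.card_le_card_of_injOn f ?_ ?_
        · intro x hx
          have hx : x ∈ K := hx
          simp only [Finset.coe_biUnion, Set.mem_iUnion, Finset.mem_coe]
          exact ⟨a x, ha x hx, by simpa using haf x hx⟩
        · intro x hx y hy he
          have hx : x ∈ K := hx
          have hy : y ∈ K := hy
          by_contra hxy
          exact Finset.disjoint_left.1 (I.zone_disjoint hN hL (hK hx) (hK hy) hr hxy) (hf x hx)
            (he ▸ hf y hy)
    _ ≤ (absorbed G m A U n w).card * d :=
        Finset.card_biUnion_le_card_mul _ _ _ fun a _ => by
          rw [G.card_neighborFinset_eq_degree, hreg a]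
    _ = _ := mul_comm _ _

end SearchInstance

end ExpanderMatching

namespace ExpanderMatching

variable {V : Type*}

section

variable (G : SimpleGraph V) [DecidableRel G.Adj]

/-- The number of pairs of adjacent vertices in `S × T`. -/
def adjCount (S T : Finset V) : ℕ := ∑ s ∈ S, ∑ t ∈ T, if G.Adj s t then 1 else 0

variable {G} {S S' T T' : Finset V} {d : ℕ}

theorem adjCount_comm : adjCount G S T = adjCount G T S := by
  unfold adjCount
  rw [Finset.sum_comm]
  simp [G.adj_comm]

theorem adjCount_mono (hS : S ⊆ S') (hT : T ⊆ T') : adjCount G S T ≤ adjCount G S' T' := by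
  unfold adjCount
  exact (Finset.sum_le_sum fun s _ => Finset.sum_le_sum_of_subset hT).trans
    (Finset.sum_le_sum_of_subset hS)

theorem adjCount_eq_zero (h : ∀ s ∈ S, ∀ t ∈ T, ¬ G.Adj s t) : adjCount G S T = 0 :=
  Finset.sum_eq_zero fun s hs => Finset.sum_eq_zero fun t ht => if_neg (h s hs t ht)

theorem adjCount_eq_card :
    adjCount G S T = ((S ×ˢ T).filter fun p => G.Adj p.1 p.2).card := by
  rw [Finset.card_filter, Finset.sum_product, adjCount]

theorem adjCount_le_of_imp (h : ∀ s ∈ S, ∀ t ∈ T, G.Adj s t → s ∈ S' ∧ t ∈ T') :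
    adjCount G S T ≤ adjCount G S' T' := by
  rw [adjCount_eq_card, adjCount_eq_card]
  refine Finset.card_le_card fun p hp => ?_
  simp only [Finset.mem_filter, Finset.mem_product] at hp ⊢
  exact ⟨h _ hp.1.1 _ hp.1.2 hp.2, hp.2⟩

theorem adjCount_singleton_self {v : V} : adjCount G {v} {v} = 0 := by simp [adjCount]

theorem adjCount_univ [Fintype V] (hreg : G.IsRegularOfDegree d) :
    adjCount G S Finset.univ = d * S.card := by
  unfold adjCount
  have : ∀ s ∈ S, (∑ t, if G.Adj s t then 1 else 0) = d := by
    intro s _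
    rw [Finset.sum_boole, ← hreg s, ← G.card_neighborFinset_eq_degree, Nat.cast_id]
    congr 1
    ext; simp
  rw [Finset.sum_congr rfl this, Finset.sum_const, smul_eq_mul, mul_comm]

theorem adjCount_le_left [Fintype V] (hreg : G.IsRegularOfDegree d) : adjCount G S T ≤ d * S.card :=
  (adjCount_mono le_rfl (Finset.subset_univ T)).trans (adjCount_univ hreg).le

variable [DecidableEq V]

theorem adjCount_union_left (h : Disjoint S S') :
    adjCount G (S ∪ S') T = adjCount G S T + adjCount G S' T := Finset.sum_union h

theorem adjCount_union_right (h : Disjoint T T') :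
    adjCount G S (T ∪ T') = adjCount G S T + adjCount G S T' := by
  rw [adjCount_comm, adjCount_union_left h, adjCount_comm, adjCount_comm (S := T')]

theorem adjCount_biUnion_left {ι : Type*} [DecidableEq ι] {I : Finset ι} {f : ι → Finset V}
    (h : (I : Set ι).PairwiseDisjoint f) :
    adjCount G (I.biUnion f) T = ∑ i ∈ I, adjCount G (f i) T := Finset.sum_biUnion h

variable [Fintype V]

theorem adjCount_le_right (hreg : G.IsRegularOfDegree d) : adjCount G S T ≤ d * T.card :=
  adjCount_comm.trans_le (adjCount_le_left hreg)

theorem cutSize_eq_adjCount : cutSize G S = adjCount G S Sᶜ := by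
  unfold cutSize adjCount
  rw [SimpleGraph.interedges, Rel.interedges, Finset.card_filter, Finset.sum_product]

end

variable {G : SimpleGraph V} {B : Finset V} {a b : V}

open Classical in
/-- The component of `b` in the subgraph induced on `B`. -/
noncomputable def comp (G : SimpleGraph V) (B : Finset V) (b : V) : Finset V :=
  B.filter (Conn G B b)

theorem mem_comp : a ∈ comp G B b ↔ a ∈ B ∧ Conn G B b a := by
  simp [comp]

theorem self_mem_comp (hb : b ∈ B) : b ∈ comp G B b :=
  mem_comp.2 ⟨hb, Relation.ReflTransGen.refl⟩

theorem comp_eq (h : Conn G B a b) : comp G B a = comp G B b := by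
  ext c
  simp only [mem_comp]
  exact ⟨fun hc => ⟨hc.1, h.symm.trans hc.2⟩, fun hc => ⟨hc.1, h.trans hc.2⟩⟩

variable [DecidableEq V]

/-- The components of the subgraph induced on `B`. -/
noncomputable def comps (G : SimpleGraph V) (B : Finset V) : Finset (Finset V) :=
  B.image (comp G B)

theorem eq_comp_of_mem {Q : Finset V} (hQ : Q ∈ comps G B) (ha : a ∈ Q) : Q = comp G B a := by
  obtain ⟨b, -, rfl⟩ := Finset.mem_image.1 hQ
  exact comp_eq (mem_comp.1 ha).2

theorem subset_of_mem_comps {Q : Finset V} (hQ : Q ∈ comps G B) : Q ⊆ B := by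
  intro a ha
  rw [eq_comp_of_mem hQ ha] at ha
  exact (mem_comp.1 ha).1

theorem nonempty_of_mem_comps {Q : Finset V} (hQ : Q ∈ comps G B) : Q.Nonempty := by
  obtain ⟨b, hb, rfl⟩ := Finset.mem_image.1 hQ
  exact ⟨b, self_mem_comp hb⟩

theorem comp_mem_comps (hb : b ∈ B) : comp G B b ∈ comps G B := Finset.mem_image_of_mem _ hb

theorem comps_pairwiseDisjoint : (comps G B : Set (Finset V)).PairwiseDisjoint id := by
  intro Q hQ Q' hQ' hne
  rw [Function.onFun, Finset.disjoint_left]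
  intro a ha ha'
  exact hne ((eq_comp_of_mem hQ ha).trans (eq_comp_of_mem hQ' ha').symm)

theorem comps_biUnion : (comps G B).biUnion id = B := by
  ext a
  simp only [Finset.mem_biUnion, id]
  exact ⟨fun ⟨Q, hQ, ha⟩ => subset_of_mem_comps hQ ha,
    fun ha => ⟨_, comp_mem_comps ha, self_mem_comp ha⟩⟩

theorem adjCount_eq_sum_comps [DecidableRel G.Adj] (S : Finset V) :
    adjCount G B S = ∑ Q ∈ comps G B, adjCount G Q S := by
  conv_lhs => rw [← comps_biUnion (G := G) (B := B), adjCount_biUnion_left comps_pairwiseDisjoint]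
  rfl

theorem mem_of_adj_of_mem_comps {Q : Finset V} (hQ : Q ∈ comps G B) (ha : a ∈ Q) (hb : b ∈ B)
    (h : G.Adj a b) : b ∈ Q := by
  have haB := subset_of_mem_comps hQ ha
  rw [eq_comp_of_mem hQ ha]
  exact mem_comp.2 ⟨hb, Conn.of_adj haB hb h⟩

theorem even_card_of_mem_comps {m : V → V} (hinv : ∀ v, m (m v) = v)
    (hm : ∀ v ∈ B, m v ∈ B ∧ m v ≠ v ∧ G.Adj v (m v)) {Q : Finset V} (hQ : Q ∈ comps G B) :
    Even Q.card := by
  have h : ∑ _v ∈ Q, (1 : ZMod 2) = 0 := by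
    refine Finset.sum_involution (fun v _ => m v) (fun _ _ => by decide) ?_ ?_ ?_
    · intro v hv _
      exact (hm v (subset_of_mem_comps hQ hv)).2.1
    · intro v hv
      have := hm v (subset_of_mem_comps hQ hv)
      exact mem_of_adj_of_mem_comps hQ hv this.1 this.2.2
    · intro v _
      exact hinv v
  rw [Finset.sum_const, nsmul_eq_mul, mul_one] at h
  exact even_iff_two_dvd.2 ((ZMod.natCast_eq_zero_iff _ 2).1 h)

/-- A partition of a part of the vertex set as it arises from a search: `O` and `T` are the
vertices reached only at even and only at odd distance, `B` those reached both ways. -/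
structure SearchClasses (G : SimpleGraph V) (m : V → V) (O T B : Finset V) (k : ℕ) : Prop where
  inv : ∀ v, m (m v) = v
  mate : ∀ v ∈ B, m v ∈ B ∧ m v ≠ v ∧ G.Adj v (m v)
  disjOT : Disjoint O T
  disjOB : Disjoint O B
  disjTB : Disjoint T B
  card : O.card = T.card + k

variable [Fintype V] [DecidableRel G.Adj] {m : V → V} {O T : Finset V} {k d : ℕ}

/-- The number of edges between components of `B` and vertices of `O` other than the chosen one. -/
noncomputable def extraCount (G : SimpleGraph V) [DecidableRel G.Adj] (O B : Finset V)
    (o : Finset V → V) : ℕ := ∑ Q ∈ comps G B, adjCount G Q (O.erase (o Q))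

theorem adjCount_split (S O T B : Finset V) (hOT : Disjoint O T) (hOB : Disjoint O B)
    (hTB : Disjoint T B) (hreg : G.IsRegularOfDegree d) :
    d * S.card = adjCount G S O + adjCount G S T + adjCount G S B +
      adjCount G S (O ∪ T ∪ B)ᶜ := by
  rw [← adjCount_univ hreg, ← Finset.union_compl (O ∪ T ∪ B),
    adjCount_union_right disjoint_compl_right,
    adjCount_union_right (Finset.disjoint_union_left.2 ⟨hOB, hTB⟩), adjCount_union_right hOT]

namespace SearchClasses

theorem balance (C : SearchClasses G m O T B k) (hreg : G.IsRegularOfDegree d) :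
    adjCount G O O + adjCount G O B + adjCount G O (O ∪ T ∪ B)ᶜ =
      d * k + adjCount G T T + adjCount G T B + adjCount G T (O ∪ T ∪ B)ᶜ := by
  have h1 := adjCount_split O O T B C.disjOT C.disjOB C.disjTB hreg
  have h2 := adjCount_split T O T B C.disjOT C.disjOB C.disjTB hreg
  rw [C.card, mul_add] at h1
  have h3 : adjCount G T O = adjCount G O T := adjCount_comm
  omega

theorem cut_component (C : SearchClasses G m O T B k) (hreg : G.IsRegularOfDegree d)
    {Q : Finset V} (hQ : Q ∈ comps G B) {o : V} (ho : o ∈ O) :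
    cutSize G (insert o Q) + adjCount G Q {o} =
      d + adjCount G Q (O.erase o) + adjCount G Q T + adjCount G Q (O ∪ T ∪ B)ᶜ := by
  have hoQ : o ∉ Q := fun h => Finset.disjoint_left.1 C.disjOB ho (subset_of_mem_comps hQ h)
  have hd : Disjoint {o} Q := Finset.disjoint_singleton_left.2 hoQ
  have h1 := adjCount_split Q O T B C.disjOT C.disjOB C.disjTB hreg
  have h2 : adjCount G Q B = adjCount G Q Q := by
    have : B = Q ∪ (B \ Q) := (Finset.union_sdiff_of_subset (subset_of_mem_comps hQ)).symm
    rw [this, adjCount_union_right Finset.disjoint_sdiff,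
      adjCount_eq_zero (S := Q) (T := B \ Q), add_zero]
    intro s hs t ht h
    rw [Finset.mem_sdiff] at ht
    exact ht.2 (mem_of_adj_of_mem_comps hQ hs ht.1 h)
  have h3 : adjCount G Q O = adjCount G Q {o} + adjCount G Q (O.erase o) := by
    rw [← adjCount_union_right (by simp), ← Finset.insert_eq, Finset.insert_erase ho]
  have h4 : d * (insert o Q).card = adjCount G (insert o Q) (insert o Q) +
      cutSize G (insert o Q) := by
    rw [cutSize_eq_adjCount, ← adjCount_union_right disjoint_compl_right, Finset.union_compl,
      adjCount_univ hreg]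
  have h5 : adjCount G (insert o Q) (insert o Q) = adjCount G Q Q + 2 * adjCount G Q {o} := by
    rw [Finset.insert_eq, adjCount_union_left hd, adjCount_union_right hd,
      adjCount_union_right hd, adjCount_singleton_self, adjCount_comm (S := {o}) (T := Q)]
    ring
  rw [Finset.card_insert_of_notMem hoQ, mul_add, mul_one] at h4
  omega

theorem sum_comps_erase (o : Finset V → V) (ho : ∀ Q ∈ comps G B, o Q ∈ O) :
    adjCount G B O = ∑ Q ∈ comps G B, adjCount G Q {o Q} + extraCount G O B o := by
  rw [adjCount_eq_sum_comps, extraCount, ← Finset.sum_add_distrib]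
  refine Finset.sum_congr rfl fun Q hQ => ?_
  rw [← adjCount_union_right (by simp), ← Finset.insert_eq, Finset.insert_erase (ho Q hQ)]

/-- Counting edges between the search classes, using that odd sets have large boundary. -/
theorem count (C : SearchClasses G m O T B k) (hreg : G.IsRegularOfDegree d)
    (hodd : ∀ H : Finset V, 3 ≤ H.card → Odd H.card → 2 ≤ Hᶜ.card → d + 1 ≤ cutSize G H)
    {u u' : V} (hu : u ∉ B) (hu' : u' ∉ B) (huu : u ≠ u') (o : Finset V → V)
    (ho : ∀ Q ∈ comps G B, o Q ∈ O) :
    d * k + adjCount G (O ∪ T ∪ B) (O ∪ T ∪ B)ᶜ + (comps G B).card ≤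
      2 * adjCount G (O ∪ B) (O ∪ T ∪ B)ᶜ + adjCount G O O + 2 * extraCount G O B o + 1 := by
  have hQ0 : ∀ Q ∈ comps G B, 3 ≤ (insert (o Q) Q).card ∧ Odd (insert (o Q) Q).card ∧
      Q.card + 2 ≤ Fintype.card V ∧ (insert (o Q) Q).card = Q.card + 1 := by
    intro Q hQ
    have hoQ : o Q ∉ Q := fun h =>
      Finset.disjoint_left.1 C.disjOB (ho Q hQ) (subset_of_mem_comps hQ h)
    have he := even_card_of_mem_comps C.inv C.mate hQ
    have hpos := (nonempty_of_mem_comps hQ).card_pos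
    rw [Finset.card_insert_of_notMem hoQ]
    refine ⟨by grind, by grind, ?_, rfl⟩
    have h1 : ({u, u'} : Finset V) ⊆ Qᶜ := by
      intro v hv
      rw [Finset.mem_compl]
      intro hvQ
      have := subset_of_mem_comps hQ hvQ
      simp only [Finset.mem_insert, Finset.mem_singleton] at hv
      rcases hv with rfl | rfl
      · exact hu this
      · exact hu' this
    have h2 := Finset.card_le_card h1
    rw [Finset.card_pair huu, Finset.card_compl] at h2
    omega
  have hcut : (comps G B).card * (d + 1) ≤ ∑ Q ∈ comps G B, cutSize G (insert (o Q) Q) + 1 := by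
    by_cases hall : ∀ Q ∈ comps G B, d + 1 ≤ cutSize G (insert (o Q) Q)
    · have := Finset.card_nsmul_le_sum _ _ _ hall
      rw [smul_eq_mul] at this
      omega
    · push Not at hall
      obtain ⟨Q, hQ, hlt⟩ := hall
      obtain ⟨h1, h2, h3, h4⟩ := hQ0 Q hQ
      have hc : (insert (o Q) Q)ᶜ.card = 1 := by
        have h5 : (insert (o Q) Q)ᶜ.card < 2 := by
          by_contra h
          have := hodd _ h1 h2 (by omega)
          omega
        rw [Finset.card_compl] at h5 ⊢
        omega
      have hQB : Q = B := by
        refine Finset.eq_of_subset_of_card_le (subset_of_mem_comps hQ) ?_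
        have h1 : ({u, u'} : Finset V) ⊆ Bᶜ := by
          intro v hv
          rw [Finset.mem_compl]
          simp only [Finset.mem_insert, Finset.mem_singleton] at hv
          rcases hv with rfl | rfl
          · exact hu
          · exact hu'
        have h2 := Finset.card_le_card h1
        rw [Finset.card_pair huu, Finset.card_compl] at h2
        rw [Finset.card_compl] at hc
        omega
      have hone : comps G B = {Q} := by
        refine Finset.eq_singleton_iff_unique_mem.2 ⟨hQ, fun Q' hQ' => ?_⟩
        obtain ⟨b, hb⟩ := nonempty_of_mem_comps hQ'
        have hbQ : b ∈ Q := hQB ▸ subset_of_mem_comps hQ' hb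
        exact (eq_comp_of_mem hQ' hb).trans (eq_comp_of_mem hQ hbQ).symm
      have hd : cutSize G (insert (o Q) Q) = d := by
        have := adjCount_univ (S := (insert (o Q) Q)ᶜ) hreg
        rw [hc, mul_one, ← Finset.union_compl (insert (o Q) Q),
          adjCount_union_right disjoint_compl_right] at this
        obtain ⟨z, hz⟩ := Finset.card_eq_one.1 hc
        rw [cutSize_eq_adjCount, adjCount_comm, ← this]
        rw [hz, adjCount_singleton_self, add_zero]
      rw [hone, Finset.card_singleton, Finset.sum_singleton, hd]
      omega
  have hsum : ∑ Q ∈ comps G B, (cutSize G (insert (o Q) Q) + adjCount G Q {o Q}) =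
      ∑ Q ∈ comps G B, (d + adjCount G Q (O.erase (o Q)) + adjCount G Q T +
        adjCount G Q (O ∪ T ∪ B)ᶜ) :=
    Finset.sum_congr rfl fun Q hQ => C.cut_component hreg hQ (ho Q hQ)
  simp only [Finset.sum_add_distrib, Finset.sum_const, smul_eq_mul] at hsum
  rw [← adjCount_eq_sum_comps T, ← adjCount_eq_sum_comps, ← extraCount] at hsum
  have hBO := sum_comps_erase o ho (O := O)
  have hbal := C.balance hreg
  have hOB : adjCount G (O ∪ B) (O ∪ T ∪ B)ᶜ =
      adjCount G O (O ∪ T ∪ B)ᶜ + adjCount G B (O ∪ T ∪ B)ᶜ := adjCount_union_left C.disjOB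
  have hX : adjCount G (O ∪ T ∪ B) (O ∪ T ∪ B)ᶜ = adjCount G O (O ∪ T ∪ B)ᶜ +
      adjCount G T (O ∪ T ∪ B)ᶜ + adjCount G B (O ∪ T ∪ B)ᶜ := by
    rw [adjCount_union_left (Finset.disjoint_union_left.2 ⟨C.disjOB, C.disjTB⟩),
      adjCount_union_left C.disjOT]
  have c1 : adjCount G B O = adjCount G O B := adjCount_comm
  have c2 : adjCount G B T = adjCount G T B := adjCount_comm
  rw [mul_add, mul_one] at hcut
  omega

theorem cut_both_le (C : SearchClasses G m O T B k) (hreg : G.IsRegularOfDegree d)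
    (o : Finset V → V) (ho : ∀ Q ∈ comps G B, o Q ∈ O) :
    cutSize G B ≤ 2 * (d * (comps G B).card) + 2 * extraCount G O B o + adjCount G O O +
      adjCount G (O ∪ B) (O ∪ T ∪ B)ᶜ := by
  have hBO := sum_comps_erase o ho (O := O)
  have hle : ∑ Q ∈ comps G B, adjCount G Q {o Q} ≤ d * (comps G B).card := by
    rw [mul_comm, ← smul_eq_mul]
    refine Finset.sum_le_card_nsmul _ _ _ fun Q _ => ?_
    simpa using adjCount_le_right (S := Q) (T := {o Q}) hreg
  have hbal := C.balance hreg
  have hOB : adjCount G (O ∪ B) (O ∪ T ∪ B)ᶜ =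
      adjCount G O (O ∪ T ∪ B)ᶜ + adjCount G B (O ∪ T ∪ B)ᶜ := adjCount_union_left C.disjOB
  have c1 : adjCount G B O = adjCount G O B := adjCount_comm
  have c2 : adjCount G B T = adjCount G T B := adjCount_comm
  have h1 := adjCount_split B O T B C.disjOT C.disjOB C.disjTB hreg
  have h2 : d * B.card = adjCount G B B + cutSize G B := by
    rw [cutSize_eq_adjCount, ← adjCount_union_right disjoint_compl_right, Finset.union_compl,
      adjCount_univ hreg]
  omega

end SearchClasses

end ExpanderMatching

namespace ExpanderMatching

variable {V : Type*} [DecidableEq V]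

open Classical in
/-- The gates that share a component of the vertices reached both ways with another gate. -/
noncomputable def multis (G : SimpleGraph V) (m : V → V) (A U : Finset V) (n w : ℕ) : Finset V :=
  (gates G m A U n w).filter (IsMulti G m A U n w)

variable {G : SimpleGraph V} {m : V → V} {A U K : Finset V} {n w L r d : ℕ} {x u u' : V}

theorem mem_multis : x ∈ multis G m A U n w ↔ IsMulti G m A U n w x := by
  simp only [multis, Finset.mem_filter, and_iff_right_iff_imp]
  exact fun h => h.1

theorem multis_subset : multis G m A U n w ⊆ gates G m A U n w := by
  classical exact Finset.filter_subset _ _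

theorem IsMulti.exists_ne (h : IsMulti G m A U n w x) : ∃ y, y ≠ x ∧ IsMulti G m A U n w y := by
  obtain ⟨hx, y, hy, hyx, b, hb, b', hb', h1, h2, hc⟩ := h
  exact ⟨y, hyx, hy, x, hx, hyx.symm, b', hb', b, hb, h2, h1, hc.symm⟩

theorem out_union_both : (outSet G m A U n \ inSet G m A U n) ∪ bothSet G m A U n =
    outSet G m A U n := Finset.sdiff_union_inter _ _

theorem classes_union : (outSet G m A U n \ inSet G m A U n) ∪ (inSet G m A U n \ outSet G m A U n)
    ∪ bothSet G m A U n = reached G m A U n := by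
  ext v
  simp only [Finset.mem_union, Finset.mem_sdiff, mem_bothSet, reached]
  tauto

theorem card_bothSet_add_absorbed_le :
    (bothSet G m A U n).card + (absorbed G m A U n w).card ≤ (bothSet G m A U (n + w)).card := by
  rw [← Finset.card_union_of_disjoint]
  · refine Finset.card_le_card (Finset.union_subset (bothSet_mono (Nat.le_add_right n w)) ?_)
    intro v hv
    obtain ⟨h1, h2, -⟩ := mem_absorbed.1 hv
    exact mem_bothSet.2 ⟨outSet_mono (Nat.le_add_right n w) h1, h2⟩
  · rw [Finset.disjoint_left]
    intro v h1 h2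
    exact (mem_absorbed.1 h2).2.2 (mem_bothSet.1 h1).2

theorem card_reached_add_sdiff : (reached G m A U n).card +
    (reached G m A U (n + w) \ reached G m A U n).card = (reached G m A U (n + w)).card := by
  rw [add_comm, Finset.card_sdiff_add_card_eq_card (reached_mono (Nat.le_add_right n w))]

namespace SearchInstance

theorem searchClasses (I : SearchInstance G m A U) (hN : NoAug G m A U L) (hn : n ≤ L)
    (he : Even n) :
    SearchClasses G m (outSet G m A U n \ inSet G m A U n) (inSet G m A U n \ outSet G m A U n)
      (bothSet G m A U n) U.card where
  inv := I.inv
  mate := by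
    intro v hv
    obtain ⟨h1, h2, -⟩ := I.mate_mem_bothSet hN hn he hv
    exact ⟨h1, h2, I.madj v h2⟩
  disjOT := Finset.disjoint_left.2 fun v h1 h2 => by
    simp only [Finset.mem_sdiff] at h1 h2
    exact h1.2 h2.1
  disjOB := Finset.disjoint_left.2 fun v h1 h2 => by
    simp only [Finset.mem_sdiff, mem_bothSet] at h1 h2
    exact h1.2 h2.2
  disjTB := Finset.disjoint_left.2 fun v h1 h2 => by
    simp only [Finset.mem_sdiff, mem_bothSet] at h1 h2
    exact h1.2 h2.1
  card := by
    have hUO : U ⊆ outSet G m A U n \ inSet G m A U n := fun u hu =>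
      Finset.mem_sdiff.2 ⟨I.root_mem_out hu, hN.root_notMem_in hn hu⟩
    rw [← Finset.card_sdiff_add_card_eq_card hUO]
    congr 1
    have hinj : Function.Injective m := fun a b h => by rw [← I.inv a, h, I.inv]
    rw [← Finset.card_image_of_injective _ hinj]
    congr 1
    ext v
    simp only [Finset.mem_image, Finset.mem_sdiff]
    constructor
    · rintro ⟨w, ⟨⟨h1, h2⟩, h3⟩, rfl⟩
      refine ⟨I.mate_mem_in h3 h1, fun h => h2 ?_⟩
      have := I.mate_mem_in (I.mate_notMem_root (outSet_subset h1) h3) h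
      rwa [I.inv] at this
    · rintro ⟨h1, h2⟩
      have hU : v ∉ U := fun h => hN.root_notMem_in hn h h1
      refine ⟨m v, ⟨⟨I.mate_mem_out hN hn he h1, fun h => h2 ?_⟩,
        I.mate_notMem_root (inSet_subset h1) hU⟩, I.inv v⟩
      have := I.mate_mem_out hN hn he h
      rwa [I.inv] at this

theorem adjCount_out_compl_le [Fintype V] [DecidableRel G.Adj] (I : SearchInstance G m A U)
    (hreg : G.IsRegularOfDegree d) (hw : 1 ≤ w) :
    adjCount G (outSet G m A U n) (reached G m A U n)ᶜ ≤
      d * (reached G m A U (n + w) \ reached G m A U n).card +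
        adjCount G (outSet G m A U n) Aᶜ := by
  have hdis : Disjoint (reached G m A U (n + w) \ reached G m A U n) Aᶜ :=
    Finset.disjoint_left.2 fun v h1 h2 =>
      Finset.mem_compl.1 h2 (reached_subset (Finset.mem_sdiff.1 h1).1)
  refine le_trans ?_ (Nat.add_le_add_right
    (adjCount_le_right (S := outSet G m A U n) hreg) _)
  rw [← adjCount_union_right hdis]
  refine adjCount_le_of_imp fun s hs t ht ha => ⟨hs, ?_⟩
  rw [Finset.mem_compl] at ht
  by_cases htA : t ∈ A
  · refine Finset.mem_union_left _ (Finset.mem_sdiff.2 ⟨?_, ht⟩)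
    simp only [reached, Finset.mem_union, not_or] at ht ⊢
    exact Or.inr (inSet_mono (by omega) (I.adj_out_reached hs htA ha ht.1 ht.2))
  · exact Finset.mem_union_right _ (Finset.mem_compl.2 htA)

theorem adjCount_out_out_le [Fintype V] [DecidableRel G.Adj] (I : SearchInstance G m A U)
    (hreg : G.IsRegularOfDegree d) (hw : 1 ≤ w) :
    adjCount G (outSet G m A U n \ inSet G m A U n) (outSet G m A U n \ inSet G m A U n) ≤
      2 * (d * (absorbed G m A U n w).card) := by
  set O := outSet G m A U n \ inSet G m A U n with hO
  have hsub : absorbed G m A U n w ⊆ O := fun v hv => by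
    obtain ⟨h1, -, h2⟩ := mem_absorbed.1 hv
    exact Finset.mem_sdiff.2 ⟨h1, h2⟩
  have key : adjCount G (O \ absorbed G m A U n w) O ≤ adjCount G O (absorbed G m A U n w) := by
    refine adjCount_le_of_imp fun s hs t ht ha => ?_
    obtain ⟨hsO, hs'⟩ := Finset.mem_sdiff.1 hs
    refine ⟨hsO, ?_⟩
    obtain ⟨h1, h2⟩ := Finset.mem_sdiff.1 hsO
    obtain ⟨h3, h4⟩ := Finset.mem_sdiff.1 ht
    rcases I.adj_out_out h1 h3 ha with h | h
    · exact absurd (mem_absorbed.2 ⟨h1, inSet_mono (by omega) h, h2⟩) hs'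
    · exact mem_absorbed.2 ⟨h3, inSet_mono (by omega) h, h4⟩
  have h1 : adjCount G O O = adjCount G (absorbed G m A U n w) O +
      adjCount G (O \ absorbed G m A U n w) O := by
    rw [← adjCount_union_left Finset.disjoint_sdiff, Finset.union_sdiff_of_subset hsub]
  have h2 := adjCount_le_left (S := absorbed G m A U n w) (T := O) hreg
  have h3 := adjCount_le_right (S := O) (T := absorbed G m A U n w) hreg
  omega

/-- Each component of the vertices reached both ways can be assigned a vertex such that few edges
lead from the components to other vertices reached only at even distance. -/
theorem exists_extraCount_le [Fintype V] [DecidableRel G.Adj] (I : SearchInstance G m A U)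
    (hN : NoAug G m A U L) (hL : n + w ≤ L) (hu : u ∈ U) (hreg : G.IsRegularOfDegree d) :
    ∃ o : Finset V → V,
      (∀ Q ∈ comps G (bothSet G m A U n), o Q ∈ outSet G m A U n \ inSet G m A U n) ∧
      extraCount G (outSet G m A U n \ inSet G m A U n) (bothSet G m A U n) o ≤
        d * ((absorbed G m A U n w).card + (multis G m A U n w).card) := by
  classical
  let P : Finset V → V → Prop := fun Q x => x ∈ gates G m A U n w ∧ ∃ b ∈ Q, G.Adj x b
  let o : Finset V → V := fun Q => if h : ∃ x, P Q x then h.choose else u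
  have ho : ∀ Q, (∃ x, P Q x) → P Q (o Q) := fun Q h => by
    simp only [o, dif_pos h]
    exact h.choose_spec
  refine ⟨o, fun Q _ => ?_, ?_⟩
  · by_cases h : ∃ x, P Q x
    · obtain ⟨h1, h2⟩ := mem_gates.1 (ho Q h).1
      exact Finset.mem_sdiff.2 ⟨h1, fun h => h2 (inSet_mono (Nat.le_add_right n w) h)⟩
    · simp only [o, dif_neg h]
      exact Finset.mem_sdiff.2 ⟨I.root_mem_out hu, hN.root_notMem_in (by omega) hu⟩
  · calc _ ≤ ∑ Q ∈ comps G (bothSet G m A U n),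
          adjCount G Q (absorbed G m A U n w ∪ multis G m A U n w) := by
          refine Finset.sum_le_sum fun Q hQ => adjCount_le_of_imp fun s hs t ht ha => ⟨hs, ?_⟩
          obtain ⟨hne, ht⟩ := Finset.mem_erase.1 ht
          obtain ⟨h1, h2⟩ := Finset.mem_sdiff.1 ht
          rw [Finset.mem_union]
          by_cases h3 : t ∈ inSet G m A U (n + w)
          · exact Or.inl (mem_absorbed.2 ⟨h1, h3, h2⟩)
          have htg := mem_gates.2 ⟨h1, h3⟩
          obtain ⟨hog, b, hb, hob⟩ := ho Q ⟨t, htg, s, hs, ha.symm⟩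
          refine Or.inr (mem_multis.2 ⟨htg, o Q, hog, hne.symm, s, subset_of_mem_comps hQ hs, b,
            subset_of_mem_comps hQ hb, ha.symm, hob, ?_⟩)
          rw [eq_comp_of_mem hQ hs] at hb
          exact (mem_comp.1 hb).2
      _ = adjCount G (bothSet G m A U n) (absorbed G m A U n w ∪ multis G m A U n w) :=
          (adjCount_eq_sum_comps _).symm
      _ ≤ _ := (adjCount_le_right hreg).trans
          (Nat.mul_le_mul_left d (Finset.card_union_le _ _))

/-- The growth inequalities: either many vertices are reached, or many are absorbed, or there are
many gates that share a component. -/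
theorem growth [Fintype V] [DecidableRel G.Adj] (I : SearchInstance G m A U)
    (hN : NoAug G m A U L) (hL : n + w ≤ L) (hn : Even n) (hw : 1 ≤ w) (hu : u ∈ U)
    (hu' : u' ∉ bothSet G m A U n) (huu : u ≠ u') (hreg : G.IsRegularOfDegree d)
    (hodd : ∀ H : Finset V, 3 ≤ H.card → Odd H.card → 2 ≤ Hᶜ.card → d + 1 ≤ cutSize G H) :
    d * U.card + cutSize G (reached G m A U n) + (comps G (bothSet G m A U n)).card ≤
      2 * (d * (reached G m A U (n + w) \ reached G m A U n).card) +
      2 * adjCount G (outSet G m A U n) Aᶜ + 4 * (d * (absorbed G m A U n w).card) +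
      2 * (d * (multis G m A U n w).card) + 1 ∧
    cutSize G (bothSet G m A U n) ≤ 2 * (d * (comps G (bothSet G m A U n)).card) +
      d * (reached G m A U (n + w) \ reached G m A U n).card +
      adjCount G (outSet G m A U n) Aᶜ + 4 * (d * (absorbed G m A U n w).card) +
      2 * (d * (multis G m A U n w).card) := by
  obtain ⟨o, ho, hex⟩ := I.exists_extraCount_le hN hL hu hreg
  have C := I.searchClasses hN (by omega : n ≤ L) hn
  have huB : u ∉ bothSet G m A U n := fun h =>
    hN.root_notMem_in (by omega) hu (mem_bothSet.1 h).2
  have h1 := C.count hreg hodd huB hu' huu o ho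
  have h2 := C.cut_both_le hreg o ho
  have h3 := I.adjCount_out_out_le (n := n) hreg hw
  have h4 := I.adjCount_out_compl_le (n := n) hreg hw
  rw [classes_union, out_union_both] at h1 h2
  rw [← cutSize_eq_adjCount] at h1
  rw [mul_add] at hex
  omega

/-- Up to few exceptions, the gates that share a component have large zones. -/
theorem exists_multis_zone_large [Fintype V] [DecidableRel G.Adj] (I : SearchInstance G m A U)
    (hN : NoAug G m A U L) (hL : n + w ≤ L) (hn : Even n) (hr : r + 1 ≤ w)
    (hreg : G.IsRegularOfDegree d) :
    ∃ K ⊆ multis G m A U n w,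
      (multis G m A U n w).card ≤ K.card + d * (absorbed G m A U n w).card ∧
      ∀ x ∈ K, r ≤ (zone G m A U n x r).card := by
  classical
  refine ⟨(multis G m A U n w).filter fun x => r ≤ (zone G m A U n x r).card,
    Finset.filter_subset _ _, ?_, fun x hx => (Finset.mem_filter.1 hx).2⟩
  rw [← Finset.card_filter_add_card_filter_not (s := multis G m A U n w)
    fun x => r ≤ (zone G m A U n x r).card]
  refine Nat.add_le_add_left (I.card_adj_absorbed_le hN hL hr hreg
    ((Finset.filter_subset _ _).trans multis_subset) fun x hx => ?_) _
  obtain ⟨h1, h2⟩ := Finset.mem_filter.1 hx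
  exact (I.zone_large_or_adj_absorbed hN hL hn (mem_multis.1 h1) hr).resolve_left h2

theorem sum_zone_le [Fintype V] (I : SearchInstance G m A U)
    (hN : NoAug G m A U L) (hL : n + w ≤ L) (hr : r + 1 ≤ w) (hK : K ⊆ gates G m A U n w) :
    ∑ x ∈ K, ((zone G m A U n x r).erase x).card ≤ (bothSet G m A U n).card := by
  rw [← Finset.card_biUnion]
  · refine Finset.card_le_card fun v hv => ?_
    obtain ⟨x, -, hv⟩ := Finset.mem_biUnion.1 hv
    obtain ⟨h1, h2⟩ := Finset.mem_erase.1 hv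
    exact (Finset.mem_insert.1 (zone_subset h2)).resolve_left h1
  · intro x hx y hy hxy
    exact (I.zone_disjoint hN hL (hK hx) (hK hy) hr hxy).mono (Finset.erase_subset _ _)
      (Finset.erase_subset _ _)

theorem sum_card_zone_le [Fintype V] (I : SearchInstance G m A U) (hN : NoAug G m A U L)
    (hL : n + w ≤ L) (hr : r + 1 ≤ w) (hK : K ⊆ gates G m A U n w) :
    ∑ x ∈ K, (zone G m A U n x r).card ≤ Fintype.card V := by
  rw [← Finset.card_biUnion]
  · exact Finset.card_le_univ _
  · intro x hx y hy hxy
    exact I.zone_disjoint hN hL (hK hx) (hK hy) hr hxy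

theorem card_multis_le [Fintype V] [DecidableRel G.Adj] (I : SearchInstance G m A U)
    (hN : NoAug G m A U L) (hL : n + w ≤ L) (hn : Even n) (hr : r + 1 ≤ w)
    (hreg : G.IsRegularOfDegree d) :
    (r - 1) * (multis G m A U n w).card ≤
      (bothSet G m A U n).card + (r - 1) * (d * (absorbed G m A U n w).card) := by
  obtain ⟨K, hK, h1, h2⟩ := I.exists_multis_zone_large hN hL hn hr hreg
  have h3 := I.sum_zone_le hN hL hr (hK.trans multis_subset)
  have h4 : (r - 1) * K.card ≤ (bothSet G m A U n).card := by
    refine le_trans ?_ h3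
    rw [mul_comm, ← smul_eq_mul]
    refine Finset.card_nsmul_le_sum _ _ _ fun x hx => ?_
    rw [Finset.card_erase_of_mem root_mem_zone]
    have := h2 x hx
    omega
  calc _ ≤ (r - 1) * (K.card + d * (absorbed G m A U n w).card) := Nat.mul_le_mul_left _ h1
    _ = (r - 1) * K.card + (r - 1) * (d * (absorbed G m A U n w).card) := mul_add _ _ _
    _ ≤ _ := by omega

end SearchInstance

end ExpanderMatching

namespace ExpanderMatching

variable {V : Type*} [DecidableEq V] [Fintype V] {G : SimpleGraph V} [DecidableRel G.Adj]
  {m : V → V} {A U : Finset V} {n w w₀ L r d : ℕ} {x u u' : V} {c₀ : ℝ}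

/-- The growth rate of a search from a single root. -/
noncomputable def localRate (c₀ : ℝ) (d : ℕ) : ℝ := c₀ / (16 * (4 * d + 2 * d ^ 2))

theorem IsExpander.half_le_cutSize (hexp : IsExpander c₀ G) (hc₀ : 0 ≤ c₀) {H : Finset V}
    (hH : 2 * H.card ≤ Fintype.card V) : c₀ / 2 * H.card ≤ cutSize G H := by
  refine le_trans ?_ (hexp H)
  have h1 : (H.card : ℝ) + Hᶜ.card = Fintype.card V := by
    exact_mod_cast Finset.card_add_card_compl H
  have h2 : (2 : ℝ) * H.card ≤ Fintype.card V := by exact_mod_cast hH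
  rcases Finset.eq_empty_or_nonempty H with rfl | hne
  · simp
  have h3 : (0 : ℝ) < H.card := by exact_mod_cast hne.card_pos
  rw [le_div_iff₀ (by linarith)]
  have : 0 ≤ c₀ * H.card := by positivity
  nlinarith

/-- A search from a single root grows in each window of constant length. -/
theorem SearchInstance.local_growth (J : SearchInstance G m A {x}) (hu' : u' ∉ A)
    (hn : Even n) (hw : 2 ≤ w) (hwc : 8 * d ≤ c₀ * (w - 2)) (hd : 1 ≤ d)
    (hc₀ : 0 < c₀) (hreg : G.IsRegularOfDegree d) (hexp : IsExpander c₀ G)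
    (hodd : ∀ H : Finset V, 3 ≤ H.card → Odd H.card → 2 ≤ Hᶜ.card → d + 1 ≤ cutSize G H)
    (hhalf : 2 * (reached G m A {x} n).card ≤ Fintype.card V) {δ : ℝ}
    (hδ : adjCount G (reached G m A {x} n) Aᶜ ≤ δ)
    (hφ : 32 * δ ≤ c₀ * ((reached G m A {x} n).card + (bothSet G m A {x} n).card)) :
    (1 + localRate c₀ d) * ((reached G m A {x} n).card + (bothSet G m A {x} n).card) ≤
      (reached G m A {x} (n + w)).card + (bothSet G m A {x} (n + w)).card := by
  have hN : NoAug G m A {x} (n + w) := noAug_singleton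
  have hxA : x ∈ A := J.sub (Finset.mem_singleton_self x)
  have h1 := (J.growth hN le_rfl hn (by omega : 1 ≤ w) (Finset.mem_singleton_self x)
    (fun h => hu' (reached_subset (bothSet_subset_reached h))) (fun h => hu' (h ▸ hxA)) hreg
    hodd).1
  have h2 := J.card_multis_le hN le_rfl hn (by omega : w - 1 + 1 ≤ w) hreg
  have h3 := card_bothSet_add_absorbed_le (G := G) (m := m) (A := A) (U := {x}) (n := n) (w := w)
  have h4 := card_reached_add_sdiff (G := G) (m := m) (A := A) (U := {x}) (n := n) (w := w)
  have h5 := hexp.half_le_cutSize hc₀.le hhalf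
  have h6 : adjCount G (outSet G m A {x} n) Aᶜ ≤ adjCount G (reached G m A {x} n) Aᶜ :=
    adjCount_mono Finset.subset_union_left le_rfl
  have h7 := Finset.card_le_card (bothSet_subset_reached (G := G) (m := m) (A := A) (U := {x})
    (n := n))
  rw [Finset.card_singleton] at h1
  generalize (reached G m A {x} (n + w) \ reached G m A {x} n).card = Δ at *
  generalize (absorbed G m A {x} n w).card = a at *
  generalize (multis G m A {x} n w).card = M at *
  generalize (comps G (bothSet G m A {x} n)).card = q at *
  generalize (reached G m A {x} (n + w)).card = X' at *
  generalize (bothSet G m A {x} (n + w)).card = B' at *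
  generalize (reached G m A {x} n).card = X at *
  generalize (bothSet G m A {x} n).card = B at *
  generalize cutSize G (reached G m A {x} n) = cX at *
  generalize adjCount G (outSet G m A {x} n) Aᶜ = e at *
  generalize adjCount G (reached G m A {x} n) Aᶜ = e' at *
  obtain ⟨W, rfl⟩ : ∃ W, w = W + 2 := ⟨w - 2, by omega⟩
  have e2 : W + 2 - 1 - 1 = W := by omega
  rw [e2] at h2
  have h1' : cX ≤ 2 * (d * Δ) + 2 * e + 4 * (d * a) + 2 * (d * M) := by omega
  have k1 : (cX : ℝ) ≤ 2 * (d * Δ) + 2 * e + 4 * (d * a) + 2 * (d * M) := by exact_mod_cast h1'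
  have k2 : (W : ℝ) * M ≤ B + W * (d * a) := by exact_mod_cast h2
  have k3 : (B : ℝ) + a ≤ B' := by exact_mod_cast h3
  have k4 : (X : ℝ) + Δ = X' := by exact_mod_cast h4
  have k6 : (e : ℝ) ≤ δ := le_trans (by exact_mod_cast h6) hδ
  have k7 : (B : ℝ) ≤ X := by exact_mod_cast h7
  have hd' : (1 : ℝ) ≤ d := by exact_mod_cast hd
  push_cast at hwc
  have hWc : 8 * (d : ℝ) ≤ c₀ * W := by linarith
  have hW : (0 : ℝ) < W := by
    by_contra h
    nlinarith [Nat.cast_nonneg (α := ℝ) W]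
  have k8 : 8 * (d * ((M : ℝ) - d * a)) ≤ c₀ * X := by
    rcases le_total ((M : ℝ) - d * a) 0 with h | h
    · have : (0 : ℝ) ≤ c₀ * X := by positivity
      nlinarith
    · calc 8 * (d * ((M : ℝ) - d * a)) = (8 * d) * ((M : ℝ) - d * a) := by ring
        _ ≤ c₀ * W * ((M : ℝ) - d * a) := mul_le_mul_of_nonneg_right hWc h
        _ = c₀ * (W * M - W * (d * a)) := by ring
        _ ≤ c₀ * X := mul_le_mul_of_nonneg_left (by linarith) hc₀.le
  set C : ℝ := 4 * d + 2 * d ^ 2 with hC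
  have hCpos : 0 < C := by positivity
  have k9 : c₀ / 4 * X ≤ C * (Δ + a) + 2 * δ := by
    have e1 : (0 : ℝ) ≤ d * Δ := by positivity
    have e2 : (0 : ℝ) ≤ d ^ 2 * Δ := by positivity
    rw [hC]
    nlinarith
  have k10 : c₀ * (X + B) ≤ 16 * C * (Δ + a) := by nlinarith
  have k11 : localRate c₀ d * (X + B) ≤ Δ + a := by
    rw [localRate, div_mul_eq_mul_div, div_le_iff₀ (by positivity)]
    linarith
  nlinarith

theorem localRate_pos (hc₀ : 0 < c₀) (hd : 1 ≤ d) : 0 < localRate c₀ d := by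
  have : (0 : ℝ) < d := by exact_mod_cast hd
  unfold localRate
  positivity

/-- A search from a single root grows exponentially as long as few edges leave the search space. -/
theorem SearchInstance.local_growth_pow (J : SearchInstance G m A {x}) (hu' : u' ∉ A)
    (hn : Even n) (hwe : Even w) (hw : 2 ≤ w) (hwc : 8 * d ≤ c₀ * (w - 2)) (hd : 1 ≤ d)
    (hc₀ : 0 < c₀) (hreg : G.IsRegularOfDegree d) (hexp : IsExpander c₀ G)
    (hodd : ∀ H : Finset V, 3 ≤ H.card → Odd H.card → 2 ≤ Hᶜ.card → d + 1 ≤ cutSize G H)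
    (k : ℕ) (hhalf : 2 * (reached G m A {x} (n + k * w)).card ≤ Fintype.card V) {δ : ℝ}
    (hδ : adjCount G (reached G m A {x} (n + k * w)) Aᶜ ≤ δ)
    (hφ : 32 * δ ≤ c₀ * (reached G m A {x} n).card) :
    (1 + localRate c₀ d) ^ k * (reached G m A {x} n).card ≤
      2 * (reached G m A {x} (n + k * w)).card := by
  have hpos := localRate_pos (c₀ := c₀) hc₀ hd
  have key : ∀ j ≤ k, (1 + localRate c₀ d) ^ j * (reached G m A {x} n).card ≤
      (reached G m A {x} (n + j * w)).card + (bothSet G m A {x} (n + j * w)).card := by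
    intro j
    induction j with
    | zero => intro _; simp
    | succ j ih =>
      intro hj
      have ih := ih (by omega)
      have hjk : n + j * w ≤ n + k * w := by gcongr; omega
      have hsub := reached_mono (G := G) (m := m) (A := A) (U := {x}) hjk
      have h1 := J.local_growth hu' (n := n + j * w) (w := w)
        (hn.add (hwe.mul_left j)) hw hwc hd hc₀ hreg hexp hodd (δ := δ)
        (le_trans (Nat.mul_le_mul_left 2 (Finset.card_le_card hsub)) hhalf)
        (le_trans (by exact_mod_cast adjCount_mono hsub le_rfl) hδ) (hφ.trans ?_)
      · rw [add_assoc, ← Nat.succ_mul] at h1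
        rw [pow_succ]
        nlinarith
      · refine mul_le_mul_of_nonneg_left (le_trans ?_ ih) hc₀.le
        have : (1 : ℝ) ≤ (1 + localRate c₀ d) ^ j := one_le_pow₀ (by linarith)
        have h0 : (0 : ℝ) ≤ (reached G m A {x} n).card := Nat.cast_nonneg _
        nlinarith
  have h1 := key k le_rfl
  have h2 : ((bothSet G m A {x} (n + k * w)).card : ℝ) ≤ (reached G m A {x} (n + k * w)).card := by
    exact_mod_cast Finset.card_le_card bothSet_subset_reached
  linarith

namespace SearchInstance

theorem sum_adjCount_zone_le (I : SearchInstance G m A U) (hN : NoAug G m A U L) (hL : n + w ≤ L)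
    (hr : r + 1 ≤ w) (hreg : G.IsRegularOfDegree d) {K : Finset V}
    (hK : K ⊆ gates G m A U n w) :
    ∑ x ∈ K, adjCount G ((zone G m A U n x r).erase x) (bothSet G m A U n)ᶜ ≤
      d * (bothSet G m A U n)ᶜ.card := by
  rw [← adjCount_biUnion_left]
  · exact adjCount_le_right hreg
  · intro x hx y hy hxy
    exact (I.zone_disjoint hN hL (hK hx) (hK hy) hr hxy).mono (Finset.erase_subset _ _)
      (Finset.erase_subset _ _)

/-- The zone of a gate that shares a component grows exponentially if few edges leave it. -/
theorem zone_growth (I : SearchInstance G m A U) (hN : NoAug G m A U L) (hL : n ≤ L)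
    (hn : Even n) (hx : IsMulti G m A U n w x) {s k : ℕ} (hs : Even s) (hwe : Even w₀)
    (hw : 2 ≤ w₀) (hwc : 8 * d ≤ c₀ * (w₀ - 2)) (hd : 1 ≤ d)
    (hc₀ : 0 < c₀) (hreg : G.IsRegularOfDegree d) (hexp : IsExpander c₀ G)
    (hodd : ∀ H : Finset V, 3 ≤ H.card → Odd H.card → 2 ≤ Hᶜ.card → d + 1 ≤ cutSize G H)
    (hhalf : 2 * (zone G m A U n x (s + k * w₀)).card ≤ Fintype.card V) {δ : ℝ}
    (hδ : adjCount G ((zone G m A U n x (s + k * w₀)).erase x) (bothSet G m A U n)ᶜ ≤ δ)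
    (hsz : s ≤ (zone G m A U n x s).card) (hφ : 32 * (d + δ) ≤ c₀ * s) :
    (1 + localRate c₀ d) ^ k * s ≤ 2 * (zone G m A U n x (s + k * w₀)).card := by
  have hxB := gates_notMem_bothSet hx.1
  have J := I.local_instance hN hL hn hxB
  obtain ⟨y, hyx, hy⟩ := hx.exists_ne
  have hyA : y ∉ insert x (bothSet G m A U n) := by
    rw [Finset.mem_insert, not_or]
    exact ⟨hyx, gates_notMem_bothSet hy.1⟩
  have hδ' : adjCount G (zone G m A U n x (s + k * w₀)) (insert x (bothSet G m A U n))ᶜ ≤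
      d + δ := by
    have h1 : adjCount G (zone G m A U n x (s + k * w₀)) (insert x (bothSet G m A U n))ᶜ ≤
        d + adjCount G ((zone G m A U n x (s + k * w₀)).erase x) (bothSet G m A U n)ᶜ := by
      conv_lhs => rw [← Finset.insert_erase (root_mem_zone (G := G) (m := m) (A := A) (U := U)
        (n := n) (x := x) (r := s + k * w₀)), Finset.insert_eq x ((zone G m A U n x _).erase x)]
      rw [adjCount_union_left (by simp)]
      refine Nat.add_le_add ?_ (adjCount_mono le_rfl ?_)
      · exact (adjCount_le_left hreg).trans (by simp)
      · exact Finset.compl_subset_compl.2 (Finset.subset_insert _ _)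
    have h2 : (adjCount G (zone G m A U n x (s + k * w₀)) (insert x (bothSet G m A U n))ᶜ : ℝ) ≤
        d + adjCount G ((zone G m A U n x (s + k * w₀)).erase x) (bothSet G m A U n)ᶜ := by
      exact_mod_cast h1
    linarith
  have hs' : (s : ℝ) ≤ (zone G m A U n x s).card := by exact_mod_cast hsz
  have hpos := localRate_pos (c₀ := c₀) hc₀ hd
  refine le_trans ?_ (J.local_growth_pow hyA hs hwe hw hwc hd hc₀ hreg hexp hodd k hhalf hδ'
    (hφ.trans (mul_le_mul_of_nonneg_left hs' hc₀.le)))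
  exact mul_le_mul_of_nonneg_left hs' (by positivity)

/-- Few gates share a component compared to the complement of the vertices reached both ways. -/
theorem card_multis_le_compl (I : SearchInstance G m A U) (hN : NoAug G m A U L)
    (hL : n + w ≤ L) (hn : Even n) {s k : ℕ} (hs : Even s) (hwe : Even w₀)
    (hw : 2 ≤ w₀) (hwc : 8 * d ≤ c₀ * (w₀ - 2)) (hd : 1 ≤ d) (hc₀ : 0 < c₀)
    (hreg : G.IsRegularOfDegree d) (hexp : IsExpander c₀ G)
    (hodd : ∀ H : Finset V, 3 ≤ H.card → Odd H.card → 2 ≤ Hᶜ.card → d + 1 ≤ cutSize G H)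
    (hlen : s + k * w₀ + 1 ≤ w) {κ ε : ℝ} (hκ : 0 < κ) (hφ : 32 * (d + 8 * d / κ) ≤ c₀ * s)
    (hk : 8 ≤ κ * ε * (1 + localRate c₀ d) ^ k)
    (hε : ε * Fintype.card V ≤ (bothSet G m A U n)ᶜ.card) :
    ((multis G m A U n w).card : ℝ) ≤
      κ * (bothSet G m A U n)ᶜ.card + 8 * d * (absorbed G m A U n w).card := by
  classical
  by_contra hcon
  push Not at hcon
  set M := multis G m A U n w with hM
  set a := (absorbed G m A U n w).card with ha
  set b := (bothSet G m A U n)ᶜ.card with hb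
  set t := s + k * w₀ with ht
  have hb0 : (0 : ℝ) ≤ b := Nat.cast_nonneg _
  have hκb : 0 ≤ κ * b := by positivity
  have hda : (0 : ℝ) ≤ d * a := by positivity
  have hMpos : (0 : ℝ) < M.card := by linarith
  have hM2 : (2 : ℝ) ≤ M.card := by
    obtain ⟨x, hx⟩ := Finset.card_pos.1 (by exact_mod_cast hMpos : 0 < M.card)
    obtain ⟨y, hyx, hy⟩ := (mem_multis.1 hx).exists_ne
    have : 1 < M.card := Finset.one_lt_card.2 ⟨x, hx, y, mem_multis.2 hy, hyx.symm⟩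
    exact_mod_cast this
  obtain ⟨K, hKM, hKc, hKz⟩ := I.exists_multis_zone_large hN hL hn (r := s)
    (le_trans (by omega) hlen) hreg
  have hKg := hKM.trans multis_subset
  have hKc' : (M.card : ℝ) ≤ K.card + d * a := by exact_mod_cast hKc
  let K₁ := K.filter fun x => Fintype.card V < 2 * (zone G m A U n x t).card
  let K₂ := K.filter fun x =>
    8 * d / κ < adjCount G ((zone G m A U n x t).erase x) (bothSet G m A U n)ᶜ
  have hK₁ : K₁.card ≤ 1 := by
    by_contra h
    push Not at h
    have h1 := I.sum_card_zone_le hN hL hlen (K := K₁) ((Finset.filter_subset _ _).trans hKg)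
    have h2 : K₁.card * (Fintype.card V + 1) ≤
        ∑ x ∈ K₁, 2 * (zone G m A U n x t).card := by
      rw [← smul_eq_mul]
      exact Finset.card_nsmul_le_sum _ _ _ fun x hx => (Finset.mem_filter.1 hx).2
    rw [← Finset.mul_sum] at h2
    nlinarith
  have hK₂ : (8 : ℝ) * K₂.card ≤ κ * b := by
    have h1 := I.sum_adjCount_zone_le hN hL hlen hreg (K := K₂)
      ((Finset.filter_subset _ _).trans hKg)
    have h1' : (∑ x ∈ K₂, (adjCount G ((zone G m A U n x t).erase x) (bothSet G m A U n)ᶜ : ℝ)) ≤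
        d * b := by exact_mod_cast h1
    have h2 : (K₂.card : ℝ) * (8 * d / κ) ≤
        ∑ x ∈ K₂, (adjCount G ((zone G m A U n x t).erase x) (bothSet G m A U n)ᶜ : ℝ) := by
      rw [← nsmul_eq_mul]
      exact Finset.card_nsmul_le_sum _ _ _ fun x hx => (Finset.mem_filter.1 hx).2.le
    have h3 := h2.trans h1'
    rw [← mul_div_assoc, div_le_iff₀ hκ] at h3
    have hd' : (0 : ℝ) < d := by exact_mod_cast hd
    have : d * (8 * (K₂.card : ℝ)) ≤ d * (κ * b) := by linarith
    exact le_of_mul_le_mul_left this hd'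
  set K₃ := (K \ K₁) \ K₂ with hK₃
  have hK₃c : (K.card : ℝ) ≤ K₃.card + K₂.card + K₁.card := by
    have h1 : K.card ≤ (K \ K₁).card + K₁.card := Finset.card_le_card_sdiff_add_card
    have h2 : (K \ K₁).card ≤ K₃.card + K₂.card := Finset.card_le_card_sdiff_add_card
    exact_mod_cast (by omega : K.card ≤ K₃.card + K₂.card + K₁.card)
  have hK₁' : (K₁.card : ℝ) ≤ 1 := by exact_mod_cast hK₁
  have hK₃m : (M.card : ℝ) ≤ 4 * K₃.card := by linarith
  have hK₃K : K₃ ⊆ K := Finset.sdiff_subset.trans Finset.sdiff_subset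
  have hz : ∀ x ∈ K₃, (1 + localRate c₀ d) ^ k * s ≤ 2 * (zone G m A U n x t).card := by
    intro x hx
    obtain ⟨h1, h2⟩ := Finset.mem_sdiff.1 hx
    obtain ⟨h0, h1⟩ := Finset.mem_sdiff.1 h1
    simp only [K₁, K₂, Finset.mem_filter, h0, true_and, not_lt] at h1 h2
    exact I.zone_growth hN (by omega) hn (mem_multis.1 (hKM h0)) hs hwe hw hwc hd hc₀ hreg hexp
      hodd h1 h2 (hKz x h0) hφ
  have hsum : (K₃.card : ℝ) * ((1 + localRate c₀ d) ^ k * s) ≤ 2 * Fintype.card V := by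
    have h1 := I.sum_card_zone_le hN hL hlen (hK₃K.trans hKg)
    have h2 : (K₃.card : ℝ) * ((1 + localRate c₀ d) ^ k * s) ≤
        ∑ x ∈ K₃, 2 * ((zone G m A U n x t).card : ℝ) := by
      rw [← nsmul_eq_mul]
      exact Finset.card_nsmul_le_sum _ _ _ hz
    rw [← Finset.mul_sum] at h2
    have h1' : (∑ x ∈ K₃, ((zone G m A U n x t).card : ℝ)) ≤ Fintype.card V := by
      exact_mod_cast h1
    linarith
  have hs1 : (1 : ℝ) ≤ s := by
    have hd' : (0 : ℝ) < d := by exact_mod_cast hd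
    have : (0 : ℝ) < c₀ * s := lt_of_lt_of_le (by positivity) hφ
    have : (0 : ℝ) < s := pos_of_mul_pos_right this hc₀.le
    have : 0 < s := by exact_mod_cast this
    exact_mod_cast this
  set P := (1 + localRate c₀ d) ^ k with hP
  have hPpos : 0 < P := by
    have := localRate_pos (c₀ := c₀) hc₀ hd
    positivity
  have h1 : (M.card : ℝ) * P ≤ 8 * Fintype.card V := by
    calc (M.card : ℝ) * P ≤ 4 * K₃.card * P := mul_le_mul_of_nonneg_right hK₃m hPpos.le
      _ = 4 * (K₃.card * (P * 1)) := by ring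
      _ ≤ 4 * (K₃.card * (P * s)) := by gcongr
      _ ≤ _ := by linarith
  have h2 : κ * ε * Fintype.card V < M.card := by
    have := mul_le_mul_of_nonneg_left hε hκ.le
    linarith
  have h3 : κ * ε * Fintype.card V * P < M.card * P := mul_lt_mul_of_pos_right h2 hPpos
  have h4 : 8 * (Fintype.card V : ℝ) ≤ κ * ε * P * Fintype.card V :=
    mul_le_mul_of_nonneg_right hk (Nat.cast_nonneg _)
  nlinarith

end SearchInstance

end ExpanderMatching

namespace ExpanderMatching

section

variable {N u h s s' ε η : ℝ}

theorem ratio_mono (hu : 0 < u) (hs : 0 ≤ s) (h : s ≤ s') (hs' : s' ≤ N) :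
    (s + u) / (N - s + u) ≤ (s' + u) / (N - s' + u) :=
  div_le_div₀ (by linarith) (by linarith) (by linarith) (by linarith)

theorem ratio_growth (hN : 0 < N) (hu : 0 < u) (hh : 0 ≤ h) (hs : 0 ≤ s) (hsN : s ≤ N)
    (hss : s + h * (u + s * (N - s) / N) ≤ s') (hs' : s' ≤ N) :
    (1 + h / 2) * ((s + u) / (N - s + u)) ≤ (s' + u) / (N - s' + u) := by
  have hf : 0 ≤ s * (N - s) / N := div_nonneg (mul_nonneg hs (by linarith)) hN.le
  have hle : s ≤ s' := by
    have := mul_nonneg hh (add_nonneg hu.le hf)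
    linarith
  rcases le_total s (N - s) with h1 | h1
  · have h2 : s / 2 ≤ s * (N - s) / N := by
      rw [le_div_iff₀ hN]
      nlinarith
    have h3 : (1 + h / 2) * (s + u) ≤ s' + u := by
      have : h * ((s + u) / 2) ≤ h * (u + s * (N - s) / N) :=
        mul_le_mul_of_nonneg_left (by linarith) hh
      linarith
    rw [← mul_div_assoc]
    exact div_le_div₀ (by linarith) h3 (by linarith) (by linarith)
  · have h2 : (N - s) / 2 ≤ s * (N - s) / N := by
      rw [le_div_iff₀ hN]
      nlinarith
    have h3 : N - s' + u ≤ (1 - h / 2) * (N - s + u) := by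
      have : h * ((N - s + u) / 2) ≤ h * (u + s * (N - s) / N) :=
        mul_le_mul_of_nonneg_left (by linarith) hh
      linarith
    have h4 : (1 + h / 2) * (N - s' + u) ≤ N - s + u := by
      have h5 := mul_le_mul_of_nonneg_left h3 (by linarith : 0 ≤ 1 + h / 2)
      have h6 : 0 ≤ h ^ 2 / 4 * (N - s + u) := mul_nonneg (by positivity) (by linarith)
      linarith
    rw [← mul_div_assoc, div_le_div_iff₀ (by linarith) (by linarith)]
    calc (1 + h / 2) * (s + u) * (N - s' + u) = (s + u) * ((1 + h / 2) * (N - s' + u)) := by ring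
      _ ≤ (s' + u) * (N - s + u) := mul_le_mul (by linarith) h4
        (mul_nonneg (by linarith) (by linarith)) (by linarith)

/-- Two bounded sequences whose sum grows in each step according to a logistic law can do so only
for a logarithmic number of steps. -/
theorem pow_le_of_logistic_growth {X B : ℕ → ℝ} {k : ℕ} (hN : 0 < N) (hu : 0 < u) (huN : u ≤ N)
    (hε : 0 < ε) (hεu : ε * N ≤ u) (hη : 0 ≤ η) (hX0 : 0 ≤ X 0) (hB0 : 0 ≤ B 0)
    (hX : Monotone X) (hB : Monotone B) (hXN : ∀ j, X j ≤ N) (hBN : ∀ j, B j ≤ N)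
    (hstep : ∀ j < k, η * (u + X j * (N - X j) / N + B j * (N - B j) / N) ≤
      (X (j + 1) - X j) + (B (j + 1) - B j)) :
    (1 + η / 4) ^ k ≤ 16 / ε ^ 4 := by
  set F : ℝ → ℝ := fun s => (s + u) / (N - s + u) with hF
  have hX0' : ∀ j, 0 ≤ X j := fun j => hX0.trans (hX (Nat.zero_le j))
  have hB0' : ∀ j, 0 ≤ B j := fun j => hB0.trans (hB (Nat.zero_le j))
  have hlow : ∀ s, 0 ≤ s → s ≤ N → ε / 2 ≤ F s := by
    intro s hs hsN
    rw [hF, le_div_iff₀ (by linarith)]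
    have : ε * (N - s) ≤ ε * N := mul_le_mul_of_nonneg_left (by linarith) hε.le
    have hε1 : ε ≤ 1 := by
      by_contra hlt
      nlinarith
    nlinarith
  have hhigh : ∀ s, 0 ≤ s → s ≤ N → F s ≤ 2 / ε := by
    intro s hs hsN
    rw [hF, div_le_div_iff₀ (by linarith) hε]
    have h1 : (s + u) * ε ≤ (2 * N) * ε := mul_le_mul_of_nonneg_right (by linarith) hε.le
    linarith
  have hpos : ∀ s, 0 ≤ s → s ≤ N → 0 < F s := fun s h1 h2 =>
    lt_of_lt_of_le (by positivity) (hlow s h1 h2)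
  have key : ∀ j ≤ k, (1 + η / 4) ^ j * (ε / 2 * (ε / 2)) ≤ F (X j) * F (B j) := by
    intro j
    induction j with
    | zero =>
      intro _
      rw [pow_zero, one_mul]
      exact mul_le_mul (hlow _ hX0 (hXN 0)) (hlow _ hB0 (hBN 0)) (by positivity)
        (hpos _ hX0 (hXN 0)).le
    | succ j ih =>
      intro hj
      have ih := ih (by omega)
      have hst := hstep j (by omega)
      have hXm := hX (Nat.le_succ j)
      have hBm := hB (Nat.le_succ j)
      have hfX : 0 ≤ X j * (N - X j) / N :=
        div_nonneg (mul_nonneg (hX0' j) (by linarith [hXN j])) hN.le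
      have hfB : 0 ≤ B j * (N - B j) / N :=
        div_nonneg (mul_nonneg (hB0' j) (by linarith [hBN j])) hN.le
      have e1 : 1 + η / 4 = 1 + η / 2 / 2 := by ring
      have hmX := ratio_mono hu (hX0' j) hXm (hXN _)
      have hmB := ratio_mono hu (hB0' j) hBm (hBN _)
      have main : (1 + η / 4) * (F (X j) * F (B j)) ≤ F (X (j + 1)) * F (B (j + 1)) := by
        rcases le_total (η / 2 * (u + X j * (N - X j) / N)) (X (j + 1) - X j) with h1 | h1
        · have h2 := ratio_growth hN hu (by linarith : 0 ≤ η / 2) (hX0' j) (hXN j)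
            (by linarith : _ ≤ X (j + 1)) (hXN _)
          rw [← mul_assoc, e1]
          exact mul_le_mul h2 hmB (hpos _ (hB0' j) (hBN j)).le (hpos _ (hX0' _) (hXN _)).le
        · have h2 := ratio_growth hN hu (by linarith : 0 ≤ η / 2) (hB0' j) (hBN j)
            (by nlinarith : _ ≤ B (j + 1)) (hBN _)
          rw [mul_left_comm, e1]
          exact mul_le_mul hmX h2 (mul_nonneg (by linarith) (hpos _ (hB0' j) (hBN j)).le)
            (hpos _ (hX0' _) (hXN _)).le
      calc (1 + η / 4) ^ (j + 1) * (ε / 2 * (ε / 2)) =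
          (1 + η / 4) * ((1 + η / 4) ^ j * (ε / 2 * (ε / 2))) := by ring
        _ ≤ (1 + η / 4) * (F (X j) * F (B j)) := mul_le_mul_of_nonneg_left ih (by linarith)
        _ ≤ _ := main
  have h1 := key k le_rfl
  have h2 : F (X k) * F (B k) ≤ 2 / ε * (2 / ε) :=
    mul_le_mul (hhigh _ (hX0' k) (hXN k)) (hhigh _ (hB0' k) (hBN k))
      (hpos _ (hB0' k) (hBN k)).le (by positivity)
  have h3 := h1.trans h2
  rw [← le_div_iff₀ (by positivity)] at h3
  refine h3.trans (le_of_eq ?_)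
  field_simp
  norm_num

theorem exists_pow_gt {x K : ℝ} (hx : 0 < x) (hK : 0 < K) : ∃ C : ℝ, 0 < C ∧ ∀ ε : ℝ, 0 < ε →
    ε ≤ 1 / 2 → ∃ k : ℕ, K / ε ^ 4 < (1 + x) ^ k ∧ (k : ℝ) ≤ C * Real.log (1 / ε) := by
  have h2 : 0 < Real.log 2 := Real.log_pos (by norm_num)
  have hlx : 0 < Real.log (1 + x) := Real.log_pos (by linarith)
  refine ⟨(|Real.log K| / Real.log 2 + 4) / Real.log (1 + x) + 1 / Real.log 2, by positivity,
    fun ε hε hε2 => ?_⟩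
  have hl : Real.log 2 ≤ Real.log (1 / ε) := by
    refine Real.log_le_log (by norm_num) ?_
    rw [le_div_iff₀ hε]
    linarith
  set l := Real.log (1 / ε) with hl'
  have hlog : Real.log (K / ε ^ 4) = Real.log K + 4 * l := by
    rw [hl', one_div, Real.log_inv, Real.log_div hK.ne' (by positivity), Real.log_pow]
    push_cast
    ring
  have hone : 1 ≤ l / Real.log 2 := (one_le_div h2).2 hl
  have hle : Real.log (K / ε ^ 4) ≤ (|Real.log K| / Real.log 2 + 4) * l := by
    rw [hlog]
    have h3 := le_abs_self (Real.log K)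
    have h4 := mul_le_mul_of_nonneg_left hone (abs_nonneg (Real.log K))
    have h5 : |Real.log K| / Real.log 2 * l = |Real.log K| * (l / Real.log 2) := by ring
    linarith
  refine ⟨⌊(|Real.log K| / Real.log 2 + 4) / Real.log (1 + x) * l⌋₊ + 1, ?_, ?_⟩
  · rw [← Real.log_lt_log_iff (by positivity) (by positivity), Real.log_pow]
    refine hle.trans_lt ?_
    rw [← div_lt_iff₀ hlx, mul_div_right_comm]
    push_cast
    exact Nat.lt_floor_add_one _
  · have hnn : 0 ≤ (|Real.log K| / Real.log 2 + 4) / Real.log (1 + x) * l :=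
      mul_nonneg (by positivity) (h2.le.trans hl)
    have h3 := Nat.floor_le hnn
    push_cast
    have h4 : 1 / Real.log 2 * l = l / Real.log 2 := by ring
    rw [add_mul]
    linarith

theorem growth_arith {d k ξ β Δ a M q cX cB c₀ κ : ℝ} (hd' : 1 ≤ d) (hk : 2 ≤ k) (hξ : 0 ≤ ξ)
    (hβ : 0 ≤ β) (hΔ : 0 ≤ Δ) (hc₀ : 0 < c₀) (hκ : (8 * d ^ 2 + 4 * d) * κ ≤ c₀ / 2)
    (hη1 : η * (8 * d ^ 2 + 4 * d + 8 * d * (4 * d ^ 2 + 2 * d)) ≤ 1)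
    (hη2 : η * (8 * d ^ 2 + 4 * d + 8 * d * (4 * d ^ 2 + 2 * d)) ≤ c₀ / 2)
    (hM : M ≤ 2 * κ * β + 8 * d * a) (h5 : c₀ * ξ ≤ cX) (h6 : c₀ * β ≤ cB)
    (k1 : d * k + cX + q ≤ 2 * (d * Δ) + 4 * (d * a) + 2 * (d * M) + 1)
    (k2 : cB ≤ 2 * (d * q) + d * Δ + 4 * (d * a) + 2 * (d * M)) :
    η * (k + ξ + β) ≤ Δ + a := by
  have k5 : 2 * d ^ 2 * k + 2 * (d * (c₀ * ξ)) + c₀ * β ≤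
      (4 * d ^ 2 + d) * Δ + (8 * d ^ 2 + 4 * d) * a + (4 * d ^ 2 + 2 * d) * M + 2 * d := by
    have e1 := mul_le_mul_of_nonneg_left k1 (by linarith : (0 : ℝ) ≤ 2 * d)
    have e2 := mul_le_mul_of_nonneg_left h5 (by linarith : (0 : ℝ) ≤ 2 * d)
    linarith
  have k6 : 2 * d + k ≤ 2 * d ^ 2 * k := by
    have e1 : d ≤ d ^ 2 := by nlinarith
    have e2 : d ^ 2 * 2 ≤ d ^ 2 * k := mul_le_mul_of_nonneg_left hk (by positivity)
    have e3 : (1 : ℝ) * k ≤ d ^ 2 * k := mul_le_mul_of_nonneg_right (by linarith) (by linarith)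
    linarith
  have k7 : (4 * d ^ 2 + 2 * d) * M ≤ c₀ / 2 * β +
      8 * d * (4 * d ^ 2 + 2 * d) * a := by
    have e1 := mul_le_mul_of_nonneg_left hM (by positivity : (0 : ℝ) ≤ 4 * d ^ 2 + 2 * d)
    have e2 := mul_le_mul_of_nonneg_right hκ hβ
    linarith
  have k8 : c₀ * ξ ≤ d * (c₀ * ξ) := le_mul_of_one_le_left (by positivity) hd'
  set C : ℝ := 8 * d ^ 2 + 4 * d + 8 * d * (4 * d ^ 2 + 2 * d) with hC
  have hCpos : 0 < C := by positivity
  have k9 : k + c₀ / 2 * (ξ + β) ≤ C * (Δ + a) := by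
    have e1 : (0 : ℝ) ≤ (4 * d ^ 2 + 3 * d + 8 * d * (4 * d ^ 2 + 2 * d)) * Δ := by positivity
    have e2 : (0 : ℝ) ≤ c₀ * ξ := by positivity
    rw [hC]
    linarith
  have k10 : C * (η * (k + ξ + β)) ≤ C * (Δ + a) := by
    have e1 := mul_le_mul_of_nonneg_right hη1 (by positivity : (0 : ℝ) ≤ k)
    have e2 := mul_le_mul_of_nonneg_right hη2 (by positivity : 0 ≤ ξ + β)
    linarith
  exact le_of_mul_le_mul_left k10 hCpos

end

variable {V : Type*} [DecidableEq V] [Fintype V] {G : SimpleGraph V} [DecidableRel G.Adj]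
  {m : V → V} {A U : Finset V} {n w L d : ℕ} {c₀ κ η : ℝ}

/-- Growth of a search without restrictions in one window. -/
theorem SearchInstance.logistic_growth (I : SearchInstance G m Finset.univ U)
    (hN : NoAug G m Finset.univ U L) (hL : n + w ≤ L) (hn : Even n) (hw : 1 ≤ w)
    (hU : 2 ≤ U.card) (hd : 1 ≤ d) (hreg : G.IsRegularOfDegree d) (hexp : IsExpander c₀ G)
    (hodd : ∀ H : Finset V, 3 ≤ H.card → Odd H.card → 2 ≤ Hᶜ.card → d + 1 ≤ cutSize G H)
    (hc₀ : 0 < c₀) (hκ0 : 0 ≤ κ) (hκ : (8 * d ^ 2 + 4 * d) * κ ≤ c₀ / 2)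
    (hη1 : η * (8 * d ^ 2 + 4 * d + 8 * d * (4 * d ^ 2 + 2 * d)) ≤ 1)
    (hη2 : η * (8 * d ^ 2 + 4 * d + 8 * d * (4 * d ^ 2 + 2 * d)) ≤ c₀ / 2)
    (hM1 : ((multis G m Finset.univ U n w).card : ℝ) ≤
      κ * (bothSet G m Finset.univ U n).card + d * (absorbed G m Finset.univ U n w).card)
    (hM2 : ((multis G m Finset.univ U n w).card : ℝ) ≤
      κ * (bothSet G m Finset.univ U n)ᶜ.card + 8 * d * (absorbed G m Finset.univ U n w).card) :
    η * (U.card + (reached G m Finset.univ U n).card *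
        (Fintype.card V - (reached G m Finset.univ U n).card) / Fintype.card V +
        (bothSet G m Finset.univ U n).card *
        (Fintype.card V - (bothSet G m Finset.univ U n).card) / Fintype.card V) ≤
      (((reached G m Finset.univ U (n + w)).card : ℝ) - (reached G m Finset.univ U n).card) +
      ((bothSet G m Finset.univ U (n + w)).card - (bothSet G m Finset.univ U n).card) := by
  obtain ⟨u, hu, u', hu', huu⟩ := Finset.one_lt_card.1 hU
  have huB : u' ∉ bothSet G m Finset.univ U n := fun h =>
    hN.root_notMem_in (by omega) hu' (mem_bothSet.1 h).2
  obtain ⟨h1, h2⟩ := I.growth hN hL hn hw hu huB huu hreg hodd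
  have h3 := card_bothSet_add_absorbed_le (G := G) (m := m) (A := Finset.univ) (U := U) (n := n)
    (w := w)
  have h4 := card_reached_add_sdiff (G := G) (m := m) (A := Finset.univ) (U := U) (n := n) (w := w)
  have h5 := hexp (reached G m Finset.univ U n)
  have h6 := hexp (bothSet G m Finset.univ U n)
  have h7 : ((bothSet G m Finset.univ U n).card : ℝ) + (bothSet G m Finset.univ U n)ᶜ.card =
      Fintype.card V := by exact_mod_cast Finset.card_add_card_compl _
  have h8 : ((reached G m Finset.univ U n).card : ℝ) + (reached G m Finset.univ U n)ᶜ.card =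
      Fintype.card V := by exact_mod_cast Finset.card_add_card_compl _
  have hV : (0 : ℝ) < Fintype.card V := by
    exact_mod_cast Fintype.card_pos_iff.2 ⟨u⟩
  have he : adjCount G (outSet G m Finset.univ U n) Finset.univᶜ = 0 := by simp [adjCount]
  rw [he] at h1 h2
  have hX : ((reached G m Finset.univ U n)ᶜ.card : ℝ) =
    Fintype.card V - (reached G m Finset.univ U n).card := by linarith
  have hB : ((bothSet G m Finset.univ U n)ᶜ.card : ℝ) =
    Fintype.card V - (bothSet G m Finset.univ U n).card := by linarith
  have hXnn : 0 ≤ (Fintype.card V : ℝ) - (reached G m Finset.univ U n).card := by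
    rw [← hX]; positivity
  have hBnn : 0 ≤ (Fintype.card V : ℝ) - (bothSet G m Finset.univ U n).card := by
    rw [← hB]; positivity
  rw [hX, mul_assoc, mul_div_assoc] at h5
  rw [hB, mul_assoc, mul_div_assoc] at h6
  rw [hB] at hM2
  generalize (reached G m Finset.univ U (n + w) \ reached G m Finset.univ U n).card = Δ at *
  generalize (absorbed G m Finset.univ U n w).card = a at *
  generalize (multis G m Finset.univ U n w).card = M at *
  generalize (comps G (bothSet G m Finset.univ U n)).card = q at *
  generalize (reached G m Finset.univ U (n + w)).card = X' at *
  generalize (bothSet G m Finset.univ U (n + w)).card = B' at *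
  generalize cutSize G (reached G m Finset.univ U n) = cX at *
  generalize cutSize G (bothSet G m Finset.univ U n) = cB at *
  generalize (reached G m Finset.univ U n).card = X at *
  generalize (bothSet G m Finset.univ U n).card = B at *
  generalize (Fintype.card V : ℝ) = N at *
  generalize U.card = k at *
  have hξ : 0 ≤ (X : ℝ) * (N - X) / N := by positivity
  have hβ : 0 ≤ (B : ℝ) * (N - B) / N := by positivity
  have hd' : (1 : ℝ) ≤ d := by exact_mod_cast hd
  have hM : (M : ℝ) ≤ 2 * κ * (B * (N - B) / N) + 8 * d * a := by
    have hda : (0 : ℝ) ≤ d * a := by positivity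
    rcases le_total (B : ℝ) (N - B) with h | h
    · have h9 : (B : ℝ) / 2 ≤ B * (N - B) / N := by
        rw [le_div_iff₀ hV]
        nlinarith
      have := mul_le_mul_of_nonneg_left h9 hκ0
      linarith
    · have h9 : (N - B) / 2 ≤ B * (N - B) / N := by
        rw [le_div_iff₀ hV]
        nlinarith
      have := mul_le_mul_of_nonneg_left h9 hκ0
      linarith
  generalize (X : ℝ) * (N - X) / N = ξ at *
  generalize (B : ℝ) * (N - B) / N = β at *
  have k1 : (d : ℝ) * k + cX + q ≤ 2 * (d * Δ) + 4 * (d * a) + 2 * (d * M) + 1 := by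
    exact_mod_cast h1
  have k2 : (cB : ℝ) ≤ 2 * (d * q) + d * Δ + 4 * (d * a) + 2 * (d * M) := by exact_mod_cast h2
  have k3 : (B : ℝ) + a ≤ B' := by exact_mod_cast h3
  have k4 : (X : ℝ) + Δ = X' := by exact_mod_cast h4
  have hk : (2 : ℝ) ≤ k := by exact_mod_cast hU
  have := growth_arith hd' hk hξ hβ (Nat.cast_nonneg Δ) hc₀ hκ hη1 hη2 hM h5 h6 k1 k2
  linarith

end ExpanderMatching

namespace ExpanderMatching

/-- In an expander without small odd cuts, a short augmenting path exists. -/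
theorem exists_not_noAug {c₀ : ℝ} (hc₀ : 0 < c₀) {d : ℕ} (hd : 1 ≤ d) :
    ∃ c : ℝ, 0 < c ∧ ∀ (V : Type*) [Fintype V] [DecidableEq V] (G : SimpleGraph V)
      [DecidableRel G.Adj] (m : V → V) (U : Finset V) (ε : ℝ),
      G.IsRegularOfDegree d → IsExpander c₀ G →
      (∀ H : Finset V, 3 ≤ H.card → Odd H.card → 2 ≤ Hᶜ.card → d + 1 ≤ cutSize G H) →
      SearchInstance G m Finset.univ U → 2 ≤ U.card → 0 < ε → ε ≤ 1 / 2 →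
      ε * Fintype.card V ≤ U.card →
      ∃ L : ℕ, (L : ℝ) ≤ c * Real.log (1 / ε) ^ 3 ∧ ¬ NoAug G m Finset.univ U L := by
  have hd' : (0 : ℝ) < d := by exact_mod_cast hd
  set κ : ℝ := c₀ / (2 * (8 * d ^ 2 + 4 * d)) with hκ
  have hκ0 : 0 < κ := by positivity
  have hκ1 : (8 * (d : ℝ) ^ 2 + 4 * d) * κ ≤ c₀ / 2 := by
    rw [hκ]
    apply le_of_eq
    field_simp
  set D : ℝ := 8 * d ^ 2 + 4 * d + 8 * d * (4 * d ^ 2 + 2 * d) with hD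
  have hD0 : 0 < D := by positivity
  set η : ℝ := min 1 (c₀ / 2) / D with hη
  have hη0 : 0 < η := by positivity
  have hηD : η * D = min 1 (c₀ / 2) := div_mul_cancel₀ _ hD0.ne'
  obtain ⟨s₀, hs₀⟩ := exists_nat_ge (max (32 * (d + 8 * d / κ) / c₀) (1 / κ + 1))
  obtain ⟨w₁, hw₁⟩ := exists_nat_ge (8 * d / c₀)
  obtain ⟨C₁, hC₁, h₁⟩ := exists_pow_gt (localRate_pos (c₀ := c₀) hc₀ hd)
    (by positivity : 0 < 8 / κ)
  obtain ⟨C₂, hC₂, h₂⟩ := exists_pow_gt (by positivity : 0 < η / 4) (by norm_num : (0 : ℝ) < 16)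
  set s := 2 * s₀ with hs
  set w₀ := 2 * w₁ + 2 with hw₀
  have hs₀' : (0 : ℝ) ≤ s₀ := Nat.cast_nonneg _
  have hsφ : 32 * (d + 8 * d / κ) ≤ c₀ * s := by
    have h1 := (le_max_left _ _).trans hs₀
    rw [div_le_iff₀ hc₀] at h1
    push_cast [hs]
    nlinarith
  have hsκ : 1 ≤ κ * (s - 1) := by
    have h1 := (le_max_right _ _).trans hs₀
    have h2 : 1 / κ ≤ s - 1 := by
      push_cast [hs]
      linarith
    rwa [div_le_iff₀' hκ0] at h2
  have hwc : 8 * d ≤ c₀ * ((w₀ : ℝ) - 2) := by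
    rw [div_le_iff₀ hc₀] at hw₁
    push_cast [hw₀]
    have : (0 : ℝ) ≤ w₁ := Nat.cast_nonneg _
    nlinarith
  have hl2 : 0 < Real.log 2 := Real.log_pos (by norm_num)
  refine ⟨C₂ * ((s + 2) / Real.log 2 + C₁ * w₀) / Real.log 2, by positivity, ?_⟩
  intro V _ _ G _ m U ε hreg hexp hodd I hU hε hε2 hεU
  have hl : Real.log 2 ≤ Real.log (1 / ε) := by
    refine Real.log_le_log (by norm_num) ?_
    rw [le_div_iff₀ hε]
    linarith
  obtain ⟨k₁, hk₁, hk₁'⟩ := h₁ ε hε hε2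
  obtain ⟨k₂, hk₂, hk₂'⟩ := h₂ ε hε hε2
  set l := Real.log (1 / ε) with hl'
  set w := s + k₁ * w₀ + 2 with hw
  have hwe : Even w := by
    rw [hw, hs, hw₀]
    exact ⟨s₀ + k₁ * (w₁ + 1) + 1, by ring⟩
  refine ⟨k₂ * w, ?_, fun hN => ?_⟩
  · have hone : 1 ≤ l / Real.log 2 := (one_le_div hl2).2 hl
    have hl0 : 0 < l := hl2.trans_le hl
    have e1 : (w : ℝ) ≤ ((s + 2) / Real.log 2 + C₁ * w₀) * l := by
      have e2 := mul_le_mul_of_nonneg_left hone (by positivity : (0 : ℝ) ≤ s + 2)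
      have e3 := mul_le_mul_of_nonneg_right hk₁' (Nat.cast_nonneg (α := ℝ) w₀)
      rw [hw]
      push_cast
      have e4 : (s + 2) / Real.log 2 * l = ((s : ℝ) + 2) * (l / Real.log 2) := by ring
      rw [add_mul, e4]
      linarith
    have e5 : (k₂ : ℝ) * w ≤ C₂ * l * (((s + 2) / Real.log 2 + C₁ * w₀) * l) :=
      mul_le_mul hk₂' e1 (Nat.cast_nonneg _) (by positivity)
    push_cast
    refine e5.trans ?_
    have e6 := mul_le_mul_of_nonneg_left hone (by positivity :
      0 ≤ C₂ * l * (((s + 2) / Real.log 2 + C₁ * w₀) * l))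
    rw [mul_one] at e6
    refine e6.trans (le_of_eq ?_)
    ring
  · have hUN : (U.card : ℝ) ≤ Fintype.card V := by exact_mod_cast Finset.card_le_univ U
    have hUpos : (0 : ℝ) < U.card := by
      have : (2 : ℝ) ≤ U.card := by exact_mod_cast hU
      linarith
    have hk₁8 : 8 ≤ κ * ε * (1 + localRate c₀ d) ^ k₁ := by
      have e1 : 8 / κ / ε ≤ 8 / κ / ε ^ 4 := by
        refine div_le_div_of_nonneg_left (by positivity) (by positivity) ?_
        exact pow_le_of_le_one hε.le (by linarith) (by norm_num)
      have e2 := e1.trans hk₁.le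
      rw [div_div, div_le_iff₀ (by positivity)] at e2
      linarith
    have hcard : ∀ S : Finset V, (S.card : ℝ) ≤ Fintype.card V := fun S => by
      exact_mod_cast Finset.card_le_univ S
    have hmono : ∀ i j : ℕ, i ≤ j → i * w ≤ j * w := fun i j h => Nat.mul_le_mul_right w h
    refine absurd (pow_le_of_logistic_growth (N := Fintype.card V) (u := U.card) (ε := ε) (η := η)
      (X := fun j => ((reached G m Finset.univ U (j * w)).card : ℝ))
      (B := fun j => ((bothSet G m Finset.univ U (j * w)).card : ℝ)) (k := k₂)
      (hUpos.trans_le hUN) hUpos hUN hε hεU hη0.le (Nat.cast_nonneg _) (Nat.cast_nonneg _)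
      (fun i j h => Nat.cast_le.2 (Finset.card_le_card (reached_mono (hmono i j h))))
      (fun i j h => Nat.cast_le.2 (Finset.card_le_card (bothSet_mono (hmono i j h))))
      (fun j => hcard _) (fun j => hcard _) fun j hj => ?_) (not_le.2 hk₂)
    have hL : j * w + w ≤ k₂ * w := by
      rw [← Nat.succ_mul]
      exact hmono _ _ hj
    have hje : Even (j * w) := hwe.mul_left j
    have hBc : ε * Fintype.card V ≤ (bothSet G m Finset.univ U (j * w))ᶜ.card := by
      refine hεU.trans ?_
      have : U ⊆ (bothSet G m Finset.univ U (j * w))ᶜ := fun u hu =>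
        Finset.mem_compl.2 fun h => hN.root_notMem_in (by omega) hu (mem_bothSet.1 h).2
      exact_mod_cast Finset.card_le_card this
    have hM2 := I.card_multis_le_compl hN hL hje (s := s) (w₀ := w₀) (k := k₁) (by simp [hs])
      ⟨w₁ + 1, by omega⟩ (by omega) hwc hd hc₀ hreg hexp hodd (by omega) hκ0 hsφ hk₁8 hBc
    have hM1 : ((multis G m Finset.univ U (j * w) w).card : ℝ) ≤
        κ * (bothSet G m Finset.univ U (j * w)).card +
          d * (absorbed G m Finset.univ U (j * w) w).card := by
      have e1 := I.card_multis_le hN hL hje (r := s) (by omega) hreg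
      have hs1 : (1 : ℝ) < s := by
        by_contra h
        nlinarith
      have hs1' : 1 ≤ s := by exact_mod_cast hs1.le
      have e2 : ((s : ℝ) - 1) * (multis G m Finset.univ U (j * w) w).card ≤
          (bothSet G m Finset.univ U (j * w)).card +
            (s - 1) * (d * (absorbed G m Finset.univ U (j * w) w).card) := by
        have := (Nat.cast_le (α := ℝ)).2 e1
        push_cast [Nat.cast_sub hs1'] at this
        exact this
      have e3 := mul_le_mul_of_nonneg_right hsκ
        (Nat.cast_nonneg (α := ℝ) (bothSet G m Finset.univ U (j * w)).card)
      refine le_of_mul_le_mul_left (e2.trans ?_) (sub_pos.2 hs1)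
      linarith
    have := I.logistic_growth hN hL hje (by omega) hU hd hreg hexp hodd hc₀ hκ0.le hκ1
      (hηD.trans_le (min_le_left _ _)) (hηD.trans_le (min_le_right _ _)) hM1 hM2
    simpa only [Nat.succ_mul] using this

end ExpanderMatching

namespace ExpanderMatching

variable {V : Type*} {G : SimpleGraph V}

theorem exists_walk_getVert (l : ℕ) (p : ℕ → V) (h : ∀ i < l, G.Adj (p i) (p (i + 1))) :
    ∃ q : G.Walk (p 0) (p l), q.length = l ∧ ∀ i ≤ l, q.getVert i = p i := by
  induction l generalizing p with
  | zero => exact ⟨SimpleGraph.Walk.nil, rfl, fun i hi => by simp [Nat.le_zero.1 hi]⟩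
  | succ l ih =>
    obtain ⟨q, hq, hi⟩ := ih (fun i => p (i + 1)) fun i hi => h (i + 1) (by omega)
    refine ⟨SimpleGraph.Walk.cons (h 0 (by omega)) q, by simp [hq], fun i hil => ?_⟩
    cases i with
    | zero => simp
    | succ i =>
      rw [SimpleGraph.Walk.getVert_cons_succ]
      exact hi i (by omega)

open Classical in
/-- The mate of a vertex in the matching `M`; unmatched vertices are their own mates. -/
noncomputable def mate (M : G.Subgraph) (v : V) : V :=
  if h : ∃ w, M.Adj v w then h.choose else v

variable {M : G.Subgraph} {v w : V}

theorem mate_eq_of_adj (hM : M.IsMatching) (h : M.Adj v w) : mate M v = w := by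
  have hex : ∃ w, M.Adj v w := ⟨w, h⟩
  rw [mate, dif_pos hex]
  exact (hM (M.edge_vert h)).unique hex.choose_spec h

theorem mate_eq_self (h : v ∉ M.verts) : mate M v = v :=
  dif_neg fun ⟨_, hw⟩ => h (M.edge_vert hw)

theorem adj_mate (hM : M.IsMatching) (h : v ∈ M.verts) : M.Adj v (mate M v) := by
  obtain ⟨w, hw, -⟩ := hM h
  rwa [mate_eq_of_adj hM hw]

theorem mate_mate (hM : M.IsMatching) (v : V) : mate M (mate M v) = v := by
  by_cases h : v ∈ M.verts
  · exact mate_eq_of_adj hM (adj_mate hM h).symm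
  · rw [mate_eq_self h, mate_eq_self h]

theorem searchInstance_mate [Fintype V] (hM : M.IsMatching) {U : Finset V}
    (hU : ∀ v, v ∈ U ↔ v ∉ M.verts) : SearchInstance G (mate M) Finset.univ U where
  inv := mate_mate hM
  madj := fun v hv => by
    by_cases h : v ∈ M.verts
    · exact (adj_mate hM h).adj_sub
    · exact absurd (mate_eq_self h) hv
  sub := Finset.subset_univ U
  root := fun u hu _ => mate_eq_self ((hU u).1 hu)
  mate := fun v _ hv => by
    have h : v ∈ M.verts := by
      by_contra h
      exact hv ((hU v).2 h)
    exact ⟨Finset.mem_univ _, (adj_mate hM h).adj_sub.ne'⟩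

theorem AltPath.exists_isAugmentingPath (hM : M.IsMatching) {p : ℕ → V} {l : ℕ}
    (hp : AltPath G (mate M) p l) (hl : Odd l) (h0 : p 0 ∉ M.verts) (h1 : p l ∉ M.verts) :
    ∃ q : G.Walk (p 0) (p l), IsAugmentingPath M q ∧ q.length = l := by
  obtain ⟨q, hq, hi⟩ := exists_walk_getVert l p hp.adj
  refine ⟨q, ⟨⟨?_, ?_⟩, by rwa [hq], h0, h1⟩, hq⟩
  · rw [← SimpleGraph.Walk.IsPath.getVert_injOn_iff]
    intro i hil j hjl h
    have hil : i ≤ l := hq ▸ hil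
    have hjl : j ≤ l := hq ▸ hjl
    rw [hi i hil, hi j hjl] at h
    exact hp.inj i hil j hjl h
  · intro i hil
    rw [hq] at hil
    rw [hi i hil.le, hi (i + 1) hil, ← hp.alt i hil]
    refine ⟨mate_eq_of_adj hM, fun h => ?_⟩
    rw [← h]
    refine adj_mate hM ?_
    by_contra hv
    rw [mate_eq_self hv] at h
    exact (hp.adj i hil).ne h

end ExpanderMatching

/-- The restriction `ε ≤ 1 / 2` concerns only the rate: a matching that leaves more than
half of the vertices unmatched is covered by `ε = 1 / 2`. The set `H` has at least two
vertices outside it, so that neither `H = V` nor the complement of a single vertex counts. -/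
theorem short_augmenting_path_in_finite_expanders
    (c₀ : ℝ) (hc₀ : 0 < c₀) (d : ℕ) (hd : 3 ≤ d) :
    ∃ c : ℝ, 0 < c ∧
      ∀ (V : Type*) [Fintype V] [DecidableEq V] (G : SimpleGraph V) [DecidableRel G.Adj],
        G.IsRegularOfDegree d → ExpanderMatching.IsExpander c₀ G →
        ∀ M : G.Subgraph, M.IsMatching →
        2 ≤ (M.vertsᶜ : Set V).ncard →
        ∀ ε : ℝ, 0 < ε → ε ≤ 1 / 2 →
        ε * (Fintype.card V : ℝ) ≤ ((M.vertsᶜ : Set V).ncard : ℝ) →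
        (∃ (x y : V) (p : G.Walk x y), ExpanderMatching.IsAugmentingPath M p ∧
          (p.length : ℝ) ≤ c * (Real.log (1 / ε)) ^ 3) ∨
        (∃ H : Finset V, 3 ≤ H.card ∧ Odd H.card ∧ 2 ≤ Hᶜ.card ∧
          ExpanderMatching.cutSize G H ≤ d) := by
  obtain ⟨c, hc, h⟩ := ExpanderMatching.exists_not_noAug hc₀ (by omega : 1 ≤ d)
  refine ⟨c, hc, ?_⟩
  intro V _ _ G _ hreg hexp M hM h2 ε hε hε2 hεU
  classical
  by_contra hcon
  rw [not_or] at hcon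
  obtain ⟨hpath, hcut⟩ := hcon
  have hodd : ∀ H : Finset V, 3 ≤ H.card → Odd H.card → 2 ≤ Hᶜ.card →
      d + 1 ≤ ExpanderMatching.cutSize G H := by
    intro H h1 h2 h3
    by_contra hlt
    exact hcut ⟨H, h1, h2, h3, by omega⟩
  have hU : ∀ v, v ∈ (M.vertsᶜ : Set V).toFinset ↔ v ∉ M.verts := fun v => by simp
  rw [Set.ncard_eq_toFinset_card'] at h2 hεU
  obtain ⟨L, hL, hN⟩ := h V G (ExpanderMatching.mate M) _ ε hreg hexp hodd
    (ExpanderMatching.searchInstance_mate hM hU) h2 hε hε2 hεU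
  refine hN fun u hu l hl hlo hr => ?_
  obtain ⟨p, hp, h0, -, rfl⟩ := hr
  obtain ⟨q, hq, hql⟩ := hp.exists_isAugmentingPath hM hlo ((hU _).1 h0) ((hU _).1 hu)
  refine hpath ⟨_, _, q, hq, le_trans ?_ hL⟩
  rw [hql]
  exact_mod_cast hl
end

section
/- Let $G=(V,E)$ be an infinite, connected, locally finite simple graph. A cut is given by a nonempty finite vertex set $A \subset V$; its size is the number of edges between $A$ and $V \setminus A$, and a best cut is a cut of minimum size. Let $A \neq B$ be nonempty finite vertex sets each defining a best cut. Then: (1) either at least one of $A \setminus B$ and $B \setminus A$ is empty, or both $A \setminus B$ and $B \setminus A$ define best cuts; (2) either $A \cap B$ is empty, or both $A \cap B$ and $A \cup B$ define best cuts. In particular, if $A \setminus B$, $B \setminus A$ and $A \cap B$ are all nonempty, then each of the four sets $A \setminus B$, $B \setminus A$, $A \cup B$, $A \cap B$ defines a best cut. -/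
namespace PaperPM

/-- `E(X, Y)`: the edges of `G` with one endpoint in `X` and one endpoint in `Y`. -/
def edgesBetween {V : Type*} (G : SimpleGraph V) (X Y : Set V) : Set (Sym2 V) :=
  {e | e ∈ G.edgeSet ∧ ∃ u ∈ X, ∃ v ∈ Y, e = s(u, v)}

/-- The number of edges between `A` and its complement. In a locally finite graph the edge set
counted here is finite whenever `A` is finite, so `Set.ncard` is its true cardinality. -/
noncomputable def cutSize {V : Type*} (G : SimpleGraph V) (A : Set V) : ℕ :=
  (edgesBetween G A Aᶜ).ncard

/-- `A` defines a best cut of `G`: it is a nonempty finite vertex set whose cut size is minimal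
among all nonempty finite vertex sets. -/
def IsBestCut {V : Type*} (G : SimpleGraph V) (A : Set V) : Prop :=
  A.Nonempty ∧ A.Finite ∧
    ∀ C : Set V, C.Nonempty → C.Finite → cutSize G A ≤ cutSize G C

end PaperPM

namespace PaperPM

theorem mk_mem_edgesBetween_compl {V : Type*} {G : SimpleGraph V} {A : Set V} {u v : V} :
    s(u, v) ∈ edgesBetween G A Aᶜ ↔ G.Adj u v ∧ ¬(u ∈ A ↔ v ∈ A) := by
  simp only [edgesBetween, Set.mem_ofPred_eq, SimpleGraph.mem_edgeSet, Set.mem_compl_iff,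
    Sym2.eq_iff]
  refine and_congr_right fun _ => ⟨?_, fun h => ?_⟩
  · rintro ⟨x, hx, y, hy, ⟨rfl, rfl⟩ | ⟨rfl, rfl⟩⟩ <;> tauto
  · by_cases hu : u ∈ A
    · exact ⟨u, hu, v, by tauto, .inl ⟨rfl, rfl⟩⟩
    · exact ⟨v, by tauto, u, hu, .inr ⟨rfl, rfl⟩⟩

/-- Finite vertex sets of locally finite graphs define finite cuts. -/
theorem finite_edgesBetween {V : Type*} {G : SimpleGraph V}
    (hlocfin : ∀ v : V, (G.neighborSet v).Finite) {A : Set V} (hA : A.Finite) (B : Set V) :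
    (edgesBetween G A B).Finite := by
  refine (hA.biUnion fun u _ => (hlocfin u).image fun v => s(u, v)).subset ?_
  rintro e ⟨he, u, hu, v, -, rfl⟩
  exact Set.mem_biUnion hu ⟨v, he, rfl⟩

theorem ncard_add_ncard_le_of_union_subset_of_inter_subset {α : Type*} {s t u v : Set α}
    (hu : u.Finite) (hv : v.Finite) (hunion : s ∪ t ⊆ u ∪ v) (hinter : s ∩ t ⊆ u ∩ v) :
    s.ncard + t.ncard ≤ u.ncard + v.ncard := by
  have hst : (s ∪ t).Finite := (hu.union hv).subset hunion
  rw [← Set.ncard_union_add_ncard_inter s t (hst.subset Set.subset_union_left)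
      (hst.subset Set.subset_union_right), ← Set.ncard_union_add_ncard_inter u v hu hv]
  exact Nat.add_le_add (Set.ncard_le_ncard hunion (hu.union hv))
    (Set.ncard_le_ncard hinter (hu.inter_of_left v))

/-- The cut size is submodular. -/
theorem cutSize_inter_add_cutSize_union_le {V : Type*} {G : SimpleGraph V}
    (hlocfin : ∀ v : V, (G.neighborSet v).Finite) {A B : Set V} (hA : A.Finite) (hB : B.Finite) :
    cutSize G (A ∩ B) + cutSize G (A ∪ B) ≤ cutSize G A + cutSize G B := by
  refine ncard_add_ncard_le_of_union_subset_of_inter_subset (finite_edgesBetween hlocfin hA _)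
    (finite_edgesBetween hlocfin hB _) ?_ ?_ <;> rintro ⟨u, v⟩ <;>
  simp only [Set.mem_union, Set.mem_inter_iff, mk_mem_edgesBetween_compl] <;> tauto

/-- The cut size is posimodular. -/
theorem cutSize_diff_add_cutSize_diff_le {V : Type*} {G : SimpleGraph V}
    (hlocfin : ∀ v : V, (G.neighborSet v).Finite) {A B : Set V} (hA : A.Finite) (hB : B.Finite) :
    cutSize G (A \ B) + cutSize G (B \ A) ≤ cutSize G A + cutSize G B := by
  refine ncard_add_ncard_le_of_union_subset_of_inter_subset (finite_edgesBetween hlocfin hA _)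
    (finite_edgesBetween hlocfin hB _) ?_ ?_ <;> rintro ⟨u, v⟩ <;>
  simp only [Set.mem_union, Set.mem_inter_iff, Set.mem_sdiff, mk_mem_edgesBetween_compl] <;> tauto

theorem IsBestCut.of_cutSize_add_le {V : Type*} {G : SimpleGraph V} {A B C D : Set V}
    (hA : IsBestCut G A) (hB : IsBestCut G B) (hC : C.Nonempty) (hC' : C.Finite)
    (hD : D.Nonempty) (hD' : D.Finite)
    (h : cutSize G C + cutSize G D ≤ cutSize G A + cutSize G B) :
    IsBestCut G C ∧ IsBestCut G D := by
  have hBC := hB.2.2 C hC hC'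
  have hAD := hA.2.2 D hD hD'
  exact ⟨⟨hC, hC', fun E hE hE' => by have := hB.2.2 E hE hE'; omega⟩,
    ⟨hD, hD', fun E hE hE' => by have := hA.2.2 E hE hE'; omega⟩⟩

end PaperPM

theorem best_cut_lattice {V : Type*} [Infinite V] (G : SimpleGraph V)
    (hconn : G.Connected)
    (hlocfin : ∀ v : V, (G.neighborSet v).Finite)
    (A B : Set V) (hA : PaperPM.IsBestCut G A) (hB : PaperPM.IsBestCut G B) (hAB : A ≠ B) :
    (A \ B = ∅ ∨ B \ A = ∅ ∨
      (PaperPM.IsBestCut G (A \ B) ∧ PaperPM.IsBestCut G (B \ A))) ∧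
    (A ∩ B = ∅ ∨
      (PaperPM.IsBestCut G (A ∩ B) ∧ PaperPM.IsBestCut G (A ∪ B))) := by
  have hAf := hA.2.1
  have hBf := hB.2.1
  constructor
  · rcases (A \ B).eq_empty_or_nonempty with h | h
    · exact .inl h
    rcases (B \ A).eq_empty_or_nonempty with h' | h'
    · exact .inr (.inl h')
    exact .inr (.inr (hA.of_cutSize_add_le hB h hAf.sdiff h' hBf.sdiff
      (PaperPM.cutSize_diff_add_cutSize_diff_le hlocfin hAf hBf)))
  · rcases (A ∩ B).eq_empty_or_nonempty with h | h
    · exact .inl h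
    exact .inr (hA.of_cutSize_add_le hB h (hAf.inter_of_left B) (hA.1.mono Set.subset_union_left)
      (hAf.union hBf) (PaperPM.cutSize_inter_add_cutSize_union_le hlocfin hAf hBf))
end

section
/- Let $d \ge 3$ and let $G$ be an infinite, connected, $d$-regular, vertex-transitive simple graph. A real cut is a finite vertex set with at least $2$ elements, and its size is the number of edges between it and its complement. Then either every real cut has size strictly greater than $d$, or every vertex of $G$ is contained in exactly one clique of size $d$. -/
namespace RealCut

/-- A graph is vertex-transitive if any vertex can be taken to any other by an automorphism. -/
def IsVertexTransitive {V : Type*} (G : SimpleGraph V) : Prop :=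
  ∀ x y : V, ∃ φ : G ≃g G, φ x = y

/-- `E(X, Y)`: the set of (undirected) edges with one endpoint in `X` and one endpoint in `Y`. -/
def edgesBetween {V : Type*} (G : SimpleGraph V) (X Y : Set V) : Set (Sym2 V) :=
  {e | e ∈ G.edgeSet ∧ ∃ u ∈ X, ∃ v ∈ Y, e = s(u, v)}

/-- The size of the cut defined by `A`: the number of edges between `A` and its complement.
For finite `A` in a locally finite graph this set of edges is finite. -/
noncomputable def cutSize {V : Type*} (G : SimpleGraph V) (A : Set V) : ℕ :=
  (edgesBetween G A Aᶜ).ncard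

/-- A real cut of an infinite graph is given by a finite vertex set with at least two elements. -/
def IsRealCut {V : Type*} (A : Set V) : Prop :=
  A.Finite ∧ 2 ≤ A.ncard

end RealCut

open scoped Classical in
/-- The number of ordered pairs `(x, y)` of adjacent vertices with `x ∈ X` and `y ∈ Y`. -/
noncomputable def RealCut.adjPairs {V : Type*} (G : SimpleGraph V) (X Y : Finset V) : ℕ :=
  ∑ x ∈ X, ∑ y ∈ Y, if G.Adj x y then 1 else 0

/-- An atom is a finite set with at least two elements whose cut is smallest possible and which
has the fewest elements among all such sets. -/
structure RealCut.IsCutAtom {V : Type*} (G : SimpleGraph V) (A : Finset V) : Prop where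
  two_le_card : 2 ≤ A.card
  cut_le : ∀ B : Finset V, 2 ≤ B.card →
    RealCut.cutSize G (A : Set V) ≤ RealCut.cutSize G (B : Set V)
  card_le : ∀ B : Finset V, 2 ≤ B.card →
    RealCut.cutSize G (B : Set V) ≤ RealCut.cutSize G (A : Set V) → A.card ≤ B.card

namespace RealCut

open scoped Classical

variable {V : Type*} {G : SimpleGraph V}

lemma adjPairs_comm (X Y : Finset V) : adjPairs G X Y = adjPairs G Y X := by
  unfold adjPairs
  rw [Finset.sum_comm]
  simp only [G.adj_comm]

lemma adjPairs_union_left {X X' : Finset V} (h : Disjoint X X') (Y : Finset V) :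
    adjPairs G (X ∪ X') Y = adjPairs G X Y + adjPairs G X' Y :=
  Finset.sum_union h

lemma adjPairs_union_right {Y Y' : Finset V} (X : Finset V) (h : Disjoint Y Y') :
    adjPairs G X (Y ∪ Y') = adjPairs G X Y + adjPairs G X Y' := by
  rw [adjPairs_comm, adjPairs_union_left h, adjPairs_comm Y, adjPairs_comm Y']

lemma adjPairs_eq_sum_card [G.LocallyFinite] (X Y : Finset V) :
    adjPairs G X Y = ∑ x ∈ X, (G.neighborFinset x ∩ Y).card := by
  refine Finset.sum_congr rfl fun x _ => ?_
  rw [← Finset.card_filter]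
  congr 1
  ext y
  simp [and_comm]

lemma adjPairs_le [G.LocallyFinite] {d : ℕ} (hreg : G.IsRegularOfDegree d) (X Y : Finset V) :
    adjPairs G X Y ≤ d * X.card := by
  rw [adjPairs_eq_sum_card, mul_comm, ← smul_eq_mul]
  refine Finset.sum_le_card_nsmul _ _ _ fun x _ => ?_
  rw [← hreg x, ← G.card_neighborFinset_eq_degree]
  exact Finset.card_le_card Finset.inter_subset_left

lemma cutSize_eq_sum_card [G.LocallyFinite] (A : Finset V) :
    cutSize G (A : Set V) = ∑ x ∈ A, (G.neighborFinset x \ A).card := by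
  have himg : edgesBetween G (A : Set V) (A : Set V)ᶜ =
      (fun p : (_ : V) × V => s(p.1, p.2)) ''
        (A.sigma fun x => G.neighborFinset x \ A : Finset ((_ : V) × V)) := by
    ext e
    constructor
    · rintro ⟨he, u, hu, v, hv, rfl⟩
      exact ⟨⟨u, v⟩, by simpa using ⟨hu, he, hv⟩, rfl⟩
    · rintro ⟨⟨u, v⟩, h, rfl⟩
      simp only [Finset.mem_coe, Finset.mem_sigma, Finset.mem_sdiff,
        SimpleGraph.mem_neighborFinset] at h
      exact ⟨h.2.1, u, h.1, v, h.2.2, rfl⟩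
  rw [cutSize, himg, Set.InjOn.ncard_image, Set.ncard_coe_finset, Finset.card_sigma]
  rintro ⟨u, v⟩ h ⟨u', v'⟩ h' he
  simp only [Finset.mem_coe, Finset.mem_sigma, Finset.mem_sdiff] at h h'
  rcases Sym2.eq_iff.1 he with ⟨rfl, rfl⟩ | ⟨rfl, rfl⟩
  · rfl
  · exact absurd h.1 h'.2.2

lemma cutSize_add_adjPairs [G.LocallyFinite] {d : ℕ} (hreg : G.IsRegularOfDegree d)
    (A : Finset V) : cutSize G (A : Set V) + adjPairs G A A = d * A.card := by
  rw [cutSize_eq_sum_card, adjPairs_eq_sum_card, ← Finset.sum_add_distrib, mul_comm, ← smul_eq_mul]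
  refine Finset.sum_eq_card_nsmul fun x _ => ?_
  rw [Finset.card_sdiff_add_card_inter, G.card_neighborFinset_eq_degree, hreg x]

/-- The decomposition of `adjPairs G S S` along a partition of `S` into two parts. -/
lemma adjPairs_union_self {P C : Finset V} (h : Disjoint P C) :
    adjPairs G (P ∪ C) (P ∪ C) = adjPairs G P P + 2 * adjPairs G P C + adjPairs G C C := by
  rw [adjPairs_union_left h, adjPairs_union_right _ h, adjPairs_union_right _ h,
    adjPairs_comm C P]
  ring

/-- The cut function is submodular. -/
lemma cutSize_inter_add_cutSize_union_le [G.LocallyFinite] {d : ℕ}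
    (hreg : G.IsRegularOfDegree d) (A B : Finset V) :
    cutSize G ((A ∩ B : Finset V) : Set V) + cutSize G ((A ∪ B : Finset V) : Set V) ≤
      cutSize G (A : Set V) + cutSize G (B : Set V) := by
  have hP : Disjoint (A \ B) (A ∩ B) := Finset.disjoint_sdiff_inter A B
  have hQ : Disjoint (B \ A) (A ∩ B) := by
    rw [Finset.inter_comm]; exact Finset.disjoint_sdiff_inter B A
  have hA : (A \ B) ∪ (A ∩ B) = A := Finset.sdiff_union_inter A B
  have hB : (B \ A) ∪ (A ∩ B) = B := by
    rw [Finset.inter_comm]; exact Finset.sdiff_union_inter B A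
  have hU : (B \ A) ∪ A = A ∪ B := by
    rw [Finset.sdiff_union_self_eq_union, Finset.union_comm]
  have hBA : Disjoint (B \ A) A := Finset.sdiff_disjoint
  have eA := adjPairs_union_self (G := G) hP
  have eB := adjPairs_union_self (G := G) hQ
  have eU := adjPairs_union_self (G := G) hBA
  have eX := adjPairs_union_right (G := G) (B \ A) hP
  rw [hA] at eA eX
  rw [hB] at eB
  rw [hU] at eU
  have h1 := cutSize_add_adjPairs hreg A
  have h2 := cutSize_add_adjPairs hreg B
  have h3 := cutSize_add_adjPairs hreg (A ∩ B)
  have h4 := cutSize_add_adjPairs hreg (A ∪ B)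
  have hc : d * (A ∪ B).card + d * (A ∩ B).card = d * A.card + d * B.card := by
    rw [← mul_add, Finset.card_union_add_card_inter, mul_add]
  omega

/-- The cut function is posimodular. -/
lemma cutSize_sdiff_add_cutSize_sdiff_le [G.LocallyFinite] {d : ℕ}
    (hreg : G.IsRegularOfDegree d) (A B : Finset V) :
    cutSize G ((A \ B : Finset V) : Set V) + cutSize G ((B \ A : Finset V) : Set V) ≤
      cutSize G (A : Set V) + cutSize G (B : Set V) := by
  have hP : Disjoint (A \ B) (A ∩ B) := Finset.disjoint_sdiff_inter A B
  have hQ : Disjoint (B \ A) (A ∩ B) := by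
    rw [Finset.inter_comm]; exact Finset.disjoint_sdiff_inter B A
  have hA : (A \ B) ∪ (A ∩ B) = A := Finset.sdiff_union_inter A B
  have hB : (B \ A) ∪ (A ∩ B) = B := by
    rw [Finset.inter_comm]; exact Finset.sdiff_union_inter B A
  have hBA : Disjoint (B \ A) A := Finset.sdiff_disjoint
  have eA := adjPairs_union_self (G := G) hP
  have eB := adjPairs_union_self (G := G) hQ
  have eX := adjPairs_union_right (G := G) (A ∩ B) hBA
  have eY := adjPairs_union_right (G := G) (A ∩ B) hP
  have hle := adjPairs_le hreg (A ∩ B) (B \ A ∪ A)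
  rw [adjPairs_comm _ (A ∩ B)] at eA eB
  rw [hA] at eA eY
  rw [hB] at eB
  have h1 := cutSize_add_adjPairs hreg A
  have h2 := cutSize_add_adjPairs hreg B
  have h3 := cutSize_add_adjPairs hreg (A \ B)
  have h4 := cutSize_add_adjPairs hreg (B \ A)
  have hcA : d * (A \ B).card + d * (A ∩ B).card = d * A.card := by
    rw [← mul_add, Finset.card_sdiff_add_card_inter]
  have hcB : d * (B \ A).card + d * (A ∩ B).card = d * B.card := by
    rw [← mul_add, Finset.inter_comm, Finset.card_sdiff_add_card_inter]
  omega

lemma neighborFinset_map_sdiff [G.LocallyFinite] (φ : G ≃g G) (A : Finset V) (x : V) :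
    G.neighborFinset (φ x) \ A.map φ.toEquiv.toEmbedding =
      (G.neighborFinset x \ A).map φ.toEquiv.toEmbedding := by
  ext y
  obtain ⟨z, rfl⟩ := φ.surjective y
  change φ.toEquiv.toEmbedding z ∈ _ ↔ φ.toEquiv.toEmbedding z ∈ _
  rw [Finset.mem_map', Finset.mem_sdiff, Finset.mem_sdiff, Finset.mem_map',
    SimpleGraph.mem_neighborFinset, SimpleGraph.mem_neighborFinset]
  exact and_congr_left fun _ => φ.map_adj_iff

lemma cutSize_map [G.LocallyFinite] (φ : G ≃g G) (A : Finset V) :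
    cutSize G ((A.map φ.toEquiv.toEmbedding : Finset V) : Set V) = cutSize G (A : Set V) := by
  rw [cutSize_eq_sum_card, cutSize_eq_sum_card, Finset.sum_map]
  refine Finset.sum_congr rfl fun x _ => ?_
  exact (congrArg Finset.card (neighborFinset_map_sdiff φ A x)).trans (Finset.card_map _)

lemma IsCutAtom.map [G.LocallyFinite] {A : Finset V} (hA : IsCutAtom G A) (φ : G ≃g G) :
    IsCutAtom G (A.map φ.toEquiv.toEmbedding) where
  two_le_card := by simpa using hA.two_le_card
  cut_le B hB := by simpa only [cutSize_map] using hA.cut_le B hB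
  card_le B hB h := by
    rw [cutSize_map] at h
    simpa using hA.card_le B hB h

lemma exists_isCutAtom {B : Finset V} (hB : 2 ≤ B.card) : ∃ A : Finset V, IsCutAtom G A := by
  obtain ⟨A, hA, hmin⟩ := exists_minimal_of_wellFoundedLT
    (fun p : ℕ ×ₗ ℕ => ∃ A : Finset V, 2 ≤ A.card ∧ p = toLex (cutSize G (A : Set V), A.card))
    ⟨_, B, hB, rfl⟩
  obtain ⟨A, hA2, rfl⟩ := hA
  have key (C : Finset V) (hC : 2 ≤ C.card) :
      toLex (cutSize G (A : Set V), A.card) ≤ toLex (cutSize G (C : Set V), C.card) :=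
    (le_total _ _).elim id fun h => hmin ⟨C, hC, rfl⟩ h
  simp only [Prod.Lex.toLex_le_toLex] at key
  refine ⟨A, hA2, fun C hC => ?_, fun C hC h => ?_⟩
  · rcases key C hC with h | h <;> omega
  · rcases key C hC with h | h <;> omega

lemma IsCutAtom.three_le_card [G.LocallyFinite] {d : ℕ} (hd : 3 ≤ d)
    (hreg : G.IsRegularOfDegree d) {A : Finset V} (hA : IsCutAtom G A)
    (hcut : cutSize G (A : Set V) ≤ d) : 3 ≤ A.card := by
  by_contra hlt
  have h2 : A.card = 2 := by have := hA.two_le_card; omega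
  have hsum := cutSize_add_adjPairs hreg A
  have hle : adjPairs G A A ≤ A.card • 1 := by
    rw [adjPairs_eq_sum_card]
    refine Finset.sum_le_card_nsmul _ _ _ fun x hx => ?_
    have hsub : G.neighborFinset x ∩ A ⊆ A.erase x := fun y hy => by
      simp only [Finset.mem_inter, SimpleGraph.mem_neighborFinset] at hy
      exact Finset.mem_erase.2 ⟨hy.1.ne', hy.2⟩
    have := Finset.card_le_card hsub
    rw [Finset.card_erase_of_mem hx] at this
    omega
  rw [h2] at hsum hle
  simp at hle
  omega

/-- Two atoms which meet are equal. -/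
lemma IsCutAtom.eq_of_mem [G.LocallyFinite] {d : ℕ} (hd : 3 ≤ d)
    (hreg : G.IsRegularOfDegree d) {A B : Finset V} (hA : IsCutAtom G A) (hB : IsCutAtom G B)
    (hcut : cutSize G (A : Set V) ≤ d) {x : V} (hxA : x ∈ A) (hxB : x ∈ B) : A = B := by
  by_contra hne
  have h3 := hA.three_le_card hd hreg hcut
  have hAB : cutSize G (A : Set V) = cutSize G (B : Set V) :=
    le_antisymm (hA.cut_le B hB.two_le_card) (hB.cut_le A hA.two_le_card)
  have hcard : A.card = B.card :=
    le_antisymm (hA.card_le B hB.two_le_card hAB.ge) (hB.card_le A hA.two_le_card hAB.le)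
  have hpos : 0 < (A ∩ B).card := Finset.card_pos.2 ⟨x, Finset.mem_inter.2 ⟨hxA, hxB⟩⟩
  have hlt : (A ∩ B).card < A.card := by
    refine Finset.card_lt_card (Finset.ssubset_iff_subset_ne.2 ⟨Finset.inter_subset_left, ?_⟩)
    exact fun h => hne (Finset.eq_of_subset_of_card_le (Finset.inter_eq_left.1 h) hcard.ge)
  have hsA := Finset.card_sdiff_add_card_inter A B
  have hsB := Finset.card_sdiff_add_card_inter B A
  rw [Finset.inter_comm] at hsB
  have small (C : Finset V) (h2 : 2 ≤ C.card) (hC : C.card < A.card) :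
      cutSize G (A : Set V) < cutSize G (C : Set V) := by
    by_contra h
    have := hA.card_le C h2 (not_lt.1 h)
    omega
  by_cases h2 : 2 ≤ (A ∩ B).card
  · have h4 := small _ h2 hlt
    have h5 := hA.cut_le (A ∪ B) (h2.trans (Finset.card_le_card Finset.inter_subset_union))
    have := cutSize_inter_add_cutSize_union_le hreg A B
    omega
  · have h4 := small (A \ B) (by omega) (by omega)
    have h5 := small (B \ A) (by omega) (by omega)
    have := cutSize_sdiff_add_cutSize_sdiff_le hreg A B
    omega

/-- Every vertex of an atom has the same number of neighbours outside the atom. -/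
lemma IsCutAtom.card_sdiff_eq [G.LocallyFinite] {d : ℕ} (hd : 3 ≤ d)
    (hreg : G.IsRegularOfDegree d) (htrans : IsVertexTransitive G) {A : Finset V}
    (hA : IsCutAtom G A) (hcut : cutSize G (A : Set V) ≤ d) {x y : V} (hx : x ∈ A) (hy : y ∈ A) :
    (G.neighborFinset y \ A).card = (G.neighborFinset x \ A).card := by
  obtain ⟨φ, rfl⟩ := htrans x y
  have h : A = A.map φ.toEquiv.toEmbedding :=
    hA.eq_of_mem hd hreg (hA.map φ) hcut hy (Finset.mem_map_of_mem φ.toEquiv.toEmbedding hx)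
  conv_lhs => rw [h]
  rw [neighborFinset_map_sdiff, Finset.card_map]

lemma exists_adj_notMem [Infinite V] (hconn : G.Connected) {A : Finset V} {x : V} (hx : x ∈ A) :
    ∃ u ∈ A, ∃ v ∉ A, G.Adj u v := by
  by_contra! h
  obtain ⟨z, hz⟩ := Infinite.exists_notMem_finset A
  obtain ⟨p⟩ := hconn.preconnected x z
  obtain ⟨e, -, h1, h2⟩ := p.exists_boundary_dart (A : Set V) hx hz
  exact h _ h1 _ h2 e.adj

/-- An atom with a cut of size at most `d` is a `d`-clique, and each of its vertices has
exactly one neighbour outside. -/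
lemma IsCutAtom.isNClique_and_card_sdiff [Infinite V] [G.LocallyFinite] {d : ℕ} (hd : 3 ≤ d)
    (hconn : G.Connected) (hreg : G.IsRegularOfDegree d) (htrans : IsVertexTransitive G)
    {A : Finset V} (hA : IsCutAtom G A) (hcut : cutSize G (A : Set V) ≤ d) :
    G.IsNClique d A ∧ ∀ x ∈ A, (G.neighborFinset x \ A).card = 1 := by
  have h3 := hA.three_le_card hd hreg hcut
  obtain ⟨x₀, hx₀⟩ := Finset.card_pos.1 (by omega : 0 < A.card)
  obtain ⟨u, hu, v, hv, huv⟩ := exists_adj_notMem hconn hx₀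
  obtain ⟨s, hs⟩ : ∃ s, s = (G.neighborFinset u \ A).card := ⟨_, rfl⟩
  have hconst : ∀ x ∈ A, (G.neighborFinset x \ A).card = s := fun x hx =>
    hs ▸ hA.card_sdiff_eq hd hreg htrans hcut hu hx
  have hspos : 1 ≤ s := hs ▸ Finset.card_pos.2 ⟨v, by simp [huv, hv]⟩
  have hcuts : A.card * s ≤ d := by
    rwa [cutSize_eq_sum_card, Finset.sum_eq_card_nsmul hconst, smul_eq_mul] at hcut
  have hsub (x : V) : G.neighborFinset x ∩ A ⊆ A.erase x := fun y hy => by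
    simp only [Finset.mem_inter, SimpleGraph.mem_neighborFinset] at hy
    exact Finset.mem_erase.2 ⟨hy.1.ne', hy.2⟩
  have hdeg : ∀ x ∈ A, s + (G.neighborFinset x ∩ A).card = d := fun x hx => by
    rw [← hconst x hx, Finset.card_sdiff_add_card_inter, G.card_neighborFinset_eq_degree, hreg x]
  have hle : d + 1 ≤ A.card + s := by
    have h1 := Finset.card_le_card (hsub u)
    rw [Finset.card_erase_of_mem hu] at h1
    have := hdeg u hu
    omega
  have hs1 : s = 1 := by
    by_contra hne
    have h2 : 2 ≤ s := by omega
    have hsd : s < d := by nlinarith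
    nlinarith
  subst hs1
  have hcardA : A.card = d := by omega
  refine ⟨⟨fun x hx y hy hxy => ?_, hcardA⟩, hconst⟩
  have heq : G.neighborFinset x ∩ A = A.erase x := by
    refine Finset.eq_of_subset_of_card_le (hsub x) ?_
    have := hdeg x hx
    rw [Finset.card_erase_of_mem hx]
    omega
  have hmem : y ∈ G.neighborFinset x ∩ A := heq ▸ Finset.mem_erase.2 ⟨hxy.symm, hy⟩
  exact (G.mem_neighborFinset x y).1 (Finset.mem_inter.1 hmem).1

end RealCut

open scoped Classical in
/-- In an infinite, connected, `d`-regular, vertex-transitive simple graph with `3 ≤ d`, either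
every real cut has size strictly greater than `d`, or every vertex is contained in exactly one
clique of size `d`. -/
theorem real_cut_or_cliques {V : Type*} [Infinite V] (G : SimpleGraph V) [G.LocallyFinite]
    (d : ℕ) (hd : 3 ≤ d) (hconn : G.Connected) (hreg : G.IsRegularOfDegree d)
    (htrans : RealCut.IsVertexTransitive G) :
    (∀ A : Set V, RealCut.IsRealCut A → d < RealCut.cutSize G A) ∨
      (∀ v : V, ∃! K : Finset V, G.IsNClique d K ∧ v ∈ K) := by
  refine or_iff_not_imp_left.2 fun hsmall => ?_
  push Not at hsmall
  obtain ⟨S, ⟨hfin, hS⟩, hSd⟩ := hsmall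
  lift S to Finset V using hfin
  rw [Set.ncard_coe_finset] at hS
  obtain ⟨A₀, hA₀⟩ := RealCut.exists_isCutAtom (G := G) hS
  have hcut {A : Finset V} (hA : RealCut.IsCutAtom G A) : RealCut.cutSize G (A : Set V) ≤ d :=
    (hA.cut_le S hS).trans hSd
  have hcover (v : V) : ∃ A : Finset V, RealCut.IsCutAtom G A ∧ v ∈ A := by
    obtain ⟨x, hx⟩ := Finset.card_pos.1 (by have := hA₀.two_le_card; omega : 0 < A₀.card)
    obtain ⟨φ, rfl⟩ := htrans x v
    exact ⟨_, hA₀.map φ, Finset.mem_map_of_mem φ.toEquiv.toEmbedding hx⟩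
  intro v
  obtain ⟨A, hA, hvA⟩ := hcover v
  obtain ⟨hAclique, hAout⟩ := hA.isNClique_and_card_sdiff hd hconn hreg htrans (hcut hA)
  refine ⟨A, ⟨hAclique, hvA⟩, ?_⟩
  rintro K ⟨hK, hvK⟩
  by_contra hne
  obtain ⟨w, hwK, hwA⟩ : ∃ w ∈ K, w ∉ A := by
    by_contra! h
    exact hne (Finset.eq_of_subset_of_card_le h (by rw [hK.card_eq, hAclique.card_eq]))
  have hvw : v ≠ w := fun h => hwA (h ▸ hvA)
  obtain ⟨u, huK, hu⟩ : ∃ u ∈ K, u ∉ ({v, w} : Finset V) := by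
    refine Finset.exists_mem_notMem_of_card_lt_card ?_
    rw [Finset.card_pair hvw, hK.card_eq]
    omega
  simp only [Finset.mem_insert, Finset.mem_singleton, not_or] at hu
  have huA : u ∈ A := by
    by_contra huA
    refine hu.2 (Finset.card_le_one.1 (hAout v hvA).le u ?_ w ?_)
    · simpa using ⟨hK.isClique hvK huK (Ne.symm hu.1), huA⟩
    · simpa using ⟨hK.isClique hvK hwK hvw, hwA⟩
  obtain ⟨B, hB, hwB⟩ := hcover w
  obtain ⟨-, hBout⟩ := hB.isNClique_and_card_sdiff hd hconn hreg htrans (hcut hB)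
  have hdisj {z : V} (hz : z ∈ A) : z ∉ B := fun hzB =>
    hwA (hA.eq_of_mem hd hreg hB (hcut hA) hz hzB ▸ hwB)
  refine hu.1 (Finset.card_le_one.1 (hBout w hwB).le u ?_ v ?_)
  · simpa using ⟨hK.isClique hwK huK (Ne.symm hu.2), hdisj huA⟩
  · simpa using ⟨hK.isClique hwK hvK hvw.symm, hdisj hvA⟩
end
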